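/- Let n ≥ 1 and 1 < p < ∞. The symbol μ_2(ξ,τ) := |τ|^{1/2}·(1 + 4π²|ξ|² + iτ)^{−1/2} is an Lᵖ(ℝ^{n+1})-multiplier; that is, there exists M > 0 (depending only on n, p) such that ‖𝓕⁻¹(μ_2·𝓕f)‖_{Lᵖ} ≤ M·‖f‖_{Lᵖ} for every Schwartz function f on ℝ^{n+1}. -/

import Mathlib

noncomputable section

open MeasureTheory Real Complex
open scoped ENNReal NNReal Real BigOperators

/-- Euclidean space `ℝⁿ`. -/
abbrev Rn (n : ℕ) : Type := EuclideanSpace ℝ (Fin n)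

/-- The space `ℝ^{n+1} = ℝⁿ × ℝ`, points written `(X, t)`. -/
abbrev Rn1 (n : ℕ) : Type := EuclideanSpace ℝ (Fin n) × ℝ

/-- Fourier transform on `ℝ^{n+1}`:
`𝓕f(ξ,τ) = ∫ e^{−2πi(X·ξ + tτ)} f(X,t) dX dt`. -/
def FT1 {n : ℕ} (f : Rn1 n → ℂ) (q : Rn1 n) : ℂ :=
  ∫ p : Rn1 n,
    Complex.exp (-(2 * (π : ℂ) * Complex.I) *
      (((∑ k, p.1 k * q.1 k) + p.2 * q.2 : ℝ) : ℂ)) * f p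

/-- Inverse Fourier transform on `ℝ^{n+1}`. -/
def IFT1 {n : ℕ} (f : Rn1 n → ℂ) (x : Rn1 n) : ℂ :=
  ∫ q : Rn1 n,
    Complex.exp ((2 * (π : ℂ) * Complex.I) *
      (((∑ k, q.1 k * x.1 k) + q.2 * x.2 : ℝ) : ℂ)) * f q

/-- The Fourier multiplier operator `f ↦ 𝓕⁻¹(m · 𝓕 f)` on `ℝ^{n+1}`. -/
def MOp {n : ℕ} (m : Rn1 n → ℂ) (f : Rn1 n → ℂ) : Rn1 n → ℂ :=
  IFT1 (fun q => m q * FT1 f q)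

/-- The symbol `m_α(ξ,τ) = (1 + 4π²|ξ|² + iτ)^{α/2}` (principal branch). -/
def mSym {n : ℕ} (α : ℝ) (q : Rn1 n) : ℂ :=
  (1 + 4 * (π : ℂ) ^ 2 * (‖q.1‖ : ℂ) ^ 2 + Complex.I * (q.2 : ℂ)) ^ ((α : ℂ) / 2)

/-- Partial derivative `∂_{X_k}`. -/
def dX {n : ℕ} (k : Fin n) (f : Rn1 n → ℂ) : Rn1 n → ℂ :=
  fun x => fderiv ℝ f x (EuclideanSpace.single k 1, 0)

/-- Partial derivative `∂_t`. -/
def dT {n : ℕ} (f : Rn1 n → ℂ) : Rn1 n → ℂ :=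
  fun x => fderiv ℝ f x (0, 1)

/-- Iterated spatial derivative `D_X^β` for a multi-index `β`. -/
def dXmulti {n : ℕ} (β : Fin n → ℕ) (f : Rn1 n → ℂ) : Rn1 n → ℂ :=
  (List.finRange n).foldr (fun k g => (dX k)^[β k] g) f

/-- The half time-derivative `D_t^{1/2} f = 𝓕⁻¹(|τ|^{1/2}·𝓕f)`. -/
def halfDt {n : ℕ} (f : Rn1 n → ℂ) : Rn1 n → ℂ :=
  MOp (fun q => ((|q.2| ^ ((1 : ℝ) / 2) : ℝ) : ℂ)) f

/-- The `Lᵖ(ℝ^{n+1})` norm (as a value in `ℝ≥0∞`), `p` a real exponent. -/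
def pNorm {n : ℕ} (p : ℝ) (f : Rn1 n → ℂ) : ℝ≥0∞ :=
  eLpNorm f (ENNReal.ofReal p) volume

/-- Multi-indices `β ∈ ℕⁿ` with `|β| = N`. -/
def multiIdx (n N : ℕ) : Finset (Fin n → ℕ) :=
  (Fintype.piFinset fun _ : Fin n => Finset.range (N + 1)).filter fun β => (∑ k, β k) = N

/-- Convolution on `ℝ^{n+1}`. -/
def conv1 {n : ℕ} (g f : Rn1 n → ℂ) : Rn1 n → ℂ :=
  fun x => ∫ y : Rn1 n, g (x - y) * f y

/-- A parabolic Littlewood–Paley family on `ℝ^{n+1}`. -/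
structure ParabolicLP (n : ℕ) where
  φ : SchwartzMap (Rn1 n) ℂ
  ψ : SchwartzMap (Rn1 n) ℂ
  ft_pos : ∀ q : Rn1 n,
    1 / 2 < ‖q.1‖ + |q.2| ^ ((1 : ℝ) / 2) → ‖q.1‖ + |q.2| ^ ((1 : ℝ) / 2) < 2 →
      0 < (FT1 (⇑φ) q).re ∧ (FT1 (⇑φ) q).im = 0
  ft_supp : ∀ q : Rn1 n,
    ¬(1 / 2 < ‖q.1‖ + |q.2| ^ ((1 : ℝ) / 2) ∧ ‖q.1‖ + |q.2| ^ ((1 : ℝ) / 2) < 2) →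
      FT1 (⇑φ) q = 0
  ft_sum : ∀ q : Rn1 n, q ≠ 0 →
    ∑' i : ℤ, FT1 (⇑φ) (((2 : ℝ) ^ (-i)) • q.1, ((2 : ℝ) ^ (-(2 * i))) * q.2) = 1
  ft_psi : ∀ q : Rn1 n,
    FT1 (⇑ψ) q =
      1 - ∑' i : ℕ,
        FT1 (⇑φ) (((2 : ℝ) ^ (-((i : ℤ) + 1))) • q.1, ((2 : ℝ) ^ (-(2 * ((i : ℤ) + 1)))) * q.2)

/-- The dilate `φ_i`, whose Fourier transform is `𝓕φ(2^{−i}ξ, 2^{−2i}τ)`. -/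
def lpPhi {n : ℕ} (P : ParabolicLP n) (i : ℕ) : Rn1 n → ℂ :=
  fun x => (((2 : ℝ) ^ (i * (n + 2)) : ℝ) : ℂ) *
    P.φ (((2 : ℝ) ^ i) • x.1, ((2 : ℝ) ^ (2 * i)) * x.2)

/-- Parabolic Besov norm `N_{s,p}(f)` on `ℝ^{n+1}`, `1 ≤ p < ∞`. -/
def pBesov {n : ℕ} (P : ParabolicLP n) (s p : ℝ) (f : Rn1 n → ℂ) : ℝ≥0∞ :=
  eLpNorm (conv1 (⇑P.ψ) f) (ENNReal.ofReal p) volume +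
  (∑' i : ℕ,
    (ENNReal.ofReal ((2 : ℝ) ^ (s * ((i : ℝ) + 1))) *
      eLpNorm (conv1 (lpPhi P (i + 1)) f) (ENNReal.ofReal p) volume) ^ p) ^ (1 / p)

/-- Parabolic Besov norm `N_{s,∞}(f)` on `ℝ^{n+1}`. -/
def pBesovInf {n : ℕ} (P : ParabolicLP n) (s : ℝ) (f : Rn1 n → ℂ) : ℝ≥0∞ :=
  max (eLpNorm (conv1 (⇑P.ψ) f) ⊤ volume)
    (⨆ i : ℕ, ENNReal.ofReal ((2 : ℝ) ^ (s * ((i : ℝ) + 1))) *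
      eLpNorm (conv1 (lpPhi P (i + 1)) f) ⊤ volume)

/-- The time interval `(0, T)` for `0 < T ≤ ∞`. -/
def tSet (T : ℝ≥0∞) : Set ℝ := {t : ℝ | 0 < t ∧ ENNReal.ofReal t < T}

/-- Lebesgue measure restricted to the strip `ℝⁿ × (0,T)`. -/
def stripMeasure (n : ℕ) (T : ℝ≥0∞) : Measure (Rn1 n) :=
  volume.restrict {x : Rn1 n | x.2 ∈ tSet T}

/-- The parabolic Sobolev norm `‖g‖_{W^{2i,i}_p(ℝⁿ_T)}`. -/
def wNorm {n : ℕ} (i : ℕ) (p : ℝ) (T : ℝ≥0∞) (g : Rn1 n → ℂ) : ℝ≥0∞ :=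
  ∑ l ∈ Finset.range (i + 1),
    ∑ β ∈ (Fintype.piFinset fun _ : Fin n => Finset.range (2 * i + 1)).filter
        (fun β => (∑ k, β k) + 2 * l ≤ 2 * i),
      eLpNorm (dXmulti β (dT^[l] g)) (ENNReal.ofReal p) (stripMeasure n T)

/-- Time-regularity seminorm `[g]_{t,β,p,T}`. -/
def semT {n : ℕ} (b p : ℝ) (T : ℝ≥0∞) (g : Rn1 n → ℂ) : ℝ≥0∞ :=
  (∫⁻ X : Rn n, ∫⁻ t in tSet T, ∫⁻ s in tSet T,
      ENNReal.ofReal (‖g (X, t) - g (X, s)‖ ^ p / |t - s| ^ (1 + p * b / 2))) ^ (1 / p)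

/-- Space-regularity seminorm `[g]_{x,β,p,T}`. -/
def semX {n : ℕ} (b p : ℝ) (T : ℝ≥0∞) (g : Rn1 n → ℂ) : ℝ≥0∞ :=
  (∫⁻ t in tSet T, ∫⁻ X : Rn n, ∫⁻ Y : Rn n,
      ENNReal.ofReal (‖g (X + Y, t) - 2 * g (X, t) + g (X - Y, t)‖ ^ p /
        ‖Y‖ ^ ((n : ℝ) + p * b))) ^ (1 / p)

/-- The parabolic Besov norm `‖g‖_{B^{α,α/2}_p(ℝⁿ_T)}`, formed with index `i` where
`2i < α < 2i+2`. -/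
def pbNorm {n : ℕ} (i : ℕ) (α p : ℝ) (T : ℝ≥0∞) (g : Rn1 n → ℂ) : ℝ≥0∞ :=
  wNorm i p T g +
  ∑ l ∈ Finset.range (i + 1),
    ∑ β ∈ (Fintype.piFinset fun _ : Fin n => Finset.range (2 * i + 1)).filter
        (fun β => (∑ k, β k) + 2 * l = 2 * i),
      (semT (α - 2 * i) p T (dXmulti β (dT^[l] g)) +
        semX (α - 2 * i) p T (dXmulti β (dT^[l] g)))

/-- Fourier transform on `ℝⁿ`. -/
def FTn {n : ℕ} (f : Rn n → ℂ) (ξ : Rn n) : ℂ :=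
  ∫ x : Rn n, Complex.exp (-(2 * (π : ℂ) * Complex.I) * (((∑ k, x k * ξ k : ℝ)) : ℂ)) * f x

/-- Inverse Fourier transform on `ℝⁿ`. -/
def IFTn {n : ℕ} (f : Rn n → ℂ) (x : Rn n) : ℂ :=
  ∫ ξ : Rn n, Complex.exp ((2 * (π : ℂ) * Complex.I) * (((∑ k, ξ k * x k : ℝ)) : ℂ)) * f ξ

/-- Convolution on `ℝⁿ`. -/
def convn {n : ℕ} (g f : Rn n → ℂ) : Rn n → ℂ := fun x => ∫ y : Rn n, g (x - y) * f y

/-- A Littlewood–Paley family on `ℝⁿ`. -/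
structure LPFamily (n : ℕ) where
  φ : SchwartzMap (Rn n) ℂ
  ψ : SchwartzMap (Rn n) ℂ
  ft_pos : ∀ ξ : Rn n, 1 / 2 < ‖ξ‖ → ‖ξ‖ < 2 →
    0 < (FTn (⇑φ) ξ).re ∧ (FTn (⇑φ) ξ).im = 0
  ft_supp : ∀ ξ : Rn n, ¬(1 / 2 < ‖ξ‖ ∧ ‖ξ‖ < 2) → FTn (⇑φ) ξ = 0
  ft_sum : ∀ ξ : Rn n, ξ ≠ 0 → ∑' i : ℤ, FTn (⇑φ) (((2 : ℝ) ^ (-i)) • ξ) = 1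
  ft_psi : ∀ ξ : Rn n,
    FTn (⇑ψ) ξ = 1 - ∑' i : ℕ, FTn (⇑φ) (((2 : ℝ) ^ (-((i : ℤ) + 1))) • ξ)

/-- The dilate `φ′_i(x) = 2^{in} φ′(2^i x)`. -/
def lpPhin {n : ℕ} (P : LPFamily n) (i : ℕ) : Rn n → ℂ :=
  fun x => (((2 : ℝ) ^ (i * n) : ℝ) : ℂ) * P.φ (((2 : ℝ) ^ i) • x)

/-- Besov norm `B_{s,p}(f)` on `ℝⁿ`, `1 ≤ p < ∞`. -/
def besovN {n : ℕ} (P : LPFamily n) (s p : ℝ) (f : Rn n → ℂ) : ℝ≥0∞ :=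
  eLpNorm (convn (⇑P.ψ) f) (ENNReal.ofReal p) volume +
  (∑' i : ℕ,
    (ENNReal.ofReal ((2 : ℝ) ^ (s * ((i : ℝ) + 1))) *
      eLpNorm (convn (lpPhin P (i + 1)) f) (ENNReal.ofReal p) volume) ^ p) ^ (1 / p)

/-- The heat kernel `Γ(X,t)` on `ℝⁿ` (zero for `t ≤ 0`). -/
def heatKer (n : ℕ) (X : Rn n) (t : ℝ) : ℝ :=
  if 0 < t then (4 * π * t) ^ (-(n : ℝ) / 2) * Real.exp (-‖X‖ ^ 2 / (4 * t)) else 0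

/-- The heat extension `u(X,t) = ∫ Γ(X−Y,t) f(Y) dY`. -/
def heatExt {n : ℕ} (f : Rn n → ℂ) : Rn1 n → ℂ :=
  fun x => ∫ Y : Rn n, (heatKer n (x.1 - Y) x.2 : ℂ) * f Y

/-! ### Parabolic dyadic cubes -/

/-- The index of the parabolic dyadic cube of generation `j` containing a point. -/
def cubeIdx {m : ℕ} (j : ℤ) (x : Rn1 m) : (Fin m → ℤ) × ℤ :=
  (fun k => ⌊x.1 k / 2 ^ j⌋, ⌊x.2 / 4 ^ j⌋)

/-- The volume of a parabolic dyadic cube of generation `j`. -/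
def cubeVol (m : ℕ) (j : ℤ) : ℝ := ((2 : ℝ) ^ j) ^ m * 4 ^ j

lemma cubeVol_pos (m : ℕ) (j : ℤ) : 0 < cubeVol m j := by
  unfold cubeVol; positivity

lemma cubeVol_succ (m : ℕ) (j : ℤ) : cubeVol m (j + 1) = (2 ^ m * 4) * cubeVol m j := by
  unfold cubeVol
  rw [zpow_add_one₀ (by norm_num), zpow_add_one₀ (by norm_num), mul_pow]
  ring

lemma le_cubeVol (m j : ℕ) : (j : ℝ) ≤ cubeVol m j := by
  have h1 : (1 : ℝ) ≤ ((2 : ℝ) ^ (j : ℤ)) ^ m :=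
    one_le_pow₀ (by rw [zpow_natCast]; exact one_le_pow₀ (by norm_num))
  have h2 : (j : ℝ) ≤ 4 ^ (j : ℤ) := by
    rw [zpow_natCast]
    exact_mod_cast (Nat.lt_pow_self (by norm_num : 1 < 4) (n := j)).le
  unfold cubeVol
  nlinarith [h2, h1, (Nat.cast_nonneg j : (0 : ℝ) ≤ j)]

lemma measurable_cubeIdx {m : ℕ} (j : ℤ) : Measurable (cubeIdx (m := m) j) := by
  unfold cubeIdx
  refine Measurable.prodMk (measurable_pi_lambda _ fun k => ?_) ?_
  · refine Int.measurable_floor.comp (Measurable.div_const ?_ _)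
    fun_prop
  · exact Int.measurable_floor.comp (measurable_snd.div_const _)

lemma measurableSet_cubeIdx_eq {m : ℕ} (j : ℤ) (i : (Fin m → ℤ) × ℤ) :
    MeasurableSet {x : Rn1 m | cubeIdx j x = i} :=
  measurable_cubeIdx j (measurableSet_singleton i)

lemma floor_div_nat_congr {a b : ℝ} (k : ℕ) (h : ⌊a⌋ = ⌊b⌋) : ⌊a / k⌋ = ⌊b / k⌋ := by
  rw [Int.floor_div_natCast, Int.floor_div_natCast, h]

lemma cubeIdx_succ_congr {m : ℕ} {j : ℤ} {x y : Rn1 m} (h : cubeIdx j x = cubeIdx j y) :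
    cubeIdx (j + 1) x = cubeIdx (j + 1) y := by
  unfold cubeIdx at *
  rw [Prod.mk.injEq] at *
  refine ⟨funext fun k => ?_, ?_⟩
  · have := floor_div_nat_congr 2 (congrFun h.1 k)
    rwa [div_div, div_div, Nat.cast_ofNat, ← zpow_add_one₀ (by norm_num)] at this
  · have := floor_div_nat_congr 4 h.2
    rwa [div_div, div_div, Nat.cast_ofNat, ← zpow_add_one₀ (by norm_num)] at this

lemma cubeIdx_congr_of_le {m : ℕ} {j k : ℤ} (hjk : j ≤ k) {x y : Rn1 m}
    (h : cubeIdx j x = cubeIdx j y) : cubeIdx k x = cubeIdx k y := by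
  induction k, hjk using Int.leInduction with
  | base => exact h
  | succ k _ ih => exact cubeIdx_succ_congr ih

lemma setOf_floor_div_eq {r : ℝ} (hr : 0 < r) (i : ℤ) :
    {t : ℝ | ⌊t / r⌋ = i} = Set.Ico (i * r) ((i + 1) * r) := by
  ext t
  simp only [Set.mem_ofPred_eq, Int.floor_eq_iff, Set.mem_Ico, le_div_iff₀ hr, div_lt_iff₀ hr]

lemma volume_setOf_cubeIdx_eq {m : ℕ} (j : ℤ) (i : (Fin m → ℤ) × ℤ) :
    volume {x : Rn1 m | cubeIdx j x = i} = ENNReal.ofReal (cubeVol m j) := by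
  have h2 : (0 : ℝ) < 2 ^ j := by positivity
  have h4 : (0 : ℝ) < 4 ^ j := by positivity
  have hset : {x : Rn1 m | cubeIdx j x = i} =
      ((WithLp.ofLp : Rn m → (Fin m → ℝ)) ⁻¹' Set.univ.pi fun k =>
        Set.Ico (i.1 k * (2 : ℝ) ^ j) ((i.1 k + 1) * 2 ^ j)) ×ˢ
      Set.Ico (i.2 * (4 : ℝ) ^ j) ((i.2 + 1) * 4 ^ j) := by
    rw [← setOf_floor_div_eq h4]
    simp_rw [← setOf_floor_div_eq h2]
    ext x
    simp [cubeIdx, Prod.ext_iff, funext_iff]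
  rw [hset, Measure.volume_eq_prod, Measure.prod_prod,
    (PiLp.volume_preserving_ofLp (Fin m)).measure_preimage
      (MeasurableSet.univ_pi fun _ => measurableSet_Ico).nullMeasurableSet, Real.volume_Ico,
    Real.volume_pi_Ico]
  have e2 : ∀ k, ((i.1 k : ℝ) + 1) * 2 ^ j - i.1 k * 2 ^ j = 2 ^ j := fun k => by ring
  have e4 : ((i.2 : ℝ) + 1) * 4 ^ j - i.2 * 4 ^ j = 4 ^ j := by ring
  simp only [e2, e4, Finset.prod_const, Finset.card_univ, Fintype.card_fin]
  rw [← ENNReal.ofReal_pow h2.le, ← ENNReal.ofReal_mul (by positivity), cubeVol]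

lemma abs_sub_le_of_floor_div_eq {r a b : ℝ} (hr : 0 < r) (h : ⌊a / r⌋ = ⌊b / r⌋) :
    |a - b| ≤ r := by
  have h1 := Int.abs_sub_lt_one_of_floor_eq_floor h
  rw [← sub_div, abs_div, abs_of_pos hr, div_lt_one hr] at h1
  exact h1.le

lemma norm_fst_sub_le_of_cubeIdx_eq {m : ℕ} {j : ℤ} {x y : Rn1 m}
    (h : cubeIdx j x = cubeIdx j y) : ‖x.1 - y.1‖ ≤ (m + 1) * 2 ^ j := by
  have h2 : (0 : ℝ) < 2 ^ j := by positivity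
  have h1 : ‖x.1 - y.1‖ ≤ ∑ k, |x.1 k - y.1 k| := by
    rw [EuclideanSpace.norm_eq]
    refine Real.sqrt_le_iff.2 ⟨Finset.sum_nonneg fun _ _ => abs_nonneg _, ?_⟩
    simpa using Finset.sum_sq_le_sq_sum_of_nonneg (s := Finset.univ)
      (f := fun k => |x.1 k - y.1 k|) (fun _ _ => abs_nonneg _)
  refine h1.trans ((Finset.sum_le_card_nsmul _ _ (2 ^ j) fun k _ =>
    abs_sub_le_of_floor_div_eq h2 ?_).trans ?_)
  · exact congrFun (Prod.ext_iff.1 h).1 k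
  · simp only [Finset.card_univ, Fintype.card_fin, nsmul_eq_mul]
    nlinarith

lemma abs_snd_sub_le_of_cubeIdx_eq {m : ℕ} {j : ℤ} {x y : Rn1 m}
    (h : cubeIdx j x = cubeIdx j y) : |x.2 - y.2| ≤ 4 ^ j :=
  abs_sub_le_of_floor_div_eq (by positivity) (Prod.ext_iff.1 h).2

/-! ### The Calderón–Zygmund decomposition -/

/-- Continuous, bounded, integrable functions. -/
structure Nice {m : ℕ} (f : Rn1 m → ℂ) : Prop where
  cont : Continuous f
  int : Integrable f
  bdd : ∃ C, ∀ x, ‖f x‖ ≤ C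

/-- The parabolic dyadic cube of generation `s.1` and index `s.2`. -/
def pcube {m : ℕ} (s : ℤ × ((Fin m → ℤ) × ℤ)) : Set (Rn1 m) := {x | cubeIdx s.1 x = s.2}

lemma measurableSet_pcube {m : ℕ} (s : ℤ × ((Fin m → ℤ) × ℤ)) : MeasurableSet (pcube s) :=
  measurableSet_cubeIdx_eq _ _

lemma volume_pcube {m : ℕ} (s : ℤ × ((Fin m → ℤ) × ℤ)) :
    volume (pcube s) = ENNReal.ofReal (cubeVol m s.1) := volume_setOf_cubeIdx_eq _ _

lemma pcube_nonempty {m : ℕ} (s : ℤ × ((Fin m → ℤ) × ℤ)) : (pcube s).Nonempty := by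
  refine nonempty_of_measure_ne_zero (μ := volume) ?_
  rw [volume_pcube]
  simpa using cubeVol_pos m s.1

lemma exists_pcube_subset {m : ℕ} (x : Rn1 m) {U : Set (Rn1 m)} (hU : U ∈ nhds x) :
    ∃ j : ℤ, pcube (j, cubeIdx j x) ⊆ U := by
  obtain ⟨ε, hε, hb⟩ := Metric.mem_nhds_iff.1 hU
  have h2 : Filter.Tendsto (fun j : ℕ => ((m : ℝ) + 1) * (1 / 2 : ℝ) ^ j) Filter.atTop (nhds 0) := by
    simpa using (tendsto_pow_atTop_nhds_zero_of_lt_one (by norm_num : (0 : ℝ) ≤ 1 / 2)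
      (by norm_num)).const_mul ((m : ℝ) + 1)
  have h4 : Filter.Tendsto (fun j : ℕ => (1 / 4 : ℝ) ^ j) Filter.atTop (nhds 0) :=
    tendsto_pow_atTop_nhds_zero_of_lt_one (by norm_num) (by norm_num)
  obtain ⟨j, hj2, hj4⟩ :=
    ((h2.eventually (gt_mem_nhds hε)).and (h4.eventually (gt_mem_nhds hε))).exists
  refine ⟨-(j : ℤ), fun y hy => hb ?_⟩
  have hy' : cubeIdx (-(j : ℤ)) y = cubeIdx (-(j : ℤ)) x := hy
  have e1 := norm_fst_sub_le_of_cubeIdx_eq hy'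
  have e2 := abs_snd_sub_le_of_cubeIdx_eq hy'
  rw [zpow_neg, zpow_natCast, ← inv_pow, inv_eq_one_div] at e1 e2
  rw [Metric.mem_ball, dist_eq_norm, Prod.norm_def]
  exact max_lt (e1.trans_lt hj2) (e2.trans_lt hj4)

lemma exists_stopping_cubes {m : ℕ} {f : Rn1 m → ℂ} (hf : Nice f) {l : ℝ} (hl : 0 < l) :
    ∃ S : Set (ℤ × ((Fin m → ℤ) × ℤ)), S.PairwiseDisjoint pcube ∧
      (∀ s ∈ S, ENNReal.ofReal l * volume (pcube s) < ∫⁻ y in pcube s, ‖f y‖ₑ) ∧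
      (∀ s ∈ S, ∫⁻ y in pcube s, ‖f y‖ₑ ≤
        ENNReal.ofReal ((2 ^ m * 4) * l) * volume (pcube s)) ∧
      (∀ x ∉ ⋃ s ∈ S, pcube s, ‖f x‖ ≤ l) := by
  set heavy : ℤ × ((Fin m → ℤ) × ℤ) → Prop := fun s =>
    ENNReal.ofReal l * volume (pcube s) < ∫⁻ y in pcube s, ‖f y‖ₑ with heavy_def
  have hbd : ∃ N : ℤ, ∀ s, heavy s → s.1 ≤ N := by
    have hfin : ∫⁻ y, ‖f y‖ₑ < ⊤ := hf.int.2
    obtain ⟨N, hN⟩ := exists_nat_gt ((∫⁻ y, ‖f y‖ₑ).toReal / l)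
    refine ⟨N, fun s hs => ?_⟩
    by_contra! hlt
    have h1 : ENNReal.ofReal (l * cubeVol m s.1) < ∫⁻ y, ‖f y‖ₑ := by
      rw [ENNReal.ofReal_mul hl.le, ← volume_pcube]
      exact lt_of_lt_of_le hs (setLIntegral_le_lintegral _ _)
    rw [ENNReal.ofReal_lt_iff_lt_toReal (mul_pos hl (cubeVol_pos _ _)).le hfin.ne] at h1
    have h2 : (s.1.toNat : ℝ) ≤ cubeVol m s.1 := by
      have := le_cubeVol m s.1.toNat
      rwa [Int.toNat_of_nonneg (by lia)] at this
    have h3 : (N : ℝ) ≤ s.1.toNat := by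
      have : N ≤ s.1.toNat := by lia
      exact_mod_cast this
    rw [div_lt_iff₀ hl] at hN
    nlinarith
  obtain ⟨N, hN⟩ := hbd
  refine ⟨{s | heavy s ∧ ∀ k > s.1, ∀ x ∈ pcube s, ¬ heavy (k, cubeIdx k x)}, ?_, ?_, ?_, ?_⟩
  · intro s hs t ht hst
    refine Set.disjoint_left.2 fun x hxs hxt => hst ?_
    have hs' : cubeIdx s.1 x = s.2 := hxs
    have ht' : cubeIdx t.1 x = t.2 := hxt
    rcases lt_trichotomy s.1 t.1 with h | h | h
    · exact absurd (by rw [ht']; exact ht.1) (hs.2 _ h x hxs)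
    · exact Prod.ext h (by rw [← hs', ← ht', h])
    · exact absurd (by rw [hs']; exact hs.1) (ht.2 _ h x hxt)
  · exact fun s hs => hs.1
  · intro s hs
    obtain ⟨x, hx⟩ := pcube_nonempty s
    have h1 := hs.2 (s.1 + 1) (by simp) x hx
    rw [heavy_def] at h1
    push Not at h1
    have hsub : pcube s ⊆ pcube (s.1 + 1, cubeIdx (s.1 + 1) x) := fun y hy =>
      cubeIdx_succ_congr ((show cubeIdx s.1 y = s.2 from hy).trans hx.symm)
    refine (lintegral_mono_set hsub).trans (h1.trans ?_)
    rw [volume_pcube, volume_pcube, cubeVol_succ, ← ENNReal.ofReal_mul hl.le,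
      ← ENNReal.ofReal_mul (by positivity)]
    exact ENNReal.ofReal_le_ofReal (le_of_eq (by ring))
  · intro x hx
    have hnot : ∀ j, ¬ heavy (j, cubeIdx j x) := by
      by_contra! hex
      obtain ⟨j, hj, hmax⟩ := Int.exists_greatest_of_bdd (P := fun j => heavy (j, cubeIdx j x))
        ⟨N, fun z hz => hN _ hz⟩ hex
      refine hx (Set.mem_biUnion (x := (j, cubeIdx j x)) ⟨hj, fun k hk y hy hhy => ?_⟩ rfl)
      have hy' : cubeIdx j y = cubeIdx j x := hy
      rw [cubeIdx_congr_of_le (le_of_lt hk) hy'] at hhy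
      exact absurd (hmax k hhy) (not_le.2 hk)
    by_contra! hlt
    obtain ⟨r, hr1, hr2⟩ := exists_between hlt
    obtain ⟨j, hj⟩ := exists_pcube_subset x
      (hf.cont.norm.continuousAt.eventually (lt_mem_nhds hr2))
    refine hnot j ?_
    have h0 : (0 : ℝ) < cubeVol m j := cubeVol_pos m j
    calc ENNReal.ofReal l * volume (pcube (j, cubeIdx j x))
        < ENNReal.ofReal r * volume (pcube (j, cubeIdx j x)) := by
          rw [volume_pcube, ← ENNReal.ofReal_mul hl.le, ← ENNReal.ofReal_mul (hl.trans hr1).le]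
          exact (ENNReal.ofReal_lt_ofReal_iff (mul_pos (hl.trans hr1) h0)).2
            (mul_lt_mul_of_pos_right hr1 h0)
      _ = ∫⁻ _ in pcube (j, cubeIdx j x), ENNReal.ofReal r := by rw [setLIntegral_const]
      _ ≤ _ := by
          refine setLIntegral_mono' (measurableSet_pcube _) fun y hy => ?_
          rw [← ofReal_norm]
          exact ENNReal.ofReal_le_ofReal (hj hy).le

lemma exists_cz_decomposition {m : ℕ} {f : Rn1 m → ℂ} (hf : Nice f) {l : ℝ} (hl : 0 < l) :
    ∃ (S : Set (ℤ × ((Fin m → ℤ) × ℤ))) (b : Rn1 m → ℂ), S.PairwiseDisjoint pcube ∧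
      Integrable b ∧ (∃ C, ∀ x, ‖b x‖ ≤ C) ∧ (∀ x ∉ ⋃ s ∈ S, pcube s, b x = 0) ∧
      (∀ s ∈ S, ∫ y in pcube s, b y = 0) ∧
      (∫⁻ y, ‖b y‖ₑ ≤
        2 * ENNReal.ofReal ((2 ^ m * 4) * l) * volume (⋃ s ∈ S, pcube s)) ∧
      (∀ x, ‖f x - b x‖ ≤ (2 ^ m * 4) * l) ∧ (∀ x ∉ ⋃ s ∈ S, pcube s, ‖f x‖ ≤ l) ∧
      ENNReal.ofReal (l / 2) * volume (⋃ s ∈ S, pcube s) ≤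
        ∫⁻ y in {y | l / 2 < ‖f y‖}, ‖f y‖ₑ := by
  classical
  obtain ⟨S, hd, hlow, hup, hoff⟩ := exists_stopping_cubes hf hl
  set D : ℝ := (2 ^ m * 4) * l with hD
  have hlD : l ≤ D := by
    have : (1 : ℝ) ≤ 2 ^ m := one_le_pow₀ (by norm_num)
    nlinarith
  have hV0 : ∀ s : ℤ × ((Fin m → ℤ) × ℤ), volume (pcube s) ≠ 0 := fun s => by
    rw [volume_pcube]; simpa using cubeVol_pos m s.1
  have hVt : ∀ s : ℤ × ((Fin m → ℤ) × ℤ), volume (pcube s) ≠ ⊤ := fun s => by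
    rw [volume_pcube]; simp
  set c : ℤ × ((Fin m → ℤ) × ℤ) → ℂ := fun s => ⨍ y in pcube s, f y with hc
  have hcD : ∀ s ∈ S, ‖c s‖ₑ * volume (pcube s) ≤ ∫⁻ y in pcube s, ‖f y‖ₑ := by
    intro s hs
    have h1 : ‖c s‖ₑ ≤ (volume (pcube s))⁻¹ * ∫⁻ y in pcube s, ‖f y‖ₑ := by
      rw [hc]
      simp only [setAverage_eq, enorm_smul]
      refine mul_le_mul' (le_of_eq ?_) (enorm_integral_le_lintegral_enorm _)
      rw [Measure.real, ← ENNReal.toReal_inv, Real.enorm_of_nonneg ENNReal.toReal_nonneg,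
        ENNReal.ofReal_toReal (ENNReal.inv_ne_top.2 (hV0 s))]
    calc ‖c s‖ₑ * volume (pcube s) ≤
          ((volume (pcube s))⁻¹ * ∫⁻ y in pcube s, ‖f y‖ₑ) * volume (pcube s) := by gcongr
      _ = _ := by
          rw [mul_comm _ (volume (pcube s)), ← mul_assoc, ENNReal.mul_inv_cancel (hV0 s) (hVt s),
            one_mul]
  have hcD' : ∀ s ∈ S, ‖c s‖ ≤ D := by
    intro s hs
    have := (hcD s hs).trans (hup s hs)
    rw [ENNReal.mul_le_mul_iff_left (hV0 s) (hVt s), ← ofReal_norm,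
      ENNReal.ofReal_le_ofReal_iff (by positivity)] at this
    exact this
  set b : Rn1 m → ℂ := fun x => if h : ∃ s ∈ S, x ∈ pcube s then f x - c h.choose else 0 with hb
  have hb_on : ∀ s ∈ S, ∀ x ∈ pcube s, b x = f x - c s := by
    intro s hs x hx
    have h : ∃ s ∈ S, x ∈ pcube s := ⟨s, hs, hx⟩
    have : h.choose = s := by
      by_contra hne
      exact Set.disjoint_left.1 (hd h.choose_spec.1 hs hne) h.choose_spec.2 hx
    simp only [hb]
    rw [dif_pos h, this]
  have hb_off : ∀ x ∉ ⋃ s ∈ S, pcube s, b x = 0 := by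
    intro x hx
    simp only [hb]
    rw [dif_neg]
    simpa using hx
  have hSc : S.Countable := Set.to_countable S
  have hΩm : MeasurableSet (⋃ s ∈ S, pcube s) :=
    MeasurableSet.biUnion hSc fun s _ => measurableSet_pcube s
  have hbm : AEStronglyMeasurable b := by
    have h1 : AEStronglyMeasurable b (volume.restrict (⋃ s ∈ S, pcube s)) := by
      have : Countable S := hSc
      rw [Set.biUnion_eq_iUnion, aestronglyMeasurable_iUnion_iff]
      rintro ⟨s, hs⟩
      refine ((hf.cont.aestronglyMeasurable (μ := volume.restrict (pcube s))).sub
        (aestronglyMeasurable_const (b := c s))).congr ?_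
      refine (ae_restrict_iff' (measurableSet_pcube s)).2 (Filter.Eventually.of_forall ?_)
      exact fun x hx => (hb_on s hs x hx).symm
    have h2 : AEStronglyMeasurable b (volume.restrict (⋃ s ∈ S, pcube s)ᶜ) := by
      refine (aestronglyMeasurable_const (b := (0 : ℂ))).congr ?_
      refine (ae_restrict_iff' hΩm.compl).2 (Filter.Eventually.of_forall ?_)
      exact fun x hx => (hb_off x hx).symm
    have := (aestronglyMeasurable_union_iff (s := ⋃ s ∈ S, pcube s)
      (t := (⋃ s ∈ S, pcube s)ᶜ)).2 ⟨h1, h2⟩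
    rwa [Set.union_compl_self, Measure.restrict_univ] at this
  have hVsum : volume (⋃ s ∈ S, pcube s) = ∑' s : S, volume (pcube s.1) :=
    measure_biUnion hSc hd fun s _ => measurableSet_pcube s
  have hbQ : ∀ s ∈ S, ∫⁻ y in pcube s, ‖b y‖ₑ ≤
      2 * ENNReal.ofReal D * volume (pcube s) := by
    intro s hs
    calc ∫⁻ y in pcube s, ‖b y‖ₑ ≤ ∫⁻ y in pcube s, (‖f y‖ₑ + ‖c s‖ₑ) := by
          refine setLIntegral_mono' (measurableSet_pcube _) fun y hy => ?_
          rw [hb_on s hs y hy]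
          exact enorm_sub_le
      _ = (∫⁻ y in pcube s, ‖f y‖ₑ) + ‖c s‖ₑ * volume (pcube s) := by
          rw [lintegral_add_right _ measurable_const, setLIntegral_const]
      _ ≤ _ := by
          rw [two_mul, add_mul]
          exact add_le_add (hup s hs) ((hcD s hs).trans (hup s hs))
  have hbI : ∫⁻ y, ‖b y‖ₑ ≤ 2 * ENNReal.ofReal D * volume (⋃ s ∈ S, pcube s) := by
    calc ∫⁻ y, ‖b y‖ₑ = ∫⁻ y in ⋃ s ∈ S, pcube s, ‖b y‖ₑ := by
          rw [setLIntegral_eq_of_support_subset]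
          intro x hx
          by_contra hxn
          exact hx (by simp [hb_off x hxn])
      _ = ∑' s : S, ∫⁻ y in pcube s.1, ‖b y‖ₑ :=
          lintegral_biUnion hSc (fun s _ => measurableSet_pcube s) hd _
      _ ≤ ∑' s : S, 2 * ENNReal.ofReal D * volume (pcube s.1) :=
          ENNReal.tsum_le_tsum fun s => hbQ s s.2
      _ = _ := by rw [ENNReal.tsum_mul_left, hVsum]
  have hVI : ENNReal.ofReal (l / 2) * volume (⋃ s ∈ S, pcube s) ≤
        ∫⁻ y in {y | l / 2 < ‖f y‖}, ‖f y‖ₑ := by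
    have hT : MeasurableSet {y | l / 2 < ‖f y‖} := measurableSet_lt measurable_const
      hf.cont.norm.measurable
    have key : ∀ s ∈ S, ENNReal.ofReal (l / 2) * volume (pcube s) ≤
        ∫⁻ y in pcube s, {y | l / 2 < ‖f y‖}.indicator (fun y => ‖f y‖ₑ) y := by
      intro s hs
      have h1 : ∫⁻ y in pcube s, ‖f y‖ₑ ≤
          (∫⁻ y in pcube s, {y | l / 2 < ‖f y‖}.indicator (fun y => ‖f y‖ₑ) y) +
            ENNReal.ofReal (l / 2) * volume (pcube s) := by
        rw [← setLIntegral_const, ← lintegral_add_right _ measurable_const]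
        refine lintegral_mono fun y => ?_
        by_cases hy : l / 2 < ‖f y‖
        · rw [Set.indicator_of_mem (show y ∈ {y | l / 2 < ‖f y‖} from hy)]
          exact le_self_add
        · rw [← ofReal_norm]
          exact (ENNReal.ofReal_le_ofReal (not_lt.1 hy)).trans le_add_self
      have h2 := (hlow s hs).le.trans h1
      have h3 : ENNReal.ofReal l = ENNReal.ofReal (l / 2) + ENNReal.ofReal (l / 2) := by
        rw [← ENNReal.ofReal_add (by positivity) (by positivity), add_halves]
      rw [h3, add_mul] at h2
      exact (ENNReal.add_le_add_iff_right
        (ENNReal.mul_ne_top ENNReal.ofReal_ne_top (hVt s))).1 h2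
    calc ENNReal.ofReal (l / 2) * volume (⋃ s ∈ S, pcube s)
        = ∑' s : S, ENNReal.ofReal (l / 2) * volume (pcube s.1) := by
          rw [ENNReal.tsum_mul_left, hVsum]
      _ ≤ ∑' s : S, ∫⁻ y in pcube s.1,
            {y | l / 2 < ‖f y‖}.indicator (fun y => ‖f y‖ₑ) y :=
          ENNReal.tsum_le_tsum fun s => key s s.2
      _ = ∫⁻ y in ⋃ s ∈ S, pcube s, {y | l / 2 < ‖f y‖}.indicator (fun y => ‖f y‖ₑ) y :=
          (lintegral_biUnion hSc (fun s _ => measurableSet_pcube s) hd _).symm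
      _ ≤ ∫⁻ y, {y | l / 2 < ‖f y‖}.indicator (fun y => ‖f y‖ₑ) y :=
          setLIntegral_le_lintegral _ _
      _ = _ := lintegral_indicator hT _
  have hVfin : volume (⋃ s ∈ S, pcube s) ≠ ⊤ := by
    intro htop
    rw [htop, ENNReal.mul_top (by simpa using hl)] at hVI
    exact (lt_of_le_of_lt (hVI.trans (setLIntegral_le_lintegral _ _)) hf.int.2).ne rfl
  have hgb : ∀ x, ‖f x - b x‖ ≤ D := by
    intro x
    by_cases hx : x ∈ ⋃ s ∈ S, pcube s
    · obtain ⟨s, hs, hxs⟩ := Set.mem_iUnion₂.1 hx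
      rw [hb_on s hs x hxs, sub_sub_cancel]
      exact hcD' s hs
    · rw [hb_off x hx, sub_zero]
      exact (hoff x hx).trans hlD
  refine ⟨S, b, hd, ⟨hbm, ?_⟩, ?_, hb_off, ?_, hbI, hgb, hoff, hVI⟩
  · exact lt_of_le_of_lt hbI (ENNReal.mul_lt_top
      (ENNReal.mul_lt_top (by simp) (by simp)) (lt_top_iff_ne_top.2 hVfin))
  · obtain ⟨C, hC⟩ := hf.bdd
    refine ⟨C + D, fun x => ?_⟩
    calc ‖b x‖ = ‖f x - (f x - b x)‖ := by rw [sub_sub_cancel]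
      _ ≤ ‖f x‖ + ‖f x - b x‖ := norm_sub_le _ _
      _ ≤ C + D := add_le_add (hC x) (hgb x)
  · intro s hs
    rw [setIntegral_congr_fun (measurableSet_pcube s) (fun y hy => hb_on s hs y hy),
      integral_sub hf.int.integrableOn (integrableOn_const (hVt s)), setIntegral_const, hc]
    simp only [setAverage_eq, smul_smul, Measure.real]
    rw [mul_inv_cancel₀ (ENNReal.toReal_ne_zero.2 ⟨hV0 s, hVt s⟩), one_smul, sub_self]

/-! ### Calderón–Zygmund kernels and the weak-type estimate -/

/-- An integrable kernel bounded on `L²` and satisfying the parabolic Hörmander condition, with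
constants at most `A`. -/
structure CZKernel {m : ℕ} (A : ℝ≥0) (K : Rn1 m → ℂ) : Prop where
  meas : Measurable K
  int : Integrable K
  l2 : ∀ g, Integrable g → (∃ C, ∀ x, ‖g x‖ ≤ C) →
    ∫⁻ x, ‖conv1 K g x‖ₑ ^ 2 ≤ A * ∫⁻ x, ‖g x‖ₑ ^ 2
  horm : ∀ δ > 0, ∀ w : Rn1 m, ‖w.1‖ ≤ δ → |w.2| ≤ δ ^ 2 →
    ∫⁻ z in {z : Rn1 m | 2 * δ < ‖z.1‖ ∨ 2 * δ ^ 2 < |z.2|}, ‖K (z - w) - K z‖ₑ ≤ A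

instance isAddHaarMeasure_volume_Rn1 (m : ℕ) : (volume : Measure (Rn1 m)).IsAddHaarMeasure :=
  inferInstanceAs ((volume : Measure (Rn m)).prod (volume : Measure ℝ)).IsAddHaarMeasure

lemma integrable_conv1_integrand {m : ℕ} {K g : Rn1 m → ℂ} (hK : Integrable K)
    (hg : AEStronglyMeasurable g) (hb : ∃ C, ∀ x, ‖g x‖ ≤ C) (x : Rn1 m) :
    Integrable fun y => K (x - y) * g y := by
  obtain ⟨C, hC⟩ := hb
  exact (hK.comp_sub_left x).mul_bdd (c := C) hg (ae_of_all _ hC)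

lemma aestronglyMeasurable_conv1 {m : ℕ} {K g : Rn1 m → ℂ} (hK : Measurable K)
    (hg : AEStronglyMeasurable g) : AEStronglyMeasurable (conv1 K g) := by
  unfold conv1
  refine AEStronglyMeasurable.integral_prod_right'
    (f := fun z : Rn1 m × Rn1 m => K (z.1 - z.2) * g z.2) ?_
  exact (hK.comp (measurable_fst.sub measurable_snd)).aestronglyMeasurable.mul hg.comp_snd

/-- The enlargement of a parabolic dyadic cube. -/
def pstar {m : ℕ} (s : ℤ × ((Fin m → ℤ) × ℤ)) : Set (Rn1 m) :=
  {z | ‖z.1 - (pcube_nonempty s).some.1‖ ≤ 2 * ((m + 1) * 2 ^ s.1) ∧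
    |z.2 - (pcube_nonempty s).some.2| ≤ 2 * ((m + 1) * 2 ^ s.1) ^ 2}

/-- The volume ratio between an enlarged cube and the cube. -/
def starConst (m : ℕ) : ℝ≥0 :=
  ((2 * (m + 1)) ^ m * (4 * (m + 1) ^ 2)) * (volume (Metric.ball (0 : Rn m) 1)).toNNReal

lemma volume_pstar {m : ℕ} (s : ℤ × ((Fin m → ℤ) × ℤ)) :
    volume (pstar s) = starConst m * volume (pcube s) := by
  have hset : pstar s = Metric.closedBall (pcube_nonempty s).some.1 (2 * ((m + 1) * 2 ^ s.1)) ×ˢ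
      Metric.closedBall (pcube_nonempty s).some.2 (2 * ((m + 1) * 2 ^ s.1) ^ 2) := by
    ext z; simp [pstar, dist_eq_norm]
  have h0 : (0 : ℝ) < 2 ^ s.1 := by positivity
  have h4 : (4 : ℝ) ^ s.1 = (2 ^ s.1) ^ 2 := by
    rw [← zpow_natCast, ← zpow_mul, mul_comm, zpow_mul]; norm_num
  have hfin : volume (Metric.ball (0 : Rn m) 1) ≠ ⊤ := measure_ball_lt_top.ne
  rw [volume_pcube, hset, Measure.volume_eq_prod, Measure.prod_prod, Real.volume_closedBall,
    Measure.addHaar_closedBall _ _ (by positivity), starConst, cubeVol, h4]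
  rw [ENNReal.coe_mul, ENNReal.coe_toNNReal hfin, ← ENNReal.ofReal_coe_nnreal,
    mul_right_comm, mul_right_comm (ENNReal.ofReal (NNReal.toReal _)),
    ← ENNReal.ofReal_mul (by positivity), ← ENNReal.ofReal_mul (by positivity)]
  congr 2
  simp only [finrank_euclideanSpace, Fintype.card_fin]
  push_cast
  rw [mul_pow, mul_pow, mul_pow, mul_pow]
  ring

lemma measurableSet_pstar {m : ℕ} (s : ℤ × ((Fin m → ℤ) × ℤ)) : MeasurableSet (pstar s) := by
  refine MeasurableSet.inter ?_ ?_
  · exact measurableSet_le (measurable_fst.sub_const _).norm measurable_const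
  · exact measurableSet_le (measurable_snd.sub_const _).norm measurable_const

lemma CZKernel.lintegral_compl_pstar_le {m : ℕ} {A : ℝ≥0} {K : Rn1 m → ℂ} (hK : CZKernel A K)
    (s : ℤ × ((Fin m → ℤ) × ℤ)) {y : Rn1 m} (hy : y ∈ pcube s) :
    ∫⁻ z in (pstar s)ᶜ, ‖K (z - y) - K (z - (pcube_nonempty s).some)‖ₑ ≤ A := by
  set c := (pcube_nonempty s).some with hc
  have hcm : c ∈ pcube s := (pcube_nonempty s).some_mem
  have hyc : cubeIdx s.1 y = cubeIdx s.1 c := (show _ = _ from hy).trans (show _ = _ from hcm).symm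
  have h0 : (0 : ℝ) < 2 ^ s.1 := by positivity
  have h4 : (4 : ℝ) ^ s.1 = (2 ^ s.1) ^ 2 := by
    rw [← zpow_natCast, ← zpow_mul, mul_comm, zpow_mul]; norm_num
  have key := hK.horm ((m + 1) * 2 ^ s.1) (by positivity) (y - c)
    (norm_fst_sub_le_of_cubeIdx_eq hyc) ((abs_snd_sub_le_of_cubeIdx_eq hyc).trans (by
      rw [h4, mul_pow]
      nlinarith [sq_nonneg ((2 : ℝ) ^ s.1), (Nat.cast_nonneg m : (0 : ℝ) ≤ m),
        mul_nonneg (Nat.cast_nonneg m : (0 : ℝ) ≤ m) (sq_nonneg ((2 : ℝ) ^ s.1)),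
        mul_nonneg (sq_nonneg (m : ℝ)) (sq_nonneg ((2 : ℝ) ^ s.1))]))
  refine le_trans (le_of_eq ?_) key
  rw [← lintegral_indicator (measurableSet_pstar s).compl, ← lintegral_indicator,
    ← lintegral_add_right_eq_self _ c]
  · congr 1 with z
    have : (z + c ∈ (pstar s)ᶜ) ↔ z ∈ {z : Rn1 m | 2 * ((m + 1) * 2 ^ s.1) < ‖z.1‖ ∨
        2 * ((m + 1) * 2 ^ s.1) ^ 2 < |z.2|} := by
      simp only [pstar, ← hc, Set.mem_compl_iff, Set.mem_ofPred_eq, Prod.fst_add, Prod.snd_add,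
        add_sub_cancel_right, not_and_or, not_le]
    by_cases h : z + c ∈ (pstar s)ᶜ
    · rw [Set.indicator_of_mem h, Set.indicator_of_mem (this.1 h)]
      congr 3 <;> abel
    · rw [Set.indicator_of_notMem h, Set.indicator_of_notMem (fun h' => h (this.2 h'))]
  · exact (measurableSet_lt measurable_const measurable_fst.norm).union
      (measurableSet_lt measurable_const measurable_snd.norm)

lemma CZKernel.lintegral_conv1_compl_le {m : ℕ} {A : ℝ≥0} {K : Rn1 m → ℂ} (hK : CZKernel A K)
    {S : Set (ℤ × ((Fin m → ℤ) × ℤ))} {b : Rn1 m → ℂ} (hS : S.PairwiseDisjoint pcube)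
    (hb : Integrable b) (hbd : ∃ C, ∀ x, ‖b x‖ ≤ C) (h0 : ∀ x ∉ ⋃ s ∈ S, pcube s, b x = 0)
    (hmean : ∀ s ∈ S, ∫ y in pcube s, b y = 0) :
    ∫⁻ z in (⋃ s ∈ S, pstar s)ᶜ, ‖conv1 K b z‖ₑ ≤ A * ∫⁻ y, ‖b y‖ₑ := by
  set c : ℤ × ((Fin m → ℤ) × ℤ) → Rn1 m := fun s => (pcube_nonempty s).some with hc
  have hdisj : Pairwise (Function.onFun Disjoint fun s : S => pcube s.1) := fun s t hst =>
    hS s.2 t.2 (fun h => hst (Subtype.ext h))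
  have hpt : ∀ z, ‖conv1 K b z‖ₑ ≤
      ∑' s : S, ∫⁻ y in pcube s.1, ‖K (z - y) - K (z - c s.1)‖ₑ * ‖b y‖ₑ := by
    intro z
    have h_int := integrable_conv1_integrand hK.int hb.aestronglyMeasurable hbd z
    have e1 : conv1 K b z = ∑' s : S, ∫ y in pcube s.1, (K (z - y) - K (z - c s.1)) * b y := by
      unfold conv1
      rw [← setIntegral_eq_integral_of_forall_compl_eq_zero (s := ⋃ s : S, pcube s.1),
        integral_iUnion (s := fun s : S => pcube s.1) (f := fun y => K (z - y) * b y)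
          (fun s => measurableSet_pcube s.1) hdisj h_int.integrableOn]
      · refine tsum_congr fun s => ?_
        simp_rw [sub_mul]
        rw [integral_sub h_int.integrableOn (hb.const_mul _).integrableOn, integral_const_mul,
          hmean s.1 s.2, mul_zero, sub_zero]
      · intro y hy
        rw [h0 y (by rwa [Set.biUnion_eq_iUnion]), mul_zero]
    rw [e1]
    refine (enorm_tsum_le_tsum_enorm).trans (ENNReal.tsum_le_tsum fun s => ?_)
    refine (enorm_integral_le_lintegral_enorm _).trans (le_of_eq ?_)
    simp_rw [enorm_mul]
  have hmeas : ∀ s : S, AEMeasurable (fun q : Rn1 m × Rn1 m =>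
      ‖K (q.1 - q.2) - K (q.1 - c s.1)‖ₑ * ‖b q.2‖ₑ)
      ((volume.restrict (⋃ s ∈ S, pstar s)ᶜ).prod (volume.restrict (pcube s.1))) := by
    intro s
    have h1 : Measurable fun q : Rn1 m × Rn1 m => ‖K (q.1 - q.2) - K (q.1 - c s.1)‖ₑ :=
      ((hK.meas.comp (measurable_fst.sub measurable_snd)).sub
        (hK.meas.comp (measurable_fst.sub_const _))).enorm
    exact h1.aemeasurable.mul (hb.aestronglyMeasurable.restrict.comp_snd).enorm
  have e1 : ∫⁻ z in (⋃ s ∈ S, pstar s)ᶜ, ‖conv1 K b z‖ₑ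
      ≤ ∫⁻ z in (⋃ s ∈ S, pstar s)ᶜ,
          ∑' s : S, ∫⁻ y in pcube s.1, ‖K (z - y) - K (z - c s.1)‖ₑ * ‖b y‖ₑ :=
        lintegral_mono fun z => hpt z
  have e2 : ∫⁻ z in (⋃ s ∈ S, pstar s)ᶜ,
          ∑' s : S, ∫⁻ y in pcube s.1, ‖K (z - y) - K (z - c s.1)‖ₑ * ‖b y‖ₑ
     = ∑' s : S, ∫⁻ z in (⋃ s ∈ S, pstar s)ᶜ,
          ∫⁻ y in pcube s.1, ‖K (z - y) - K (z - c s.1)‖ₑ * ‖b y‖ₑ :=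
        lintegral_tsum fun s => (hmeas s).lintegral_prod_right'
  have e3 : ∀ s : S, ∫⁻ z in (⋃ s ∈ S, pstar s)ᶜ,
          ∫⁻ y in pcube s.1, ‖K (z - y) - K (z - c s.1)‖ₑ * ‖b y‖ₑ
        ≤ ∫⁻ y in pcube s.1, A * ‖b y‖ₑ := by
    intro s
    rw [lintegral_lintegral_swap (hmeas s)]
    refine setLIntegral_mono' (measurableSet_pcube _) fun y hy => ?_
    rw [lintegral_mul_const' _ _ enorm_ne_top]
    refine mul_le_mul_left ((lintegral_mono_set ?_).trans (hK.lintegral_compl_pstar_le s.1 hy)) _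
    exact Set.compl_subset_compl.2 (Set.subset_biUnion_of_mem s.2)
  have e4 : ∑' s : S, ∫⁻ y in pcube s.1, A * ‖b y‖ₑ = ∫⁻ y in ⋃ s : S, pcube s.1, A * ‖b y‖ₑ :=
    (lintegral_iUnion (s := fun s : S => pcube s.1) (fun s => measurableSet_pcube s.1) hdisj
      fun y => A * ‖b y‖ₑ).symm
  rw [← lintegral_const_mul' _ _ ENNReal.coe_ne_top]
  refine (e1.trans_eq e2).trans ((ENNReal.tsum_le_tsum e3).trans ?_)
  rw [e4]
  exact setLIntegral_le_lintegral _ _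

/-- The constant in the weak-type estimate. -/
def weakConst (m : ℕ) (A : ℝ≥0) : ℝ≥0 :=
  2 * (A * (2 ^ m * 4) ^ 2 + starConst m + 2 * A * (2 ^ m * 4))

lemma conv1_add {m : ℕ} {K g b : Rn1 m → ℂ} (hK : Integrable K)
    (hg : AEStronglyMeasurable g) (hgb : ∃ C, ∀ x, ‖g x‖ ≤ C)
    (hb : AEStronglyMeasurable b) (hbb : ∃ C, ∀ x, ‖b x‖ ≤ C) (x : Rn1 m) :
    conv1 K (fun y => g y + b y) x = conv1 K g x + conv1 K b x := by
  unfold conv1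
  simp_rw [mul_add]
  exact integral_add (integrable_conv1_integrand hK hg hgb x)
    (integrable_conv1_integrand hK hb hbb x)

lemma volume_biUnion_pstar_le {m : ℕ} {S : Set (ℤ × ((Fin m → ℤ) × ℤ))}
    (hS : S.PairwiseDisjoint pcube) :
    volume (⋃ s ∈ S, pstar s) ≤ starConst m * volume (⋃ s ∈ S, pcube s) := by
  rw [measure_biUnion S.to_countable hS fun s _ => measurableSet_pcube s]
  refine (measure_biUnion_le _ S.to_countable _).trans (le_of_eq ?_)
  simp_rw [volume_pstar]
  rw [ENNReal.tsum_mul_left]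

lemma CZKernel.weak {m : ℕ} {A : ℝ≥0} {K : Rn1 m → ℂ} (hK : CZKernel A K)
    {f : Rn1 m → ℂ} (hf : Nice f) {l : ℝ} (hl : 0 < l) :
    volume {z | 2 * l < ‖conv1 K f z‖} ≤
      A * (ENNReal.ofReal l)⁻¹ ^ 2 * (∫⁻ y in {y | ‖f y‖ ≤ l}, ‖f y‖ₑ ^ 2) +
      weakConst m A * (ENNReal.ofReal l)⁻¹ * ∫⁻ y in {y | l / 2 < ‖f y‖}, ‖f y‖ₑ := by
  obtain ⟨S, b, hS, hbi, hbb, hb0, hbm, hbn, hg, hoff, hvol⟩ := exists_cz_decomposition hf hl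
  set Ω := ⋃ s ∈ S, pcube s with hΩ
  set L := ENNReal.ofReal l with hL
  have hL0 : L ≠ 0 := by simpa [hL] using hl
  have hLt : L ≠ ⊤ := ENNReal.ofReal_ne_top
  have hLi : L⁻¹ * L = 1 := ENNReal.inv_mul_cancel hL0 hLt
  set D : ℝ≥0 := 2 ^ m * 4 with hD
  have hDl : ENNReal.ofReal ((2 ^ m * 4) * l) = D * L := by
    rw [ENNReal.ofReal_mul (by positivity), ← ENNReal.ofReal_coe_nnreal, hD]
    push_cast; rfl
  set g : Rn1 m → ℂ := fun x => f x - b x with hgdef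
  have hgi : Integrable g := hf.int.sub hbi
  have hgb : ∃ C, ∀ x, ‖g x‖ ≤ C := ⟨_, hg⟩
  have hKf : ∀ x, conv1 K f x = conv1 K g x + conv1 K b x := fun x => by
    rw [← conv1_add hK.int hgi.aestronglyMeasurable hgb hbi.aestronglyMeasurable hbb]
    simp [hgdef]
  have hΩm : MeasurableSet Ω := MeasurableSet.biUnion S.to_countable fun s _ => measurableSet_pcube s
  set Ω' := ⋃ s ∈ S, pstar s with hΩ'
  have hΩ'm : MeasurableSet Ω' :=
    MeasurableSet.biUnion S.to_countable fun s _ => measurableSet_pstar s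
  have hsub : {z | 2 * l < ‖conv1 K f z‖} ⊆
      {z | L ^ 2 ≤ ‖conv1 K g z‖ₑ ^ 2} ∪ (Ω' ∪ ({z | L ≤ ‖conv1 K b z‖ₑ} ∩ Ω'ᶜ)) := by
    intro z hz
    have hz' : 2 * l < ‖conv1 K f z‖ := hz
    have htri := norm_add_le (conv1 K g z) (conv1 K b z)
    rw [← hKf] at htri
    by_cases h1 : l ≤ ‖conv1 K g z‖
    · left
      have : L ≤ ‖conv1 K g z‖ₑ := by
        rw [hL, ← ofReal_norm]; exact ENNReal.ofReal_le_ofReal h1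
      exact pow_le_pow_left' this 2
    · right
      by_cases h2 : z ∈ Ω'
      · exact Or.inl h2
      · refine Or.inr ⟨?_, h2⟩
        change L ≤ ‖conv1 K b z‖ₑ
        rw [hL, ← ofReal_norm]; exact ENNReal.ofReal_le_ofReal (by linarith)
  have hP1 : volume {z | L ^ 2 ≤ ‖conv1 K g z‖ₑ ^ 2} ≤
      A * L⁻¹ ^ 2 * (∫⁻ y in {y | ‖f y‖ ≤ l}, ‖f y‖ₑ ^ 2) + A * D ^ 2 * volume Ω := by
    have e1 := meas_ge_le_lintegral_div
      ((aestronglyMeasurable_conv1 hK.meas hgi.aestronglyMeasurable).enorm.pow_const 2)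
      (pow_ne_zero 2 hL0) (ENNReal.pow_ne_top hLt)
    have e2 : ∫⁻ x, ‖g x‖ₑ ^ 2 ≤ (∫⁻ y in {y | ‖f y‖ ≤ l}, ‖f y‖ₑ ^ 2) + (D * L) ^ 2 * volume Ω := by
      rw [← lintegral_add_compl _ hΩm, add_comm]
      refine add_le_add ?_ ?_
      · calc ∫⁻ x in Ωᶜ, ‖g x‖ₑ ^ 2 = ∫⁻ x in Ωᶜ, ‖f x‖ₑ ^ 2 :=
              setLIntegral_congr_fun hΩm.compl fun x hx => by simp [hgdef, hb0 x hx]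
          _ ≤ _ := lintegral_mono_set fun x hx => hoff x hx
      · rw [← setLIntegral_const]
        refine lintegral_mono fun x => pow_le_pow_left' ?_ 2
        rw [← ofReal_norm, ← hDl]; exact ENNReal.ofReal_le_ofReal (hg x)
    refine e1.trans ?_
    rw [ENNReal.div_eq_inv_mul, ENNReal.inv_pow]
    refine (mul_le_mul_right ((hK.l2 g hgi hgb).trans (mul_le_mul_right e2 _)) _).trans_eq ?_
    calc L⁻¹ ^ 2 * (A * ((∫⁻ y in {y | ‖f y‖ ≤ l}, ‖f y‖ₑ ^ 2) + (D * L) ^ 2 * volume Ω))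
        = A * L⁻¹ ^ 2 * (∫⁻ y in {y | ‖f y‖ ≤ l}, ‖f y‖ₑ ^ 2)
          + A * D ^ 2 * (L⁻¹ * L) ^ 2 * volume Ω := by generalize L⁻¹ = Li; ring
      _ = _ := by rw [hLi]; generalize L⁻¹ = Li; ring
  have hP3 : volume ({z | L ≤ ‖conv1 K b z‖ₑ} ∩ Ω'ᶜ) ≤ 2 * A * D * volume Ω := by
    have e1 := meas_ge_le_lintegral_div (μ := volume.restrict Ω'ᶜ)
      (aestronglyMeasurable_conv1 hK.meas hbi.aestronglyMeasurable).restrict.enorm hL0 hLt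
    rw [Measure.restrict_apply' hΩ'm.compl, ENNReal.div_eq_inv_mul] at e1
    refine e1.trans ((mul_le_mul_right ((hK.lintegral_conv1_compl_le hS hbi hbb hb0 hbm).trans
      (mul_le_mul_right hbn _)) _).trans_eq ?_)
    rw [hDl]
    calc L⁻¹ * (A * (2 * (D * L) * volume Ω)) = 2 * A * D * (L⁻¹ * L) * volume Ω := by generalize L⁻¹ = Li; ring
      _ = _ := by rw [hLi]; ring
  have hV : volume Ω ≤ 2 * L⁻¹ * ∫⁻ y in {y | l / 2 < ‖f y‖}, ‖f y‖ₑ := by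
    rw [ENNReal.ofReal_div_of_pos two_pos, ← hL, ENNReal.ofReal_ofNat] at hvol
    refine le_trans (le_of_eq ?_) (mul_le_mul_right hvol (2 * L⁻¹))
    calc volume Ω = (2 * 2⁻¹) * (L⁻¹ * L) * volume Ω := by
          rw [hLi, ENNReal.mul_inv_cancel two_ne_zero ENNReal.ofNat_ne_top]; ring
      _ = _ := by rw [ENNReal.div_eq_inv_mul]; generalize L⁻¹ = Li; ring
  calc volume {z | 2 * l < ‖conv1 K f z‖}
      ≤ volume {z | L ^ 2 ≤ ‖conv1 K g z‖ₑ ^ 2} + (volume Ω' +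
          volume ({z | L ≤ ‖conv1 K b z‖ₑ} ∩ Ω'ᶜ)) :=
        (measure_mono hsub).trans ((measure_union_le _ _).trans
          (add_le_add le_rfl (measure_union_le _ _)))
    _ ≤ (A * L⁻¹ ^ 2 * (∫⁻ y in {y | ‖f y‖ ≤ l}, ‖f y‖ₑ ^ 2) + A * D ^ 2 * volume Ω) +
          (starConst m * volume Ω + 2 * A * D * volume Ω) :=
        add_le_add hP1 (add_le_add (volume_biUnion_pstar_le hS) hP3)
    _ = A * L⁻¹ ^ 2 * (∫⁻ y in {y | ‖f y‖ ≤ l}, ‖f y‖ₑ ^ 2) +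
          (A * D ^ 2 + starConst m + 2 * A * D) * volume Ω := by generalize L⁻¹ = Li; ring
    _ ≤ A * L⁻¹ ^ 2 * (∫⁻ y in {y | ‖f y‖ ≤ l}, ‖f y‖ₑ ^ 2) +
          (A * D ^ 2 + starConst m + 2 * A * D) *
            (2 * L⁻¹ * ∫⁻ y in {y | l / 2 < ‖f y‖}, ‖f y‖ₑ) := by gcongr
    _ = _ := by
        rw [weakConst, ← hD]
        push_cast
        generalize L⁻¹ = Li
        ring

/-! ### The strong-type estimate for `1 < p < 2` -/

lemma lintegral_tail_rpow_le {p : ℝ} (hp2 : p < 2) {c : ℝ} (hc : 0 ≤ c) :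
    ∫⁻ l in Set.Ioi (0 : ℝ), (if c ≤ l then ENNReal.ofReal (l ^ (p - 3)) else 0) *
      ENNReal.ofReal c ^ 2 ≤ ENNReal.ofReal (2 - p)⁻¹ * ENNReal.ofReal (c ^ p) := by
  rw [lintegral_mul_const' _ _ (by simp)]
  rcases hc.eq_or_lt with rfl | hc
  · simp
  have h1 : ∫⁻ l in Set.Ioi (0 : ℝ), (if c ≤ l then ENNReal.ofReal (l ^ (p - 3)) else 0) ≤
      ∫⁻ l in Set.Ici c, ENNReal.ofReal (l ^ (p - 3)) := by
    refine (setLIntegral_le_lintegral _ _).trans (le_of_eq ?_)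
    rw [← lintegral_indicator measurableSet_Ici]
    rfl
  refine (mul_le_mul_left h1 _).trans (le_of_eq ?_)
  rw [restrict_Ioi_eq_restrict_Ici.symm, ← ofReal_integral_eq_lintegral_ofReal
    (integrableOn_Ioi_rpow_of_lt (by linarith) hc)
    ((ae_restrict_mem measurableSet_Ioi).mono fun l hl => Real.rpow_nonneg
      (hc.le.trans (le_of_lt hl)) _), integral_Ioi_rpow_of_lt (by linarith) hc,
    ← ENNReal.ofReal_pow hc.le, ← ENNReal.ofReal_mul', ← ENNReal.ofReal_mul']
  · congr 1
    have : c ^ p = c ^ (p - 3 + 1) * c ^ 2 := by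
      rw [← Real.rpow_natCast, ← Real.rpow_add hc]; congr 1; push_cast; ring
    rw [this, show p - 3 + 1 = -(2 - p) by ring, neg_div_neg_eq]
    ring
  · positivity
  · positivity

lemma lintegral_head_rpow_le {p : ℝ} (hp1 : 1 < p) {c : ℝ} (hc : 0 ≤ c) :
    ∫⁻ l in Set.Ioi (0 : ℝ), (if l / 2 < c then ENNReal.ofReal (l ^ (p - 2)) else 0) *
      ENNReal.ofReal c ≤ ENNReal.ofReal (2 ^ (p - 1) / (p - 1)) * ENNReal.ofReal (c ^ p) := by
  rw [lintegral_mul_const' _ _ (by simp)]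
  rcases hc.eq_or_lt with rfl | hc
  · simp
  have h1 : ∫⁻ l in Set.Ioi (0 : ℝ), (if l / 2 < c then ENNReal.ofReal (l ^ (p - 2)) else 0) ≤
      ∫⁻ l in Set.Ioc 0 (2 * c), ENNReal.ofReal (l ^ (p - 2)) := by
    rw [← lintegral_indicator measurableSet_Ioi, ← lintegral_indicator measurableSet_Ioc]
    refine lintegral_mono fun l => ?_
    by_cases h0 : 0 < l
    · rw [Set.indicator_of_mem (show l ∈ Set.Ioi 0 from h0)]
      split_ifs with h
      · rw [Set.indicator_of_mem (show l ∈ Set.Ioc 0 (2 * c) from ⟨h0, by linarith⟩)]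
      · exact zero_le
    · rw [Set.indicator_of_notMem (show l ∉ Set.Ioi 0 from h0)]
      exact zero_le
  refine (mul_le_mul_left h1 _).trans (le_of_eq ?_)
  have h2c : 0 ≤ 2 * c := by positivity
  rw [← ofReal_integral_eq_lintegral_ofReal
    ((intervalIntegrable_iff_integrableOn_Ioc_of_le h2c).1
      (intervalIntegral.intervalIntegrable_rpow' (by linarith)))
    ((ae_restrict_mem measurableSet_Ioc).mono fun l hl => Real.rpow_nonneg hl.1.le _),
    ← intervalIntegral.integral_of_le h2c, integral_rpow (Or.inl (by linarith)),
    ← ENNReal.ofReal_mul', ← ENNReal.ofReal_mul']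
  · congr 1
    have : c ^ p = c ^ (p - 1) * c := by
      rw [← Real.rpow_add_one hc.ne']; norm_num
    rw [this, show p - 2 + 1 = p - 1 by ring, Real.zero_rpow (by linarith),
      Real.mul_rpow (by norm_num) hc.le]
    ring
  · positivity
  · positivity

lemma CZKernel.exists_lintegral_rpow_le_of_lt_two (m : ℕ) (A : ℝ≥0) {p : ℝ} (hp1 : 1 < p)
    (hp2 : p < 2) : ∃ C : ℝ≥0, ∀ K : Rn1 m → ℂ, CZKernel A K → ∀ f : Rn1 m → ℂ, Nice f →
      ∫⁻ z, ‖conv1 K f z‖ₑ ^ p ≤ C * ∫⁻ y, ‖f y‖ₑ ^ p := by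
  have hp0 : 0 < p := by linarith
  set C1 : ℝ≥0∞ := A * ENNReal.ofReal (2 - p)⁻¹ +
    weakConst m A * ENNReal.ofReal (2 ^ (p - 1) / (p - 1)) with hC1
  have hC1t : 2 ^ p * (ENNReal.ofReal p * C1) ≠ ⊤ := by
    refine ENNReal.mul_ne_top (ENNReal.rpow_ne_top_of_nonneg hp0.le (by simp))
      (ENNReal.mul_ne_top (by simp) (ENNReal.add_ne_top.2 ⟨?_, ?_⟩)) <;>
    exact ENNReal.mul_ne_top (by simp) (by simp)
  refine ⟨(2 ^ p * (ENNReal.ofReal p * C1)).toNNReal, fun K hK f hf => ?_⟩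
  rw [ENNReal.coe_toNNReal hC1t]
  have hKm : AEStronglyMeasurable (conv1 K f) :=
    aestronglyMeasurable_conv1 hK.meas hf.int.aestronglyMeasurable
  set G1 : ℝ → Rn1 m → ℝ≥0∞ := fun l y =>
    (if ‖f y‖ ≤ l then ENNReal.ofReal (l ^ (p - 3)) else 0) * ENNReal.ofReal ‖f y‖ ^ 2 with hG1
  set G2 : ℝ → Rn1 m → ℝ≥0∞ := fun l y =>
    (if l / 2 < ‖f y‖ then ENNReal.ofReal (l ^ (p - 2)) else 0) * ENNReal.ofReal ‖f y‖ with hG2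
  have hfm : Measurable f := hf.cont.measurable
  have hG1m : Measurable (Function.uncurry G1) := by
    refine Measurable.mul (Measurable.ite (measurableSet_le (hfm.comp measurable_snd).norm
      measurable_fst) ?_ measurable_const) ?_
    · exact (measurable_fst.pow_const _).ennreal_ofReal
    · exact ((hfm.comp measurable_snd).norm.ennreal_ofReal).pow_const _
  have hG2m : Measurable (Function.uncurry G2) := by
    refine Measurable.mul (Measurable.ite (measurableSet_lt (measurable_fst.div_const _)
      (hfm.comp measurable_snd).norm) ?_ measurable_const) ?_
    · exact (measurable_fst.pow_const _).ennreal_ofReal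
    · exact ((hfm.comp measurable_snd).norm.ennreal_ofReal)
  have hfp : ∀ y, ENNReal.ofReal (‖f y‖ ^ p) = ‖f y‖ₑ ^ p := fun y => by
    rw [← ENNReal.ofReal_rpow_of_nonneg (norm_nonneg _) hp0.le, ofReal_norm]
  have hpt : ∀ l ∈ Set.Ioi (0 : ℝ),
      volume {z | l < ‖conv1 K f z‖ / 2} * ENNReal.ofReal (l ^ (p - 1)) ≤
        A * (∫⁻ y, G1 l y) + weakConst m A * ∫⁻ y, G2 l y := by
    intro l hl
    have hl : 0 < l := hl
    have e0 : {z | l < ‖conv1 K f z‖ / 2} = {z | 2 * l < ‖conv1 K f z‖} := by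
      ext z
      simp only [Set.mem_ofPred_eq]
      rw [lt_div_iff₀' two_pos]
    have e1 : ∫⁻ y, G1 l y = ENNReal.ofReal (l ^ (p - 3)) *
        ∫⁻ y in {y | ‖f y‖ ≤ l}, ‖f y‖ₑ ^ 2 := by
      rw [← lintegral_indicator (measurableSet_le hfm.norm measurable_const),
        ← lintegral_const_mul' _ _ ENNReal.ofReal_ne_top]
      refine lintegral_congr fun y => ?_
      by_cases h : ‖f y‖ ≤ l <;> simp [hG1, Set.indicator, h]
    have e2 : ∫⁻ y, G2 l y = ENNReal.ofReal (l ^ (p - 2)) *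
        ∫⁻ y in {y | l / 2 < ‖f y‖}, ‖f y‖ₑ := by
      rw [← lintegral_indicator (measurableSet_lt measurable_const hfm.norm),
        ← lintegral_const_mul' _ _ ENNReal.ofReal_ne_top]
      refine lintegral_congr fun y => ?_
      by_cases h : l / 2 < ‖f y‖ <;> simp [hG2, Set.indicator, h]
    have i1 : ENNReal.ofReal (l ^ (p - 3)) =
        (ENNReal.ofReal l)⁻¹ ^ 2 * ENNReal.ofReal (l ^ (p - 1)) := by
      rw [← ENNReal.ofReal_inv_of_pos hl, ← ENNReal.ofReal_pow (by positivity),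
        ← ENNReal.ofReal_mul (by positivity)]
      congr 1
      rw [← Real.rpow_neg_one, ← Real.rpow_natCast, ← Real.rpow_mul hl.le, ← Real.rpow_add hl]
      congr 1; push_cast; ring
    have i2 : ENNReal.ofReal (l ^ (p - 2)) =
        (ENNReal.ofReal l)⁻¹ * ENNReal.ofReal (l ^ (p - 1)) := by
      rw [← ENNReal.ofReal_inv_of_pos hl, ← ENNReal.ofReal_mul (by positivity)]
      congr 1
      rw [← Real.rpow_neg_one, ← Real.rpow_add hl]
      congr 1; ring
    rw [e0, e1, e2, i1, i2]
    refine (mul_le_mul_left (hK.weak hf hl) _).trans (le_of_eq ?_)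
    generalize (ENNReal.ofReal l)⁻¹ = Li
    ring
  have hG1m' : Measurable fun l => ∫⁻ y, G1 l y := hG1m.lintegral_prod_right'
  have hmain : ∫⁻ z, ENNReal.ofReal ((‖conv1 K f z‖ / 2) ^ p) ≤
      ENNReal.ofReal p * (C1 * ∫⁻ y, ‖f y‖ₑ ^ p) := by
    rw [lintegral_rpow_eq_lintegral_meas_lt_mul volume (ae_of_all _ fun z => by positivity)
      (hKm.norm.aemeasurable.div_const 2) hp0]
    refine mul_le_mul_right ((setLIntegral_mono' measurableSet_Ioi hpt).trans ?_) _
    rw [lintegral_add_left (hG1m'.const_mul _),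
      lintegral_const_mul' _ _ ENNReal.coe_ne_top, lintegral_const_mul' _ _ ENNReal.coe_ne_top,
      lintegral_lintegral_swap hG1m.aemeasurable, lintegral_lintegral_swap hG2m.aemeasurable, hC1,
      add_mul, mul_assoc, mul_assoc]
    refine add_le_add (mul_le_mul_right ?_ _) (mul_le_mul_right ?_ _)
    · rw [← lintegral_const_mul' _ _ ENNReal.ofReal_ne_top]
      refine lintegral_mono fun y => ?_
      rw [← hfp]
      exact lintegral_tail_rpow_le hp2 (norm_nonneg _)
    · rw [← lintegral_const_mul' _ _ ENNReal.ofReal_ne_top]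
      refine lintegral_mono fun y => ?_
      rw [← hfp]
      exact lintegral_head_rpow_le hp1 (norm_nonneg _)
  have hfin : ∀ z, ‖conv1 K f z‖ₑ ^ p = 2 ^ p * ENNReal.ofReal ((‖conv1 K f z‖ / 2) ^ p) := by
    intro z
    rw [← ENNReal.ofReal_rpow_of_nonneg (by positivity) hp0.le,
      ← ENNReal.mul_rpow_of_nonneg _ _ hp0.le, ENNReal.ofReal_div_of_pos two_pos,
      ENNReal.ofReal_ofNat, ENNReal.mul_div_cancel two_ne_zero ENNReal.ofNat_ne_top, ofReal_norm]
  simp_rw [hfin]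
  rw [lintegral_const_mul' _ _ (ENNReal.rpow_ne_top_of_nonneg hp0.le (by simp))]
  refine (mul_le_mul_right hmain _).trans (le_of_eq ?_)
  ring

/-! ### Duality and the strong-type estimate for `1 < p < ∞` -/

lemma conv1_eq_integral_sub {m : ℕ} (K f : Rn1 m → ℂ) (x : Rn1 m) :
    conv1 K f x = ∫ y, K y * f (x - y) := by
  unfold conv1
  rw [← integral_sub_left_eq_self (fun y => K y * f (x - y)) volume x]
  simp

lemma Nice.conv1 {m : ℕ} {K f : Rn1 m → ℂ} (hf : Nice f) (hKm : Measurable K)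
    (hK : Integrable K) : Nice (conv1 K f) := by
  obtain ⟨C, hC⟩ := hf.bdd
  have hle : ∀ x y, ‖K y * f (x - y)‖ ≤ C * ‖K y‖ := fun x y => by
    rw [norm_mul, mul_comm]; gcongr; exact hC _
  refine ⟨?_, ?_, C * ∫ y, ‖K y‖, fun x => ?_⟩
  · have : _root_.conv1 K f = fun x => ∫ y, K y * f (x - y) := funext (conv1_eq_integral_sub K f)
    rw [this]
    refine continuous_of_dominated (bound := fun y => C * ‖K y‖) (fun x => ?_)
      (fun x => ae_of_all _ (hle x)) (hK.norm.const_mul C) (ae_of_all _ fun y => ?_)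
    · exact hK.aestronglyMeasurable.mul
        (hf.cont.comp (continuous_const.sub continuous_id)).aestronglyMeasurable
    · exact continuous_const.mul (hf.cont.comp (continuous_id.sub continuous_const))
  · refine ⟨aestronglyMeasurable_conv1 hKm hf.int.aestronglyMeasurable, ?_⟩
    have hm : Measurable (Function.uncurry fun x y : Rn1 m => ‖K (x - y)‖ₑ * ‖f y‖ₑ) :=
      ((hKm.comp (measurable_fst.sub measurable_snd)).enorm).mul
        (hf.cont.measurable.comp measurable_snd).enorm
    calc ∫⁻ x, ‖_root_.conv1 K f x‖ₑ ≤ ∫⁻ x, ∫⁻ y, ‖K (x - y)‖ₑ * ‖f y‖ₑ := by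
          refine lintegral_mono fun x => (enorm_integral_le_lintegral_enorm _).trans (le_of_eq ?_)
          simp_rw [enorm_mul]
      _ = ∫⁻ y, (∫⁻ x, ‖K x‖ₑ) * ‖f y‖ₑ := by
          rw [lintegral_lintegral_swap hm.aemeasurable]
          refine lintegral_congr fun y => ?_
          rw [lintegral_mul_const' _ _ enorm_ne_top,
            lintegral_sub_right_eq_self (fun x => ‖K x‖ₑ) y]
      _ = (∫⁻ x, ‖K x‖ₑ) * ∫⁻ y, ‖f y‖ₑ := lintegral_const_mul' _ _ hK.2.ne
      _ < ⊤ := ENNReal.mul_lt_top hK.2 hf.int.2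
  · rw [conv1_eq_integral_sub, ← integral_const_mul]
    exact norm_integral_le_of_norm_le (hK.norm.const_mul C) (ae_of_all _ (hle x))

lemma conv1_neg {m : ℕ} (K g : Rn1 m → ℂ) (x : Rn1 m) :
    conv1 (fun y => K (-y)) g x = conv1 K (fun y => g (-y)) (-x) := by
  unfold conv1
  rw [← integral_neg_eq_self]
  refine integral_congr_ae (ae_of_all _ fun y => ?_)
  change K (-(x - -y)) * _ = K (-x - y) * _
  rw [show -(x - -y) = -x - y by abel]

lemma CZKernel.neg {m : ℕ} {A : ℝ≥0} {K : Rn1 m → ℂ} (hK : CZKernel A K) :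
    CZKernel A fun x => K (-x) := by
  refine ⟨hK.meas.comp measurable_neg, hK.int.comp_neg, fun g hg hgb => ?_, fun δ hδ w h1 h2 => ?_⟩
  · obtain ⟨C, hC⟩ := hgb
    have := hK.l2 (fun y => g (-y)) hg.comp_neg ⟨C, fun x => hC _⟩
    rw [lintegral_neg_eq_self (fun y => ‖g y‖ₑ ^ 2)] at this
    rw [← lintegral_neg_eq_self] at this
    simpa only [conv1_neg] using this
  · have := hK.horm δ hδ (-w) (by simpa using h1) (by simpa using h2)
    refine le_trans (le_of_eq ?_) this
    have hm : MeasurableSet {z : Rn1 m | 2 * δ < ‖z.1‖ ∨ 2 * δ ^ 2 < |z.2|} :=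
      (measurableSet_lt measurable_const measurable_fst.norm).union
        (measurableSet_lt measurable_const measurable_snd.norm)
    rw [← lintegral_indicator hm, ← lintegral_indicator hm, ← lintegral_neg_eq_self]
    refine lintegral_congr fun z => ?_
    simp only [Set.indicator, Set.mem_ofPred_eq, Prod.fst_neg, Prod.snd_neg, norm_neg, abs_neg,
      neg_neg, neg_sub, sub_neg_eq_add, add_comm w]

lemma integral_conv1_mul {m : ℕ} {K f g : Rn1 m → ℂ} (hK : Integrable K)
    (hf : Nice f) (hg : Nice g) :
    ∫ x, conv1 K f x * g x = ∫ y, f y * conv1 (fun z => K (-z)) g y := by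
  unfold conv1
  simp_rw [← integral_mul_const, ← integral_const_mul]
  obtain ⟨C, hC⟩ := hg.bdd
  rw [integral_integral_swap]
  · refine integral_congr_ae (ae_of_all _ fun y => integral_congr_ae (ae_of_all _ fun x => ?_))
    change K (x - y) * f y * g x = f y * (K (-(y - x)) * g x)
    rw [neg_sub]; ring
  · have hconv : Integrable fun p : Rn1 m × Rn1 m => K (p.1 - p.2) * f p.2 := by
      have h := (hf.int.convolution_integrand (ContinuousLinearMap.mul ℝ ℂ) hK
        (μ := volume) (ν := volume))
      refine h.congr (ae_of_all _ fun p => ?_)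
      simp [mul_comm]
    exact hconv.mul_bdd (c := C) (hg.cont.comp continuous_fst).aestronglyMeasurable
      (ae_of_all _ fun p => hC _)

lemma Nice.dual {m : ℕ} {h : Rn1 m → ℂ} (hh : Nice h) {p : ℝ} (hp : 2 < p) :
    Nice fun x => ((‖h x‖ ^ (p - 2) : ℝ) : ℂ) * (starRingEnd ℂ) (h x) := by
  obtain ⟨C, hC⟩ := hh.bdd
  have hp0 : 0 ≤ p - 2 := by linarith
  have hcont : Continuous fun x => ((‖h x‖ ^ (p - 2) : ℝ) : ℂ) :=
    continuous_ofReal.comp (hh.cont.norm.rpow_const fun _ => Or.inr hp0)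
  have hb : ∀ x, ‖((‖h x‖ ^ (p - 2) : ℝ) : ℂ)‖ ≤ C ^ (p - 2) := fun x => by
    rw [Complex.norm_real, Real.norm_of_nonneg (by positivity)]
    exact Real.rpow_le_rpow (norm_nonneg _) (hC x) hp0
  have hconj : Continuous fun x => (starRingEnd ℂ) (h x) := continuous_conj.comp hh.cont
  refine ⟨hcont.mul hconj, ?_, C ^ (p - 2) * C, fun x => ?_⟩
  · refine Integrable.bdd_mul (c := C ^ (p - 2)) ?_ hcont.aestronglyMeasurable (ae_of_all _ hb)
    exact hh.int.norm.mono' hconj.aestronglyMeasurable (ae_of_all _ fun x => by simp)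
  · rw [norm_mul, RCLike.norm_conj]
    exact mul_le_mul (hb x) (hC x) (norm_nonneg _) ((norm_nonneg _).trans (hb x))

lemma Nice.lintegral_rpow_ne_top {m : ℕ} {h : Rn1 m → ℂ} (hh : Nice h) {p : ℝ} (hp : 1 ≤ p) :
    ∫⁻ x, ‖h x‖ₑ ^ p ≠ ⊤ := by
  obtain ⟨C, hC⟩ := hh.bdd
  have hle : ∀ x, ‖h x‖ₑ ^ p ≤ ENNReal.ofReal C ^ (p - 1) * ‖h x‖ₑ := fun x => by
    have h1 : ‖h x‖ₑ ^ p = ‖h x‖ₑ ^ (p - 1) * ‖h x‖ₑ := by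
      nth_rw 3 [← ENNReal.rpow_one ‖h x‖ₑ]
      rw [← ENNReal.rpow_add_of_nonneg _ _ (by linarith) zero_le_one]; norm_num
    rw [h1]
    refine mul_le_mul_left (ENNReal.rpow_le_rpow ?_ (by linarith)) _
    rw [← ofReal_norm]; exact ENNReal.ofReal_le_ofReal (hC x)
  have hct : ENNReal.ofReal C ^ (p - 1) ≠ ⊤ :=
    ENNReal.rpow_ne_top_of_nonneg (by linarith) ENNReal.ofReal_ne_top
  refine ne_top_of_le_ne_top ?_ (lintegral_mono hle)
  rw [lintegral_const_mul' _ _ hct]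
  exact ENNReal.mul_ne_top hct hh.int.2.ne

/-- The Calderón–Zygmund theorem for truncated kernels. -/
theorem CZKernel.exists_lintegral_rpow_le (m : ℕ) (A : ℝ≥0) {p : ℝ} (hp1 : 1 < p) :
    ∃ C : ℝ≥0, ∀ K : Rn1 m → ℂ, CZKernel A K → ∀ f : Rn1 m → ℂ, Nice f →
      ∫⁻ z, ‖conv1 K f z‖ₑ ^ p ≤ C * ∫⁻ y, ‖f y‖ₑ ^ p := by
  rcases lt_trichotomy p 2 with hp2 | rfl | hp2
  · exact CZKernel.exists_lintegral_rpow_le_of_lt_two m A hp1 hp2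
  · refine ⟨A, fun K hK f hf => ?_⟩
    simpa only [ENNReal.rpow_two] using hK.l2 f hf.int hf.bdd
  have hp0 : 0 < p := by linarith
  set q : ℝ := p / (p - 1) with hq
  have hpq : p.HolderConjugate q := Real.HolderConjugate.conjExponent hp1
  have hq1 : 1 < q := hpq.symm.lt
  have hq2 : q < 2 := by rw [hq, div_lt_iff₀ (by linarith)]; linarith
  obtain ⟨C, hC⟩ := CZKernel.exists_lintegral_rpow_le_of_lt_two m A hq1 hq2
  refine ⟨(C ^ (1 / q)) ^ p, fun K hK f hf => ?_⟩
  have hh := hf.conv1 hK.meas hK.int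
  set h := conv1 K f with hhdef
  have hg := hh.dual hp2
  set g : Rn1 m → ℂ := fun x => ((‖h x‖ ^ (p - 2) : ℝ) : ℂ) * (starRingEnd ℂ) (h x) with hgdef
  have hgn : ∀ x, ‖g x‖ = ‖h x‖ ^ (p - 1) := fun x => by
    simp only [hgdef]
    rw [norm_mul, RCLike.norm_conj, Complex.norm_real, Real.norm_of_nonneg (by positivity)]
    rcases (norm_nonneg (h x)).eq_or_lt with h0 | h0
    · rw [← h0, Real.zero_rpow (by linarith), Real.zero_rpow (by linarith), zero_mul]
    · rw [← Real.rpow_add_one h0.ne']; congr 1; ring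
  have hhg : ∀ x, h x * g x = ((‖h x‖ ^ p : ℝ) : ℂ) := fun x => by
    simp only [hgdef]
    rw [mul_left_comm, Complex.mul_conj, Complex.normSq_eq_norm_sq, ← Complex.ofReal_mul]
    congr 1
    rw [← Real.rpow_natCast, ← Real.rpow_add' (norm_nonneg _) (by norm_num; linarith)]
    congr 1; norm_num
  set I := ∫⁻ x, ‖h x‖ₑ ^ p with hI
  have hIt : I ≠ ⊤ := hh.lintegral_rpow_ne_top hp1.le
  have e1 : I ≤ ∫⁻ y, ‖f y‖ₑ * ‖conv1 (fun z => K (-z)) g y‖ₑ := by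
    have h_int : Integrable fun x => ‖h x‖ ^ p := by
      refine ⟨(hh.cont.norm.rpow_const fun _ => Or.inr hp0.le).aestronglyMeasurable, ?_⟩
      refine lt_of_le_of_lt (le_of_eq (lintegral_congr fun x => ?_)) hIt.lt_top
      rw [Real.enorm_of_nonneg (by positivity), ← ENNReal.ofReal_rpow_of_nonneg (norm_nonneg _)
        hp0.le, ofReal_norm]
    have e2 : I = ENNReal.ofReal (∫ x, ‖h x‖ ^ p) := by
      rw [ofReal_integral_eq_lintegral_ofReal h_int (ae_of_all _ fun x => by positivity)]
      refine lintegral_congr fun x => ?_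
      rw [← ENNReal.ofReal_rpow_of_nonneg (norm_nonneg _) hp0.le, ofReal_norm]
    have e3 : ((∫ x, ‖h x‖ ^ p : ℝ) : ℂ) = ∫ y, f y * conv1 (fun z => K (-z)) g y := by
      rw [← integral_conv1_mul hK.int hf hg, ← integral_complex_ofReal]
      exact integral_congr_ae (ae_of_all _ fun x => (hhg x).symm)
    calc I = ‖((∫ x, ‖h x‖ ^ p : ℝ) : ℂ)‖ₑ := by
          rw [e2, ← ofReal_norm, Complex.norm_real,
            Real.norm_of_nonneg (integral_nonneg fun x => by positivity)]
      _ ≤ _ := by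
          rw [e3]
          refine (enorm_integral_le_lintegral_enorm _).trans (le_of_eq ?_)
          simp_rw [enorm_mul]
  have e4 : I ≤ (∫⁻ y, ‖f y‖ₑ ^ p) ^ (1 / p) * (C * I) ^ (1 / q) := by
    refine e1.trans ((ENNReal.lintegral_mul_le_Lp_mul_Lq volume hpq
      hf.cont.aestronglyMeasurable.enorm
      (aestronglyMeasurable_conv1 hK.neg.meas hg.int.aestronglyMeasurable).enorm).trans ?_)
    refine mul_le_mul_right (ENNReal.rpow_le_rpow ?_ (by positivity)) _
    refine (hC _ hK.neg g hg).trans (le_of_eq ?_)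
    congr 1
    refine lintegral_congr fun x => ?_
    rw [← ofReal_norm, hgn, ← ENNReal.ofReal_rpow_of_nonneg (norm_nonneg _) (by linarith),
      ofReal_norm, ← ENNReal.rpow_mul]
    congr 1
    rw [hq]; field_simp [show p - 1 ≠ 0 by linarith]
  rcases eq_or_ne I 0 with h0 | h0
  · rw [h0]; exact zero_le
  have hpq' : 1 / p + 1 / q = 1 := by simpa using hpq.inv_add_inv_eq_one
  have e5 : I ^ (1 / p) ≤ C ^ (1 / q) * (∫⁻ y, ‖f y‖ₑ ^ p) ^ (1 / p) := by
    have h1 : I ^ (1 / q) ≠ 0 := (ENNReal.rpow_pos (pos_iff_ne_zero.2 h0) hIt).ne'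
    have h2 : I ^ (1 / q) ≠ ⊤ := ENNReal.rpow_ne_top_of_nonneg (by positivity) hIt
    rw [← ENNReal.mul_le_mul_iff_left h1 h2, ← ENNReal.rpow_add _ _ h0 hIt, hpq', ENNReal.rpow_one]
    refine e4.trans (le_of_eq ?_)
    rw [ENNReal.mul_rpow_of_nonneg _ _ (by positivity)]
    ring
  have e6 := ENNReal.rpow_le_rpow e5 hp0.le
  rw [← ENNReal.rpow_mul, one_div_mul_cancel hp0.ne', ENNReal.rpow_one,
    ENNReal.mul_rpow_of_nonneg _ _ hp0.le, ← ENNReal.rpow_mul (∫⁻ y, ‖f y‖ₑ ^ p),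
    one_div_mul_cancel hp0.ne', ENNReal.rpow_one] at e6
  rwa [ENNReal.coe_rpow_of_nonneg _ hp0.le, ENNReal.coe_rpow_of_nonneg _ (by positivity)]

/-! ### Fourier inversion and Plancherel on `ℝ^{n+1}` -/

/-- The character `e^{2πi(X·ξ + tτ)}`. -/
def char1 {m : ℕ} (p q : Rn1 m) : ℂ :=
  Complex.exp ((2 * (π : ℂ) * Complex.I) * (((∑ k, p.1 k * q.1 k) + p.2 * q.2 : ℝ) : ℂ))

lemma norm_char1 {m : ℕ} (p q : Rn1 m) : ‖char1 p q‖ = 1 := by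
  rw [char1, show (2 * (π : ℂ) * Complex.I) * (((∑ k, p.1 k * q.1 k) + p.2 * q.2 : ℝ) : ℂ)
    = ((2 * π * ((∑ k, p.1 k * q.1 k) + p.2 * q.2) : ℝ) : ℂ) * Complex.I by push_cast; ring]
  exact Complex.norm_exp_ofReal_mul_I _

lemma char1_comm {m : ℕ} (p q : Rn1 m) : char1 p q = char1 q p := by
  simp only [char1, mul_comm]

lemma char1_add {m : ℕ} (p p' q : Rn1 m) : char1 (p + p') q = char1 p q * char1 p' q := by
  rw [char1, char1, char1, ← Complex.exp_add]
  congr 1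
  rw [← mul_add, ← Complex.ofReal_add]
  congr 2
  simp only [Prod.fst_add, Prod.snd_add, PiLp.add_apply, add_mul, Finset.sum_add_distrib]
  ring

lemma char1_neg {m : ℕ} (p q : Rn1 m) : char1 (-p) q =
    Complex.exp (-(2 * (π : ℂ) * Complex.I) * (((∑ k, p.1 k * q.1 k) + p.2 * q.2 : ℝ) : ℂ)) := by
  rw [char1]
  congr 1
  simp only [Prod.fst_neg, Prod.snd_neg, PiLp.neg_apply, neg_mul, Finset.sum_neg_distrib]
  push_cast; ring

lemma conj_char1 {m : ℕ} (p q : Rn1 m) : (starRingEnd ℂ) (char1 p q) = char1 (-p) q := by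
  rw [char1_neg, char1, ← Complex.exp_conj]
  congr 1
  simp only [map_mul, Complex.conj_I, Complex.conj_ofReal, map_ofNat]
  simp

lemma FT1_eq {m : ℕ} (f : Rn1 m → ℂ) (q : Rn1 m) : FT1 f q = ∫ p, char1 (-p) q * f p := by
  simp only [FT1, char1_neg]

lemma IFT1_eq {m : ℕ} (f : Rn1 m → ℂ) (x : Rn1 m) : IFT1 f x = ∫ q, char1 q x * f q := rfl

@[fun_prop]
lemma continuous_char1 {m : ℕ} : Continuous fun z : Rn1 m × Rn1 m => char1 z.1 z.2 := by
  unfold char1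
  fun_prop

lemma exists_schwartz_FT1 {m : ℕ} (φ : SchwartzMap (Rn1 m) ℂ) :
    ∃ ψ : SchwartzMap (Rn1 m) ℂ, (∀ q, FT1 φ q = ψ q) ∧ ∀ x, IFT1 ψ x = φ x := by
  let L := WithLp.prodContinuousLinearEquiv 2 ℝ (Rn m) ℝ
  let Φ := SchwartzMap.compCLMOfContinuousLinearEquiv ℂ L φ
  let Ψ := SchwartzMap.compCLMOfContinuousLinearEquiv ℂ L.symm (FourierTransform.fourier Φ)
  have hmp := WithLp.volume_preserving_ofLp (Rn m) ℝ
  have hem : MeasurableEmbedding (WithLp.ofLp (p := 2) (V := Rn m × ℝ)) :=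
    L.toHomeomorph.measurableEmbedding
  have hin : ∀ v w : WithLp 2 (Rn m × ℝ), (inner ℝ v w : ℝ)
      = (∑ k, v.ofLp.1 k * w.ofLp.1 k) + v.ofLp.2 * w.ofLp.2 := fun v w => by
    rw [WithLp.prod_inner_apply, PiLp.inner_apply]
    simp [mul_comm]
  have h1 : ∀ q, FT1 φ q = Ψ q := fun q => by
    have : Ψ q = FourierTransform.fourier (Φ : WithLp 2 (Rn m × ℝ) → ℂ) (L.symm q) := by
      rw [SchwartzMap.compCLMOfContinuousLinearEquiv_apply, ← SchwartzMap.fourier_coe]; rfl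
    rw [this, Real.fourier_eq', FT1, ← hmp.integral_comp hem]
    refine integral_congr_ae (ae_of_all _ fun v => ?_)
    have hq : (L.symm q).ofLp = q := rfl
    simp only [hin, hq, smul_eq_mul]
    congr 2
    push_cast; ring
  refine ⟨Ψ, h1, fun x => ?_⟩
  have h2 : φ x = FourierTransformInv.fourierInv (FourierTransform.fourier
      (Φ : WithLp 2 (Rn m × ℝ) → ℂ)) (L.symm x) := by
    rw [← SchwartzMap.fourier_coe, ← SchwartzMap.fourierInv_coe,
      FourierTransform.fourierInv_fourier_eq]
    rfl
  rw [h2, Real.fourierInv_eq', IFT1, ← hmp.integral_comp hem]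
  refine integral_congr_ae (ae_of_all _ fun v => ?_)
  have hq : (L.symm x).ofLp = x := rfl
  have hv : Ψ v.ofLp = FourierTransform.fourier (Φ : WithLp 2 (Rn m × ℝ) → ℂ) v := by
    rw [SchwartzMap.compCLMOfContinuousLinearEquiv_apply, ← SchwartzMap.fourier_coe]; rfl
  simp only [hin, hq, smul_eq_mul, hv]
  congr 2
  push_cast; ring

lemma nice_schwartz {m : ℕ} (φ : SchwartzMap (Rn1 m) ℂ) : Nice φ := by
  refine ⟨φ.continuous, φ.integrable, ?_⟩
  obtain ⟨C, hC⟩ := φ.decay 0 0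
  exact ⟨C, fun x => by simpa using hC.2 x⟩

lemma norm_FT1_le {m : ℕ} (K : Rn1 m → ℂ) (q : Rn1 m) : ‖FT1 K q‖ ≤ ∫ p, ‖K p‖ := by
  rw [FT1_eq]
  refine (norm_integral_le_integral_norm _).trans (le_of_eq ?_)
  simp [norm_char1]

lemma continuous_FT1 {m : ℕ} {K : Rn1 m → ℂ} (hK : Integrable K) : Continuous (FT1 K) := by
  have : FT1 K = fun q => ∫ p, char1 (-p) q * K p := funext (FT1_eq K)
  rw [this]
  refine continuous_of_dominated (bound := fun y => ‖K y‖) (fun x => ?_)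
      (fun x => ae_of_all _ fun p => ?_) hK.norm (ae_of_all _ fun y => ?_)
  · exact (by fun_prop : Continuous fun p : Rn1 m => char1 (-p) x).aestronglyMeasurable.mul
      hK.aestronglyMeasurable
  · simp [norm_char1]
  · fun_prop

lemma integrable_char1_mul {m : ℕ} {K : Rn1 m → ℂ} (hK : Integrable K) (x : Rn1 m) :
    Integrable fun q => char1 q x * K q :=
  hK.bdd_mul (c := 1) (by fun_prop : Continuous fun q : Rn1 m => char1 q x).aestronglyMeasurable
    (ae_of_all _ fun q => (norm_char1 _ _).le)

/-- Convolution of `K` with an inverse Fourier transform. -/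
lemma conv1_IFT1 {m : ℕ} {K ψ : Rn1 m → ℂ} (hK : Integrable K) (hψ : Integrable ψ) (x : Rn1 m) :
    conv1 K (IFT1 ψ) x = IFT1 (fun q => FT1 K q * ψ q) x := by
  rw [conv1_eq_integral_sub, IFT1_eq]
  simp_rw [IFT1_eq, FT1_eq, ← integral_const_mul, ← integral_mul_const, ← integral_const_mul]
  rw [integral_integral_swap]
  · refine integral_congr_ae (ae_of_all _ fun q => integral_congr_ae (ae_of_all _ fun y => ?_))
    change K y * (char1 q (x - y) * ψ q) = char1 q x * (char1 (-y) q * K y * ψ q)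
    rw [char1_comm q, sub_eq_add_neg, char1_add, char1_comm x q]
    ring
  · refine ((hK.mul_prod hψ).bdd_mul (c := 1)
      (f := fun z : Rn1 m × Rn1 m => char1 z.2 (x - z.1)) ?_
      (ae_of_all _ fun q => (norm_char1 _ _).le)).congr (ae_of_all _ fun z => ?_)
    · exact (by fun_prop : Continuous fun z : Rn1 m × Rn1 m =>
        char1 z.2 (x - z.1)).aestronglyMeasurable
    · simp only [Function.uncurry]; ring

/-- Fourier transform of a convolution. -/
lemma FT1_conv1 {m : ℕ} {K f : Rn1 m → ℂ} (hK : Integrable K) (hf : Integrable f) (q : Rn1 m) :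
    FT1 (conv1 K f) q = FT1 K q * FT1 f q := by
  have h := (hf.convolution_integrand (ContinuousLinearMap.mul ℝ ℂ) hK
        (μ := volume) (ν := volume))
  rw [FT1_eq]
  unfold conv1
  simp_rw [← integral_const_mul]
  rw [integral_integral_swap]
  · rw [FT1_eq, FT1_eq, ← integral_const_mul]
    refine integral_congr_ae (ae_of_all _ fun y => ?_)
    simp only
    rw [← integral_add_right_eq_self _ y, ← integral_mul_const]
    refine integral_congr_ae (ae_of_all _ fun x => ?_)
    simp only [add_sub_cancel_right]
    rw [neg_add, char1_add]; ring
  · refine (h.bdd_mul (c := 1)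
      (f := fun z : Rn1 m × Rn1 m => char1 (-z.1) q) ?_
      (ae_of_all _ fun q => (norm_char1 _ _).le)).congr (ae_of_all _ fun z => ?_)
    · exact (by fun_prop : Continuous fun z : Rn1 m × Rn1 m =>
        char1 (-z.1) q).aestronglyMeasurable
    · simp [Function.uncurry, mul_comm]

lemma integral_IFT1_mul_conj {m : ℕ} {u g : Rn1 m → ℂ} (hu : Integrable u) (hg : Integrable g) :
    ∫ x, IFT1 u x * (starRingEnd ℂ) (g x) = ∫ q, u q * (starRingEnd ℂ) (FT1 g q) := by
  simp_rw [IFT1_eq, FT1_eq, ← integral_conj, ← integral_const_mul, ← integral_mul_const]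
  rw [integral_integral_swap]
  · refine integral_congr_ae (ae_of_all _ fun q => integral_congr_ae (ae_of_all _ fun y => ?_))
    simp only [map_mul, conj_char1, neg_neg]
    rw [char1_comm]; ring
  · refine ((Integrable.mul_prod (f := fun x => (starRingEnd ℂ) (g x))
      ((integrable_norm_iff (by
        exact Complex.continuous_conj.comp_aestronglyMeasurable hg.1)).mp
        (by simpa using hg.norm)) hu).bdd_mul (c := 1)
      (f := fun z : Rn1 m × Rn1 m => char1 z.2 z.1) ?_
      (ae_of_all _ fun q => (norm_char1 _ _).le)).congr (ae_of_all _ fun z => ?_)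
    · exact (by fun_prop : Continuous fun z : Rn1 m × Rn1 m =>
        char1 z.2 z.1).aestronglyMeasurable
    · simp only [Function.uncurry]; ring

/-- Plancherel for `g = IFT1 u` with both `u` and `g` integrable and `FT1 g = u`. -/
lemma lintegral_enorm_sq_eq {m : ℕ} {u g : Rn1 m → ℂ} (hu : Nice u) (hg : Nice g)
    (h1 : ∀ x, g x = IFT1 u x) (h2 : ∀ q, FT1 g q = u q) :
    ∫⁻ x, ‖g x‖ₑ ^ 2 = ∫⁻ q, ‖u q‖ₑ ^ 2 := by
  have key : ∀ {v : Rn1 m → ℂ}, Nice v →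
      ∫⁻ x, ‖v x‖ₑ ^ 2 = ENNReal.ofReal (∫ x, v x * (starRingEnd ℂ) (v x)).re := fun {v} hv => by
    have e : ∀ x, v x * (starRingEnd ℂ) (v x) = ((‖v x‖ ^ 2 : ℝ) : ℂ) := fun x => by
      rw [Complex.mul_conj, Complex.normSq_eq_norm_sq]
    simp_rw [e]
    rw [integral_complex_ofReal, Complex.ofReal_re, ofReal_integral_eq_lintegral_ofReal]
    · refine lintegral_congr fun x => ?_
      rw [ENNReal.ofReal_pow (norm_nonneg _), ofReal_norm]
    · obtain ⟨C, hC⟩ := hv.bdd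
      simp_rw [pow_two]
      exact hv.int.norm.bdd_mul (c := C) hv.cont.norm.aestronglyMeasurable
        (ae_of_all _ fun x => by simpa using hC x)
    · exact ae_of_all _ fun x => by positivity
  rw [key hg, key hu]
  congr 2
  have := integral_IFT1_mul_conj hu.int hg.int
  simp_rw [← h1, h2] at this
  exact this

lemma Nice.FT1_mul {m : ℕ} {K : Rn1 m → ℂ} (hK : Integrable K) {ψ : Rn1 m → ℂ} (hψ : Nice ψ) :
    Nice fun q => FT1 K q * ψ q := by
  refine ⟨(continuous_FT1 hK).mul hψ.cont, ?_, ?_⟩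
  · exact hψ.int.bdd_mul (c := ∫ p, ‖K p‖) (continuous_FT1 hK).aestronglyMeasurable
      (ae_of_all _ fun q => norm_FT1_le K q)
  · obtain ⟨C, hC⟩ := hψ.bdd
    refine ⟨(∫ p, ‖K p‖) * C, fun x => ?_⟩
    rw [norm_mul]
    exact mul_le_mul (norm_FT1_le K x) (hC x) (norm_nonneg _)
      (integral_nonneg fun _ => norm_nonneg _)

lemma lintegral_conv1_schwartz_sq_le {m : ℕ} {K : Rn1 m → ℂ} (hKm : Measurable K)
    (hK : Integrable K) {B : ℝ≥0} (hB : ∀ q, ‖FT1 K q‖ₑ ≤ B) (φ : SchwartzMap (Rn1 m) ℂ) :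
    ∫⁻ x, ‖conv1 K φ x‖ₑ ^ 2 ≤ (B : ℝ≥0∞) ^ 2 * ∫⁻ x, ‖φ x‖ₑ ^ 2 := by
  obtain ⟨ψ, h1, h2⟩ := exists_schwartz_FT1 φ
  have hψ := nice_schwartz ψ
  rw [lintegral_enorm_sq_eq (Nice.FT1_mul hK hψ) ((nice_schwartz φ).conv1 hKm hK)
    (fun x => ?_) (fun q => ?_), lintegral_enorm_sq_eq hψ (nice_schwartz φ)
    (fun x => (h2 x).symm) h1, ← lintegral_const_mul' _ _ (by simp)]
  · refine lintegral_mono fun q => ?_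
    rw [enorm_mul, mul_pow]
    gcongr
    exact hB q
  · rw [← conv1_IFT1 hK ψ.integrable]
    simp_rw [_root_.conv1, h2]
  · rw [FT1_conv1 hK φ.integrable, h1]

/-- Young's inequality `L¹ * L² → L²`. -/
lemma lintegral_conv1_sq_le_young {m : ℕ} {K f : Rn1 m → ℂ} (hKm : Measurable K)
    (hf : AEStronglyMeasurable f) :
    ∫⁻ x, ‖conv1 K f x‖ₑ ^ 2 ≤ (∫⁻ y, ‖K y‖ₑ) ^ 2 * ∫⁻ x, ‖f x‖ₑ ^ 2 := by
  wlog hfm : Measurable f generalizing f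
  · have hc : conv1 K f = conv1 K (hf.mk f) := by
      funext x
      refine integral_congr_ae ?_
      filter_upwards [hf.ae_eq_mk] with y hy
      rw [hy]
    rw [hc]
    refine (this hf.stronglyMeasurable_mk.aestronglyMeasurable
      hf.stronglyMeasurable_mk.measurable).trans (le_of_eq ?_)
    congr 1
    refine lintegral_congr_ae ?_
    filter_upwards [hf.ae_eq_mk] with y hy
    rw [hy]
  have hpt : ∀ x, ‖conv1 K f x‖ₑ ^ 2
      ≤ (∫⁻ y, ‖K y‖ₑ) * ∫⁻ y, ‖K (x - y)‖ₑ * ‖f y‖ₑ ^ 2 := fun x => by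
    have hK' : Measurable fun y => ‖K (x - y)‖ₑ :=
      (hKm.comp (measurable_const.sub measurable_id)).enorm
    have h := ENNReal.lintegral_mul_le_Lp_mul_Lq (μ := (volume : Measure (Rn1 m)))
      (p := 2) (q := 2) (by constructor <;> norm_num)
      (f := fun y => ‖K (x - y)‖ₑ ^ (1 / 2 : ℝ))
      (g := fun y => ‖K (x - y)‖ₑ ^ (1 / 2 : ℝ) * ‖f y‖ₑ)
      (hK'.pow_const _).aemeasurable ((hK'.pow_const _).mul hfm.enorm).aemeasurable
    have e1 : ∀ a : ℝ≥0∞, (a ^ (1 / 2 : ℝ)) ^ (2 : ℝ) = a := fun a => by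
      rw [← ENNReal.rpow_mul]; norm_num
    have e2 : ∀ a : ℝ≥0∞, (a ^ (1 / 2 : ℝ)) ^ 2 = a := fun a => by
      rw [← ENNReal.rpow_natCast, ← ENNReal.rpow_mul]; norm_num
    have e3 : ∀ a : ℝ≥0∞, a ^ (1 / 2 : ℝ) * a ^ (1 / 2 : ℝ) = a := fun a => by
      rw [← pow_two, e2]
    have e4 : ∀ a b : ℝ≥0∞, (a ^ (1 / 2 : ℝ) * b) ^ (2 : ℝ) = a * b ^ 2 := fun a b => by
      rw [ENNReal.mul_rpow_of_nonneg _ _ (zero_le_two : (0 : ℝ) ≤ 2), e1, ENNReal.rpow_two]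
    simp only [Pi.mul_apply, e4, e1, ← mul_assoc, e3] at h
    calc ‖conv1 K f x‖ₑ ^ 2 ≤ (∫⁻ y, ‖K (x - y)‖ₑ * ‖f y‖ₑ) ^ 2 := by
          gcongr
          refine (enorm_integral_le_lintegral_enorm _).trans (le_of_eq ?_)
          simp_rw [enorm_mul]
      _ ≤ _ := pow_le_pow_left' h 2
      _ = _ := by
          rw [mul_pow, e2, e2, lintegral_sub_left_eq_self (fun y => ‖K y‖ₑ) x]
  have hm : Measurable (Function.uncurry fun x y : Rn1 m => ‖K (x - y)‖ₑ * ‖f y‖ₑ ^ 2) :=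
    ((hKm.comp (measurable_fst.sub measurable_snd)).enorm).mul
      ((hfm.comp measurable_snd).enorm.pow_const _)
  refine (lintegral_mono hpt).trans (le_of_eq ?_)
  rw [lintegral_const_mul _ (by exact hm.lintegral_prod_right'), lintegral_lintegral_swap hm.aemeasurable]
  have : ∀ y, ∫⁻ x, ‖K (x - y)‖ₑ * ‖f y‖ₑ ^ 2 = (∫⁻ x, ‖K x‖ₑ) * ‖f y‖ₑ ^ 2 := fun y => by
    rw [lintegral_mul_const _ (by exact (hKm.comp (measurable_id.sub_const y)).enorm),
      lintegral_sub_right_eq_self (fun x => ‖K x‖ₑ) y]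
  simp_rw [this]
  rw [lintegral_const_mul _ (hfm.enorm.pow_const _), ← mul_assoc, pow_two]

lemma lintegral_conv1_sq_le {m : ℕ} {K : Rn1 m → ℂ} (hKm : Measurable K)
    (hK : Integrable K) {B : ℝ≥0} (hB : ∀ q, ‖FT1 K q‖ₑ ≤ B) {g : Rn1 m → ℂ}
    (hg : Integrable g) (hgb : ∃ C, ∀ x, ‖g x‖ ≤ C) :
    ∫⁻ x, ‖conv1 K g x‖ₑ ^ 2 ≤ (B : ℝ≥0∞) ^ 2 * ∫⁻ x, ‖g x‖ₑ ^ 2 := by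
  have hg2 : MemLp g 2 := by
    obtain ⟨C, hC⟩ := hgb
    rw [memLp_two_iff_integrable_sq_norm hg.1]
    simp_rw [pow_two]
    exact hg.norm.bdd_mul (c := C) hg.1.norm (ae_of_all _ fun x => by simpa using hC x)
  have hL2 : ∀ u : Rn1 m → ℂ, eLpNorm u 2 = (∫⁻ x, ‖u x‖ₑ ^ 2) ^ (1 / 2 : ℝ) := fun u => by
    rw [eLpNorm_eq_lintegral_rpow_enorm_toReal (by norm_num) (by norm_num)]
    norm_num
  have hsq : ∀ a b c : ℝ≥0∞, a ^ (1 / 2 : ℝ) ≤ c * b ^ (1 / 2 : ℝ) ↔ a ≤ c ^ 2 * b := by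
    intro a b c
    have : c * b ^ (1 / 2 : ℝ) = (c ^ 2 * b) ^ (1 / 2 : ℝ) := by
      rw [ENNReal.mul_rpow_of_nonneg _ _ (by norm_num), ← ENNReal.rpow_natCast,
        ← ENNReal.rpow_mul]
      norm_num
    rw [this, ENNReal.rpow_le_rpow_iff (by norm_num)]
  have hyoung : ∀ u : Rn1 m → ℂ, AEStronglyMeasurable u →
      eLpNorm (conv1 K u) 2 ≤ (∫⁻ y, ‖K y‖ₑ) * eLpNorm u 2 := fun u hu => by
    rw [hL2, hL2, hsq]; exact lintegral_conv1_sq_le_young hKm hu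
  rw [← hsq, ← hL2, ← hL2]
  refine ENNReal.le_of_forall_pos_le_add fun ε hε _ => ?_
  set N := ∫⁻ y, ‖K y‖ₑ with hN
  have hNt : N ≠ ⊤ := hK.2.ne
  obtain ⟨η, hη, hηε⟩ : ∃ η : ℝ≥0, 0 < η ∧ (N + B) * (η : ℝ≥0∞) ≤ ε := by
    refine ⟨ε / (N.toNNReal + B + 1), by positivity, ?_⟩
    nth_rewrite 1 [← ENNReal.coe_toNNReal hNt]
    norm_cast
    rw [mul_div_assoc', div_le_iff₀ (by positivity)]
    rw [mul_comm]
    exact mul_le_mul_right le_self_add ε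
  have hd := (SchwartzMap.denseRange_toLpCLM (E := Rn1 m) (F := ℂ) (p := 2)
    (μ := volume) (by norm_num)).exists_mem_open (s := Metric.ball (hg2.toLp g) η)
    Metric.isOpen_ball ⟨_, Metric.mem_ball_self (by exact_mod_cast hη)⟩
  obtain ⟨φ, hφ⟩ := hd
  have hdist : eLpNorm (fun x => φ x - g x) 2 volume ≤ η := by
    have h := Metric.mem_ball.1 hφ
    rw [dist_lt_coe, ← edist_lt_coe, Lp.edist_def] at h
    refine le_trans (le_of_eq (eLpNorm_congr_ae ?_)) h.le
    have h1 := φ.coeFn_toLp 2 (volume : Measure (Rn1 m))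
    filter_upwards [h1, hg2.coeFn_toLp] with x hx hx'
    simp only [Pi.sub_apply]
    rw [hx']
    congr 1
    exact hx.symm
  have hsm : AEStronglyMeasurable fun x => g x - φ x := hg.1.sub φ.continuous.aestronglyMeasurable
  have hdist' : eLpNorm (fun x => g x - φ x) 2 volume ≤ η := by
    rw [show (fun x => g x - φ x) = -(fun x => φ x - g x) by funext x; simp, eLpNorm_neg]
    exact hdist
  have hdec : conv1 K g = conv1 K φ + conv1 K (fun x => g x - φ x) := by
    funext x
    obtain ⟨C, hC⟩ := hgb
    obtain ⟨C', hC'⟩ := (nice_schwartz φ).bdd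
    have h1 := integrable_conv1_integrand hK φ.continuous.aestronglyMeasurable ⟨C', hC'⟩ x
    have h2 := integrable_conv1_integrand hK hsm ⟨C + C', fun x =>
      (norm_sub_le _ _).trans (add_le_add (hC x) (hC' x))⟩ x
    rw [Pi.add_apply, conv1, conv1, conv1, ← integral_add h1 h2]
    congr 1; funext y; ring
  have hφg : eLpNorm φ 2 volume ≤ eLpNorm g 2 volume + η := by
    have : (φ : Rn1 m → ℂ) = g + fun x => φ x - g x := by funext x; simp
    rw [this]
    refine (eLpNorm_add_le hg.1 (φ.continuous.aestronglyMeasurable.sub hg.1)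
      (by norm_num)).trans ?_
    gcongr
    exact hdist
  calc eLpNorm (conv1 K g) 2 volume
      ≤ eLpNorm (conv1 K φ) 2 volume + eLpNorm (conv1 K fun x => g x - φ x) 2 volume := by
        rw [hdec]
        exact eLpNorm_add_le (aestronglyMeasurable_conv1 hKm φ.continuous.aestronglyMeasurable)
          (aestronglyMeasurable_conv1 hKm hsm) (by norm_num)
    _ ≤ B * (eLpNorm g 2 volume + η) + N * η := by
        gcongr
        · refine le_trans ?_ (mul_le_mul_right hφg _)
          rw [hL2, hL2, hsq]
          exact lintegral_conv1_schwartz_sq_le hKm hK hB φ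
        · exact (hyoung _ hsm).trans (mul_le_mul_right hdist' _)
    _ = B * eLpNorm g 2 volume + (N + B) * η := by ring
    _ ≤ _ := by gcongr

/-! ### Pointwise bounds for the derivative of the heat kernel -/

/-- The Gaussian `(4πT)^{-n/2} e^{-r/(cT)}`, where `r` is a squared distance. -/
def gaussG (n : ℕ) (c r T : ℝ) : ℝ := Real.exp (-(n / 2 * Real.log (4 * π * T)) - r / (c * T))

/-- `-∂_T` of `e^{-T} (4πT)^{-n/2} e^{-r/(4T)}`. -/
def heatD (n : ℕ) (r T : ℝ) : ℝ :=
  Real.exp (-T - n / 2 * Real.log (4 * π * T) - r / (4 * T)) *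
    (1 + n / (2 * T) - r / (4 * T ^ 2))

/-- The constant in the pointwise bounds. -/
def heatC (n : ℕ) : ℝ := 256 * Real.exp ((n + 1) / 8)

lemma heatC_pos (n : ℕ) : 0 < heatC n := by unfold heatC; positivity

lemma sq_le_exp_div_eight {x : ℝ} (hx : 0 ≤ x) : x ^ 2 ≤ 256 * Real.exp (x / 8) := by
  have h := Real.add_one_le_exp (x / 16)
  have h2 : Real.exp (x / 8) = Real.exp (x / 16) ^ 2 := by
    rw [← Real.exp_nat_mul]; congr 1; push_cast; ring
  rw [h2]
  nlinarith

lemma heat_absorb (n : ℕ) {T u : ℝ} (hT : 0 ≤ T) (hu : 0 ≤ u) (L : ℝ) :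
    Real.exp (-T - L - u / 4) * (T + n + 1 + u) ^ 2
      ≤ heatC n * (Real.exp (-T / 2) * Real.exp (-L - u / 8)) := by
  have h := sq_le_exp_div_eight (x := T + n + 1 + u) (by positivity)
  calc Real.exp (-T - L - u / 4) * (T + n + 1 + u) ^ 2
      ≤ Real.exp (-T - L - u / 4) * (256 * Real.exp ((T + n + 1 + u) / 8)) := by gcongr
    _ = 256 * Real.exp ((n + 1) / 8 + (-T * (7 / 8) - L - u / 8)) := by
        rw [mul_left_comm, ← Real.exp_add]; congr 2; ring
    _ ≤ 256 * Real.exp ((n + 1) / 8 + (-T / 2 + (-L - u / 8))) := by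
        gcongr; linarith
    _ = _ := by rw [heatC, Real.exp_add, Real.exp_add]; ring

lemma abs_heatD_le (n : ℕ) {r T : ℝ} (hr : 0 ≤ r) (hT : 0 < T) :
    |heatD n r T| ≤ heatC n * (T⁻¹ * Real.exp (-T / 2) * gaussG n 8 r T) := by
  set u := r / T with hu
  have hu0 : 0 ≤ u := by positivity
  have hru : r = u * T := by rw [hu]; field_simp
  have h := heat_absorb n hT.le hu0 (n / 2 * Real.log (4 * π * T))
  have e1 : r / (4 * T) = u / 4 := by rw [hru]; field_simp
  have e2 : r / (8 * T) = u / 8 := by rw [hru]; field_simp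
  have e3 : 1 + n / (2 * T) - r / (4 * T ^ 2) = T⁻¹ * (T + n / 2 - u / 4) := by
    rw [hru]; field_simp
  rw [heatD, gaussG, e1, e2, e3, abs_mul, abs_mul, abs_of_pos (Real.exp_pos _),
    abs_of_pos (inv_pos.2 hT)]
  have h2 : |T + n / 2 - u / 4| ≤ (T + n + 1 + u) ^ 2 := by
    have hn : (0 : ℝ) ≤ n := by positivity
    rw [abs_le]
    constructor <;> nlinarith
  calc _ ≤ Real.exp (-T - n / 2 * Real.log (4 * π * T) - u / 4) *
        (T⁻¹ * (T + n + 1 + u) ^ 2) := by gcongr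
    _ = T⁻¹ * (Real.exp (-T - n / 2 * Real.log (4 * π * T) - u / 4) *
        (T + n + 1 + u) ^ 2) := by ring
    _ ≤ T⁻¹ * (heatC n * (Real.exp (-T / 2) *
          Real.exp (-(n / 2 * Real.log (4 * π * T)) - u / 8))) := by gcongr
    _ = _ := by ring

lemma gaussG_eight_le (n : ℕ) {r T δ : ℝ} (hT : 0 < T) (hδ : 0 < δ) (hr : δ ^ 2 ≤ r) :
    T⁻¹ * gaussG n 8 r T ≤ 16 * (δ ^ 2)⁻¹ * gaussG n 16 r T := by
  have h := Real.add_one_le_exp (r / (16 * T))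
  have e : gaussG n 16 r T = gaussG n 8 r T * Real.exp (r / (16 * T)) := by
    rw [gaussG, gaussG, ← Real.exp_add]; congr 1; field_simp; ring
  have hG : 0 < gaussG n 8 r T := Real.exp_pos _
  rw [e, mul_comm (gaussG n 8 r T), ← mul_assoc]
  gcongr
  calc T⁻¹ ≤ 16 * (δ ^ 2)⁻¹ * (r / (16 * T)) := by
        rw [show 16 * (δ ^ 2)⁻¹ * (r / (16 * T)) = T⁻¹ * (r / δ ^ 2) by field_simp]
        exact le_mul_of_one_le_right (by positivity) ((one_le_div (by positivity)).2 hr)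
    _ ≤ _ := by gcongr; linarith

lemma hasDerivAt_heatExp (n : ℕ) {r T : ℝ → ℝ} {r' T' θ : ℝ} (hr : HasDerivAt r r' θ)
    (hT : HasDerivAt T T' θ) (h0 : 0 < T θ) :
    HasDerivAt (fun θ => Real.exp (-T θ - n / 2 * Real.log (4 * π * T θ) - r θ / (4 * T θ)))
      (Real.exp (-T θ - n / 2 * Real.log (4 * π * T θ) - r θ / (4 * T θ)) *
        (-T' - n / 2 * (T' / T θ) - (r' / (4 * T θ) - r θ * T' / (4 * T θ ^ 2)))) θ := by
  have hlog := ((hT.const_mul (4 * π)).log (by positivity)).const_mul ((n : ℝ) / 2)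
  have h4 := hr.div (hT.const_mul 4) (by positivity)
  have h := ((hT.neg.sub hlog).sub h4).exp
  refine HasDerivAt.congr_deriv h ?_
  change Real.exp (-T θ - n / 2 * Real.log (4 * π * T θ) - r θ / (4 * T θ)) * _ = _
  congr 1
  field_simp

lemma hasDerivAt_heatD (n : ℕ) {r T : ℝ → ℝ} {r' T' θ : ℝ} (hr : HasDerivAt r r' θ)
    (hT : HasDerivAt T T' θ) (h0 : 0 < T θ) :
    HasDerivAt (fun θ => heatD n (r θ) (T θ))
      (Real.exp (-T θ - n / 2 * Real.log (4 * π * T θ) - r θ / (4 * T θ)) *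
        ((-T' - n / 2 * (T' / T θ) - (r' / (4 * T θ) - r θ * T' / (4 * T θ ^ 2))) *
          (1 + n / (2 * T θ) - r θ / (4 * T θ ^ 2)) +
          (-(n * T' / (2 * T θ ^ 2)) - (r' / (4 * T θ ^ 2) - r θ * T' / (2 * T θ ^ 3))))) θ := by
  have hE := hasDerivAt_heatExp n hr hT h0
  have h1 := ((hT.const_mul 2).inv (by positivity)).const_mul (n : ℝ)
  have h2 := hr.div ((hT.pow 2).const_mul 4) (by simp only [Pi.pow_apply]; positivity)
  have hP := (h1.const_add 1).sub h2
  have h := hE.mul hP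
  have e : (fun θ => heatD n (r θ) (T θ)) = fun θ =>
      Real.exp (-T θ - n / 2 * Real.log (4 * π * T θ) - r θ / (4 * T θ)) *
        (1 + n * (2 * T θ)⁻¹ - r θ / (4 * T θ ^ 2)) := by
    funext θ; rw [heatD, div_eq_mul_inv (n : ℝ) (2 * T θ)]
  rw [e]
  refine HasDerivAt.congr_deriv h ?_
  change Real.exp _ * _ * (1 + n * (2 * T θ)⁻¹ - r θ / (4 * T θ ^ 2)) +
    Real.exp (-T θ - n / 2 * Real.log (4 * π * T θ) - r θ / (4 * T θ)) *
    (n * (-(2 * T') / (2 * T θ) ^ 2) -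
      (r' * (4 * T θ ^ 2) - r θ * (4 * _)) / (4 * T θ ^ 2) ^ 2) = _
  rw [mul_assoc, ← mul_add]
  congr 1
  simp
  field_simp
  ring

lemma heatD_deriv_core {n s v η a b : ℝ} (hn : 0 ≤ n) (hη : 0 ≤ η)
    (hη1 : η ≤ 1) (ha : |a| ≤ η ^ 2) (hb : |b| ≤ 2 * v * η) :
    |(-a * s ^ 2 - n / 2 * a - b / 4 + v ^ 2 * a / 4) * (s ^ 2 + n / 2 - v ^ 2 / 4)
      + (-(n * a / 2) - b / 4 + v ^ 2 * a / 2)| ≤ 2 * η * (s ^ 2 + n + 1 + v ^ 2) ^ 2 := by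
  have ha' : |a| ≤ η := ha.trans (by nlinarith)
  set x := s ^ 2 + n + 1 + v ^ 2 with hx
  have hx1 : 1 ≤ x := by rw [hx]; nlinarith [sq_nonneg s, sq_nonneg v]
  have hbη : |b| ≤ η * (1 + v ^ 2) := hb.trans (by nlinarith [sq_nonneg (v - 1)])
  obtain ⟨ha1, ha2⟩ := abs_le.1 ha'
  obtain ⟨hb1, hb2⟩ := abs_le.1 hbη
  have hs0 := sq_nonneg s
  have hv0 := sq_nonneg v
  have h1 : |-a * s ^ 2 - n / 2 * a - b / 4 + v ^ 2 * a / 4| ≤ η * x := by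
    rw [hx, abs_le]
    constructor <;> nlinarith
  have h2 : |s ^ 2 + n / 2 - v ^ 2 / 4| ≤ x := by
    rw [hx, abs_le]; constructor <;> linarith
  have h3 : |-(n * a / 2) - b / 4 + v ^ 2 * a / 2| ≤ η * x := by
    rw [hx, abs_le]
    constructor <;> nlinarith
  calc _ ≤ |-a * s ^ 2 - n / 2 * a - b / 4 + v ^ 2 * a / 4| * |s ^ 2 + n / 2 - v ^ 2 / 4|
        + |-(n * a / 2) - b / 4 + v ^ 2 * a / 2| := by
        rw [← abs_mul]; exact abs_add_le _ _
    _ ≤ η * x * x + η * x := by gcongr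
    _ ≤ _ := by nlinarith [mul_nonneg hη (by linarith : 0 ≤ x)]

lemma abs_heatD_deriv_le (n : ℕ) {r T r' T' δ : ℝ} (hr : 0 ≤ r) (hT : 0 < T) (hδ : 0 < δ)
    (hδT : δ ^ 2 ≤ T) (hT' : |T'| ≤ δ ^ 2) (hr' : |r'| ≤ 2 * √r * δ) :
    |Real.exp (-T - n / 2 * Real.log (4 * π * T) - r / (4 * T)) *
        ((-T' - n / 2 * (T' / T) - (r' / (4 * T) - r * T' / (4 * T ^ 2))) *
          (1 + n / (2 * T) - r / (4 * T ^ 2)) +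
          (-(n * T' / (2 * T ^ 2)) - (r' / (4 * T ^ 2) - r * T' / (2 * T ^ 3))))|
      ≤ 2 * heatC n * (δ / (√T * T) * gaussG n 8 r T) := by
  obtain ⟨s, hs, rfl⟩ : ∃ s : ℝ, 0 < s ∧ T = s ^ 2 :=
    ⟨√T, Real.sqrt_pos.2 hT, (Real.sq_sqrt hT.le).symm⟩
  obtain ⟨v, hv, rfl⟩ : ∃ v : ℝ, 0 ≤ v ∧ r = v ^ 2 * s ^ 2 :=
    ⟨√r / s, by positivity, by rw [div_pow, Real.sq_sqrt hr]; field_simp⟩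
  have hsq : √(v ^ 2 * s ^ 2) = v * s := by
    rw [← mul_pow]; exact Real.sqrt_sq (by positivity)
  have hsq2 : √(s ^ 2) = s := Real.sqrt_sq hs.le
  rw [hsq] at hr'
  rw [hsq2]
  have hδs : δ ≤ s := by nlinarith
  have ha : |T' / s ^ 2| ≤ (δ / s) ^ 2 := by
    rw [abs_div, abs_of_pos hT, div_pow]; gcongr
  have hb : |r' / s ^ 2| ≤ 2 * v * (δ / s) := by
    rw [abs_div, abs_of_pos hT, div_le_iff₀ hT]
    refine hr'.trans (le_of_eq ?_)
    field_simp
  have hcore := heatD_deriv_core (n := n) (s := s) (by positivity) (by positivity)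
    ((div_le_one hs).2 hδs) ha hb
  have habs := heat_absorb n hT.le (sq_nonneg v) (n / 2 * Real.log (4 * π * s ^ 2))
  have e1 : v ^ 2 * s ^ 2 / (4 * s ^ 2) = v ^ 2 / 4 := by field_simp
  have e2 : v ^ 2 * s ^ 2 / (8 * s ^ 2) = v ^ 2 / 8 := by field_simp
  set Ex := Real.exp (-s ^ 2 - n / 2 * Real.log (4 * π * s ^ 2) - v ^ 2 / 4) with hEx
  have e3 : ((-T' - n / 2 * (T' / s ^ 2) - (r' / (4 * s ^ 2) -
          v ^ 2 * s ^ 2 * T' / (4 * (s ^ 2) ^ 2))) *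
          (1 + n / (2 * s ^ 2) - v ^ 2 * s ^ 2 / (4 * (s ^ 2) ^ 2)) +
          (-(n * T' / (2 * (s ^ 2) ^ 2)) - (r' / (4 * (s ^ 2) ^ 2) -
          v ^ 2 * s ^ 2 * T' / (2 * (s ^ 2) ^ 3)))) =
      (s ^ 2)⁻¹ * ((-(T' / s ^ 2) * s ^ 2 - n / 2 * (T' / s ^ 2) - (r' / s ^ 2) / 4
        + v ^ 2 * (T' / s ^ 2) / 4) * (s ^ 2 + n / 2 - v ^ 2 / 4)
      + (-(n * (T' / s ^ 2) / 2) - (r' / s ^ 2) / 4 + v ^ 2 * (T' / s ^ 2) / 2)) := by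
    field_simp; ring
  rw [gaussG, e1, e2, e3, abs_mul, abs_mul, abs_of_pos (inv_pos.2 hT),
    abs_of_pos (Real.exp_pos _)]
  have hexp1 : Real.exp (-s ^ 2 / 2) ≤ 1 := by
    rw [Real.exp_le_one_iff]; linarith
  calc _ ≤ Ex * ((s ^ 2)⁻¹ * (2 * (δ / s) * (s ^ 2 + n + 1 + v ^ 2) ^ 2)) := by
        gcongr
    _ = 2 * (δ / (s * s ^ 2)) * (Ex * (s ^ 2 + n + 1 + v ^ 2) ^ 2) := by field_simp
    _ ≤ 2 * (δ / (s * s ^ 2)) * (heatC n * (Real.exp (-s ^ 2 / 2) *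
          Real.exp (-(n / 2 * Real.log (4 * π * s ^ 2)) - v ^ 2 / 8))) := by gcongr
    _ ≤ 2 * (δ / (s * s ^ 2)) * (heatC n * (1 *
          Real.exp (-(n / 2 * Real.log (4 * π * s ^ 2)) - v ^ 2 / 8))) := by
        have := (heatC_pos n).le
        gcongr
    _ = _ := by ring

lemma gaussG_mono_time (n : ℕ) {r R T T₀ δ : ℝ} (hT₀ : 0 < T₀) (h1 : T₀ / 2 ≤ T)
    (h2 : T ≤ 3 / 2 * T₀) (hδ : δ ^ 2 ≤ T₀) (hr : 0 ≤ r) (hR : R ≤ 2 * r + 2 * δ ^ 2) :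
    gaussG n 8 r T ≤ Real.exp (n / 2 * Real.log 2 + 1) * gaussG n 24 R T₀ := by
  have hT : 0 < T := by linarith
  rw [gaussG, gaussG, ← Real.exp_add]
  refine Real.exp_le_exp.2 ?_
  have hlog : Real.log (4 * π * T₀) ≤ Real.log 2 + Real.log (4 * π * T) := by
    rw [← Real.log_mul (by norm_num) (by positivity)]
    refine Real.log_le_log (by positivity) ?_
    nlinarith [Real.pi_pos]
  have h3 : R / (24 * T₀) ≤ 1 + r / (8 * T) := by
    have : r / (12 * T₀) ≤ r / (8 * T) :=
      div_le_div_of_nonneg_left hr (by positivity) (by linarith)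
    have h5 : R / (24 * T₀) ≤ (2 * r + 2 * T₀) / (24 * T₀) := by gcongr; linarith
    have h6 : (2 * r + 2 * T₀) / (24 * T₀) = r / (12 * T₀) + 1 / 12 := by field_simp; norm_num
    linarith
  have hn : (0 : ℝ) ≤ n / 2 := by positivity
  have := mul_le_mul_of_nonneg_left hlog hn
  linarith

/-! ### The parabolic kernel: size and smoothness -/

lemma gaussG_pos (n : ℕ) (c r T : ℝ) : 0 < gaussG n c r T := Real.exp_pos _

lemma integrable_gaussG (n : ℕ) {c T : ℝ} (hc : 0 < c) (hT : 0 < T) :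
    Integrable (fun X : Rn n => gaussG n c (‖X‖ ^ 2) T) ∧
      ∫ X : Rn n, gaussG n c (‖X‖ ^ 2) T = (c / 4) ^ ((n : ℝ) / 2) := by
  have hb : 0 < 1 / (c * T) := by positivity
  have e : ∀ X : Rn n, gaussG n c (‖X‖ ^ 2) T =
      Real.exp (-(n / 2 * Real.log (4 * π * T))) * Real.exp (-(1 / (c * T)) * ‖X‖ ^ 2) := fun X => by
    rw [gaussG, ← Real.exp_add]; congr 1; ring
  have hI := GaussianFourier.integral_rexp_neg_mul_sq_norm (V := Rn n) hb
  simp_rw [e]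
  constructor
  · refine Integrable.const_mul ?_ _
    by_contra hcon
    rw [integral_undef hcon] at hI
    have : 0 < (π / (1 / (c * T))) ^ (((Module.finrank ℝ (Rn n) : ℕ) : ℝ) / 2) := by positivity
    linarith
  · have e' : Real.exp (-(n / 2 * Real.log (4 * π * T))) = ((4 * π * T) ^ ((n : ℝ) / 2))⁻¹ := by
      rw [Real.exp_neg, Real.rpow_def_of_pos (by positivity), mul_comm]
    rw [integral_const_mul, hI, finrank_euclideanSpace_fin, e', ← div_eq_inv_mul,
      ← Real.div_rpow (by positivity) (by positivity)]
    congr 1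
    field_simp

lemma lintegral_gaussG (n : ℕ) {c T : ℝ} (hc : 0 < c) (hT : 0 < T) :
    ∫⁻ X : Rn n, ENNReal.ofReal (gaussG n c (‖X‖ ^ 2) T)
      = ENNReal.ofReal ((c / 4) ^ ((n : ℝ) / 2)) := by
  obtain ⟨h1, h2⟩ := integrable_gaussG n hc hT
  rw [← h2, ofReal_integral_eq_lintegral_ofReal h1 (ae_of_all _ fun X => (gaussG_pos _ _ _ _).le)]

lemma measurable_gaussG (n : ℕ) (c h : ℝ) :
    Measurable fun z : Rn1 n => gaussG n c (‖z.1‖ ^ 2) (z.2 + h) := by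
  unfold gaussG; fun_prop

lemma lintegral_mul_gaussG (n : ℕ) {c h : ℝ} (hc : 0 < c) (hh : 0 ≤ h) {ρ : ℝ → ℝ≥0∞}
    (hρ : Measurable ρ) (h0 : ∀ t ≤ 0, ρ t = 0) :
    ∫⁻ z : Rn1 n, ρ z.2 * ENNReal.ofReal (gaussG n c (‖z.1‖ ^ 2) (z.2 + h))
      = (∫⁻ t, ρ t) * ENNReal.ofReal ((c / 4) ^ ((n : ℝ) / 2)) := by
  have hm : Measurable fun z : Rn1 n =>
      ρ z.2 * ENNReal.ofReal (gaussG n c (‖z.1‖ ^ 2) (z.2 + h)) :=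
    (hρ.comp measurable_snd).mul (measurable_gaussG n c h).ennreal_ofReal
  rw [Measure.volume_eq_prod, lintegral_prod_symm _ hm.aemeasurable, ← lintegral_mul_const _ hρ]
  refine lintegral_congr fun t => ?_
  rcases le_or_gt t 0 with ht | ht
  · simp [h0 t ht]
  · have hm' : Measurable fun X : Rn n => ENNReal.ofReal (gaussG n c (‖X‖ ^ 2) (t + h)) :=
      ((measurable_gaussG n c h).comp (measurable_id.prodMk measurable_const)).ennreal_ofReal
    change ∫⁻ X : Rn n, ρ t * ENNReal.ofReal (gaussG n c (‖X‖ ^ 2) (t + h)) = _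
    rw [lintegral_const_mul _ hm', lintegral_gaussG n hc (by linarith)]

/-- The regularised parabolic kernel `-∂_t (e^{-t} Γ)(X, t + h)`, `t > 0`. -/
def heatK (n : ℕ) (h : ℝ) (z : Rn1 n) : ℂ :=
  if 0 < z.2 then (heatD n (‖z.1‖ ^ 2) (z.2 + h) : ℂ) else 0

lemma measurable_heatK (n : ℕ) (h : ℝ) : Measurable (heatK n h) := by
  unfold heatK heatD
  refine Measurable.ite (measurableSet_lt measurable_const measurable_snd) ?_ measurable_const
  fun_prop

lemma enorm_heatK_le (n : ℕ) {h : ℝ} (hh : 0 < h) (z : Rn1 n) :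
    ‖heatK n h z‖ₑ ≤ (Set.Ioi (0 : ℝ)).indicator
      (fun t => ENNReal.ofReal (heatC n * h⁻¹ * Real.exp (-(1 / 2) * t))) z.2 *
        ENNReal.ofReal (gaussG n 8 (‖z.1‖ ^ 2) (z.2 + h)) := by
  by_cases ht : 0 < z.2
  · rw [heatK, if_pos ht, Set.indicator_of_mem (by exact ht), ← ENNReal.ofReal_mul (by
      have := heatC_pos n; positivity), ← ofReal_norm, Complex.norm_real, Real.norm_eq_abs]
    refine ENNReal.ofReal_le_ofReal ((abs_heatD_le n (sq_nonneg _) (by linarith)).trans ?_)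
    have := (heatC_pos n).le
    have := (gaussG_pos n 8 (‖z.1‖ ^ 2) (z.2 + h)).le
    rw [← mul_assoc, ← mul_assoc]
    gcongr <;> linarith
  · simp [heatK, ht]

lemma integrable_heatK (n : ℕ) {h : ℝ} (hh : 0 < h) : Integrable (heatK n h) := by
  refine ⟨(measurable_heatK n h).aestronglyMeasurable, ?_⟩
  refine (lintegral_mono (enorm_heatK_le n hh)).trans_lt ?_
  rw [lintegral_mul_gaussG n (by norm_num) hh.le]
  · refine ENNReal.mul_lt_top ?_ ENNReal.ofReal_lt_top
    rw [lintegral_indicator measurableSet_Ioi]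
    exact ((integrableOn_exp_mul_Ioi (by norm_num : -(1 / 2 : ℝ) < 0) 0).const_mul
      (heatC n * h⁻¹)).lintegral_lt_top
  · exact Measurable.indicator (by fun_prop) measurableSet_Ioi
  · intro t ht; simp [ht]

lemma enorm_heatK_le_far (n : ℕ) {h δ : ℝ} (hh : 0 < h) (hδ : 0 < δ) {z : Rn1 n}
    (h1 : z.2 ≤ 3 * δ ^ 2) (h2 : 0 < z.2 → δ ≤ ‖z.1‖) :
    ‖heatK n h z‖ₑ ≤ (Set.Ioc 0 (3 * δ ^ 2)).indicator
      (fun _ => ENNReal.ofReal (heatC n * (16 * (δ ^ 2)⁻¹))) z.2 *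
        ENNReal.ofReal (gaussG n 16 (‖z.1‖ ^ 2) (z.2 + h)) := by
  by_cases ht : 0 < z.2
  · rw [heatK, if_pos ht, Set.indicator_of_mem (by exact ⟨ht, h1⟩), ← ENNReal.ofReal_mul (by
      have := heatC_pos n; positivity), ← ofReal_norm, Complex.norm_real, Real.norm_eq_abs]
    have hT : 0 < z.2 + h := by linarith
    refine ENNReal.ofReal_le_ofReal ((abs_heatD_le n (sq_nonneg _) hT).trans ?_)
    have hC := (heatC_pos n).le
    have hG := (gaussG_pos n 8 (‖z.1‖ ^ 2) (z.2 + h)).le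
    have hexp : Real.exp (-(z.2 + h) / 2) ≤ 1 := by rw [Real.exp_le_one_iff]; linarith
    rw [mul_assoc (heatC n)]
    refine mul_le_mul_of_nonneg_left ?_ hC
    refine le_trans ?_ (gaussG_eight_le n hT hδ (pow_le_pow_left₀ hδ.le (h2 ht) 2))
    gcongr
    exact mul_le_of_le_one_right (by positivity) hexp
  · simp [heatK, ht]

/-- The constant in the smoothness estimate. -/
def heatC' (n : ℕ) : ℝ := 2 * heatC n * Real.exp (n / 2 * Real.log 2 + 1)

lemma abs_heatD_sub_le (n : ℕ) {h δ t s : ℝ} (hh : 0 < h) (hδ : 0 < δ) {X Y : Rn n}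
    (ht : 2 * δ ^ 2 < t) (hY : ‖Y‖ ≤ δ) (hs : |s| ≤ δ ^ 2) :
    |heatD n (‖X - Y‖ ^ 2) (t - s + h) - heatD n (‖X‖ ^ 2) (t + h)|
      ≤ heatC' n * δ * (t / 2) ^ (-(3 / 2) : ℝ) * gaussG n 24 (‖X‖ ^ 2) (t + h) := by
  obtain ⟨hs1, hs2⟩ := abs_le.1 hs
  have hr : ∀ θ : ℝ, HasDerivAt (fun θ : ℝ => ‖X - θ • Y‖ ^ 2)
      (2 * inner ℝ (X - θ • Y) (-Y)) θ := fun θ => by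
    have h := ((hasDerivAt_id θ).smul_const Y).const_sub X
    simpa using h.norm_sq
  have hT : ∀ θ : ℝ, HasDerivAt (fun θ : ℝ => t - θ * s + h) (-s) θ := fun θ => by
    simpa using (((hasDerivAt_id θ).mul_const s).const_sub t).add_const h
  have hTb : ∀ θ ∈ Set.Icc (0 : ℝ) 1, |θ * s| ≤ δ ^ 2 := fun θ hθ => by
    rw [abs_mul, abs_of_nonneg hθ.1]
    exact (mul_le_of_le_one_left (abs_nonneg _) hθ.2).trans hs
  have hT1 : ∀ θ ∈ Set.Icc (0 : ℝ) 1, (t + h) / 2 ≤ t - θ * s + h ∧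
      t - θ * s + h ≤ 3 / 2 * (t + h) ∧ δ ^ 2 ≤ t - θ * s + h := fun θ hθ => by
    obtain ⟨h1, h2⟩ := abs_le.1 (hTb θ hθ)
    refine ⟨?_, ?_, ?_⟩ <;> nlinarith
  have hδ2 : 0 < δ ^ 2 := by positivity
  have key := norm_image_sub_le_of_norm_deriv_le_segment_01'
    (f := fun θ : ℝ => heatD n (‖X - θ • Y‖ ^ 2) (t - θ * s + h))
    (C := heatC' n * δ * (t / 2) ^ (-(3 / 2) : ℝ) * gaussG n 24 (‖X‖ ^ 2) (t + h))
    (fun θ hθ => (hasDerivAt_heatD n (hr θ) (hT θ)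
      (by linarith [(hT1 θ hθ).2.2])).hasDerivWithinAt) ?_
  · simpa using key
  intro θ hθ'
  have hθ : θ ∈ Set.Icc (0 : ℝ) 1 := ⟨hθ'.1, hθ'.2.le⟩
  obtain ⟨hTa, hTc, hTd⟩ := hT1 θ hθ
  have hT0 : 0 < t - θ * s + h := by linarith
  have hin : |2 * inner ℝ (X - θ • Y) (-Y)| ≤ 2 * √(‖X - θ • Y‖ ^ 2) * δ := by
    rw [Real.sqrt_sq (norm_nonneg _), abs_mul, abs_two, mul_assoc]
    gcongr
    refine (abs_real_inner_le_norm _ _).trans ?_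
    rw [norm_neg]; gcongr
  refine (abs_heatD_deriv_le n (sq_nonneg _) hT0 hδ hTd (by rwa [abs_neg]) hin).trans ?_
  have hR : ‖X‖ ^ 2 ≤ 2 * ‖X - θ • Y‖ ^ 2 + 2 * δ ^ 2 := by
    have hn : ‖X‖ ≤ ‖X - θ • Y‖ + δ := by
      calc ‖X‖ = ‖(X - θ • Y) + θ • Y‖ := by rw [sub_add_cancel]
        _ ≤ ‖X - θ • Y‖ + ‖θ • Y‖ := norm_add_le _ _
        _ ≤ _ := by
          gcongr
          rw [norm_smul, Real.norm_eq_abs, abs_of_nonneg hθ.1]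
          exact (mul_le_of_le_one_left (norm_nonneg _) hθ.2).trans hY
    nlinarith [sq_nonneg (‖X - θ • Y‖ - δ), norm_nonneg X]
  have hG := gaussG_mono_time n (T₀ := t + h) (by linarith) hTa hTc (by linarith)
    (sq_nonneg ‖X - θ • Y‖) hR
  have hC := (heatC_pos n).le
  have hpow : δ / (√(t - θ * s + h) * (t - θ * s + h)) ≤ δ * (t / 2) ^ (-(3 / 2) : ℝ) := by
    have e : √(t - θ * s + h) * (t - θ * s + h) = (t - θ * s + h) ^ (3 / 2 : ℝ) := by
      rw [Real.sqrt_eq_rpow, ← Real.rpow_add_one hT0.ne']; norm_num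
    rw [e, div_eq_mul_inv, ← Real.rpow_neg hT0.le]
    refine mul_le_mul_of_nonneg_left ?_ hδ.le
    have h1 : 0 < t / 2 := by linarith
    have h2 : t / 2 ≤ t - θ * s + h := by linarith [(abs_le.1 (hTb θ hθ)).2]
    exact Real.rpow_le_rpow_of_nonpos (z := -(3 / 2)) h1 h2 (by norm_num)
  calc _ ≤ 2 * heatC n * (δ * (t / 2) ^ (-(3 / 2) : ℝ) *
        (Real.exp (n / 2 * Real.log 2 + 1) * gaussG n 24 (‖X‖ ^ 2) (t + h))) := by
        have := (gaussG_pos n 8 (‖X - θ • Y‖ ^ 2) (t - θ * s + h)).le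
        have : 0 ≤ t / 2 := by linarith
        gcongr
    _ = _ := by rw [heatC']; ring

lemma lintegral_smooth_weight_le {C δ : ℝ} (hC : 0 ≤ C) (hδ : 0 < δ) :
    ∫⁻ t, (Set.Ioi (2 * δ ^ 2)).indicator
      (fun t => ENNReal.ofReal (C * δ * (t / 2) ^ (-(3 / 2) : ℝ))) t ≤ ENNReal.ofReal (4 * C) := by
  have hδ2 : 0 < 2 * δ ^ 2 := by positivity
  rw [lintegral_indicator measurableSet_Ioi]
  have hi := (integrableOn_Ioi_rpow_of_lt (by norm_num : (-(3 / 2) : ℝ) < -1) hδ2).const_mul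
    (C * δ * (1 / 2) ^ (-(3 / 2) : ℝ))
  have e : ∀ t ∈ Set.Ioi (2 * δ ^ 2), C * δ * (t / 2) ^ (-(3 / 2) : ℝ)
      = C * δ * (1 / 2) ^ (-(3 / 2) : ℝ) * t ^ (-(3 / 2) : ℝ) := fun t ht => by
    rw [mul_assoc (C * δ), ← Real.mul_rpow (by norm_num) (hδ2.trans ht).le]
    congr 2; ring
  rw [setLIntegral_congr_fun measurableSet_Ioi fun t ht => by rw [e t ht],
    ← ofReal_integral_eq_lintegral_ofReal hi, integral_const_mul,
    integral_Ioi_rpow_of_lt (by norm_num) hδ2]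
  · refine ENNReal.ofReal_le_ofReal (le_of_eq ?_)
    rw [show (-(3 / 2) + 1 : ℝ) = -(1 / 2) by norm_num, Real.mul_rpow (by norm_num) (by positivity),
      ← Real.rpow_natCast, ← Real.rpow_mul hδ.le, one_div, Real.inv_rpow (by norm_num),
      ← Real.rpow_neg (by norm_num)]
    norm_num
    rw [Real.rpow_neg_one]
    have h2 : (2 : ℝ) ^ (3 / 2 : ℝ) * 2 ^ (-(1 / 2) : ℝ) = 2 := by
      rw [← Real.rpow_add (by norm_num)]; norm_num
    field_simp
    norm_num at h2 ⊢
    linear_combination 2 * C * h2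
  · filter_upwards [ae_restrict_mem measurableSet_Ioi] with t ht
    have : 0 ≤ t := (hδ2.trans ht).le
    positivity

lemma exists_heatK_hormander (n : ℕ) : ∃ A : ℝ≥0, ∀ h > 0, ∀ δ > 0, ∀ w : Rn1 n,
    ‖w.1‖ ≤ δ → |w.2| ≤ δ ^ 2 →
    ∫⁻ z in {z : Rn1 n | 2 * δ < ‖z.1‖ ∨ 2 * δ ^ 2 < |z.2|},
      ‖heatK n h (z - w) - heatK n h z‖ₑ ≤ A := by
  have hC' : 0 ≤ heatC' n := by have := heatC_pos n; unfold heatC'; positivity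
  set c1 := ENNReal.ofReal (4 * heatC' n) * ENNReal.ofReal ((24 / 4) ^ ((n : ℝ) / 2)) with hc1
  set c2 := ENNReal.ofReal (heatC n * 48) * ENNReal.ofReal ((16 / 4) ^ ((n : ℝ) / 2)) with hc2
  have hfin : c1 + (c2 + c2) ≠ ⊤ := by simp [hc1, hc2, ENNReal.mul_eq_top]
  refine ⟨(c1 + (c2 + c2)).toNNReal, fun h hh δ hδ w hw1 hw2 => ?_⟩
  rw [ENNReal.coe_toNNReal hfin]
  have hδ2 : 0 < δ ^ 2 := by positivity
  obtain ⟨hs1, hs2⟩ := abs_le.1 hw2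
  set ρ1 : ℝ → ℝ≥0∞ := (Set.Ioi (2 * δ ^ 2)).indicator
    (fun t => ENNReal.ofReal (heatC' n * δ * (t / 2) ^ (-(3 / 2) : ℝ))) with hρ1
  set ρ2 : ℝ → ℝ≥0∞ := (Set.Ioc 0 (3 * δ ^ 2)).indicator
    (fun _ => ENNReal.ofReal (heatC n * (16 * (δ ^ 2)⁻¹))) with hρ2
  have hρ1m : Measurable ρ1 := Measurable.indicator (by fun_prop) measurableSet_Ioi
  have hρ2m : Measurable ρ2 := Measurable.indicator (by fun_prop) measurableSet_Ioc
  set G : ℝ → (ℝ → ℝ≥0∞) → Rn1 n → ℝ≥0∞ := fun c ρ z =>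
    ρ z.2 * ENNReal.ofReal (gaussG n c (‖z.1‖ ^ 2) (z.2 + h)) with hG
  have hGm : ∀ c ρ, Measurable ρ → Measurable (G c ρ) := fun c ρ hρ =>
    (hρ.comp measurable_snd).mul (measurable_gaussG n c h).ennreal_ofReal
  have hI1 : ∫⁻ z, G 24 ρ1 z ≤ c1 := by
    rw [lintegral_mul_gaussG n (by norm_num) hh.le hρ1m (fun t ht =>
      Set.indicator_of_notMem (by simp only [Set.mem_Ioi]; linarith) _)]
    exact mul_le_mul_left (lintegral_smooth_weight_le hC' hδ) _
  have hI2 : ∫⁻ z, G 16 ρ2 z ≤ c2 := by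
    rw [lintegral_mul_gaussG n (by norm_num) hh.le hρ2m (fun t ht =>
      Set.indicator_of_notMem (by simp only [Set.mem_Ioc]; intro h; linarith [h.1]) _),
      lintegral_indicator measurableSet_Ioc, lintegral_const, Measure.restrict_apply_univ,
      Real.volume_Ioc, ← ENNReal.ofReal_mul (by have := heatC_pos n; positivity)]
    refine le_of_eq ?_
    rw [hc2]
    congr 2
    field_simp; ring
  have hS : MeasurableSet {z : Rn1 n | 2 * δ < ‖z.1‖ ∨ 2 * δ ^ 2 < |z.2|} :=
    (measurableSet_lt measurable_const measurable_fst.norm).union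
      (measurableSet_lt measurable_const measurable_snd.norm)
  have hpt : ∀ z ∈ {z : Rn1 n | 2 * δ < ‖z.1‖ ∨ 2 * δ ^ 2 < |z.2|},
      ‖heatK n h (z - w) - heatK n h z‖ₑ ≤ G 24 ρ1 z + (G 16 ρ2 z + G 16 ρ2 (z - w)) := by
    intro z hz
    rcases lt_or_ge (2 * δ ^ 2) z.2 with ht | ht
    · refine le_trans ?_ le_self_add
      have hp1 : 0 < (z - w).2 := by rw [Prod.snd_sub]; linarith
      have hp2 : 0 < z.2 := by linarith
      rw [heatK, heatK, if_pos hp1, if_pos hp2, ← Complex.ofReal_sub, ← ofReal_norm,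
        Complex.norm_real, Real.norm_eq_abs]
      simp only [hG, hρ1]
      rw [Set.indicator_of_mem (by exact ht), ← ENNReal.ofReal_mul (by positivity)]
      exact ENNReal.ofReal_le_ofReal (abs_heatD_sub_le n hh hδ ht hw1 hw2)
    · refine le_trans ?_ le_add_self
      have hX : -(2 * δ ^ 2) ≤ z.2 → 2 * δ < ‖z.1‖ := fun h' => by
        rcases hz with h1 | h1
        · exact h1
        · exact absurd (abs_le.2 ⟨h', ht⟩) (not_le.2 h1)
      rw [add_comm]
      refine (enorm_sub_le).trans (add_le_add ?_ ?_)
      · refine enorm_heatK_le_far n hh hδ (by rw [Prod.snd_sub]; linarith) fun h0 => ?_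
        rw [Prod.snd_sub] at h0
        have h1 := hX (by linarith)
        have h2 := norm_sub_norm_le z.1 w.1
        rw [Prod.fst_sub]; linarith
      · exact enorm_heatK_le_far n hh hδ (by linarith) fun h0 => by
          have h1 := hX (by linarith)
          linarith
  calc _ ≤ ∫⁻ z in {z : Rn1 n | 2 * δ < ‖z.1‖ ∨ 2 * δ ^ 2 < |z.2|},
        (G 24 ρ1 z + (G 16 ρ2 z + G 16 ρ2 (z - w))) := setLIntegral_mono' hS hpt
    _ ≤ ∫⁻ z, (G 24 ρ1 z + (G 16 ρ2 z + G 16 ρ2 (z - w))) := setLIntegral_le_lintegral _ _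
    _ = (∫⁻ z, G 24 ρ1 z) + ((∫⁻ z, G 16 ρ2 z) + ∫⁻ z, G 16 ρ2 (z - w)) := by
        rw [lintegral_add_left (hGm _ _ hρ1m), lintegral_add_left (hGm _ _ hρ2m)]
    _ ≤ _ := by
        rw [lintegral_sub_right_eq_self (G 16 ρ2) w]
        gcongr

/-! ### The Fourier transform of the parabolic kernel -/

/-- The exponent `1 + 4π²|ξ|²`. -/
def heatA {n : ℕ} (ξ : Rn n) : ℝ := 1 + 4 * π ^ 2 * ‖ξ‖ ^ 2

lemma one_le_heatA {n : ℕ} (ξ : Rn n) : 1 ≤ heatA ξ := by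
  unfold heatA
  linarith [show 0 ≤ 4 * π ^ 2 * ‖ξ‖ ^ 2 by positivity]

lemma char1_prod_neg {n : ℕ} (X : Rn n) (t : ℝ) (q : Rn1 n) :
    char1 (-(X, t)) q = Complex.exp (((-2 * π * inner ℝ q.1 X : ℝ) : ℂ) * Complex.I) *
      Complex.exp (-(2 * π * q.2 * Complex.I) * t) := by
  rw [char1_neg, ← Complex.exp_add]
  congr 1
  rw [PiLp.inner_apply]
  simp only [RCLike.inner_apply, conj_trivial]
  push_cast
  ring

lemma integral_char_mul_heatExp {n : ℕ} (ξ : Rn n) {T : ℝ} (hT : 0 < T) :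
    ∫ X : Rn n, Complex.exp (((-2 * π * inner ℝ ξ X : ℝ) : ℂ) * Complex.I) *
      ((Real.exp (-T - n / 2 * Real.log (4 * π * T) - ‖X‖ ^ 2 / (4 * T)) : ℝ) : ℂ)
      = ((Real.exp (-(heatA ξ * T)) : ℝ) : ℂ) := by
  have hb : 0 < (((1 / (4 * T) : ℝ) : ℂ)).re := by rw [Complex.ofReal_re]; positivity
  have h := GaussianFourier.integral_cexp_neg_mul_sq_norm_add hb (-2 * π * Complex.I) ξ
  have e : ∀ X : Rn n, Complex.exp (((-2 * π * inner ℝ ξ X : ℝ) : ℂ) * Complex.I) *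
      ((Real.exp (-T - n / 2 * Real.log (4 * π * T) - ‖X‖ ^ 2 / (4 * T)) : ℝ) : ℂ)
      = ((Real.exp (-T - n / 2 * Real.log (4 * π * T)) : ℝ) : ℂ) *
        Complex.exp (-((1 / (4 * T) : ℝ) : ℂ) * ‖X‖ ^ 2 +
          (-2 * π * Complex.I) * (inner ℝ ξ X : ℝ)) := fun X => by
    rw [Complex.ofReal_exp, Complex.ofReal_exp, ← Complex.exp_add, ← Complex.exp_add]
    congr 1
    push_cast
    ring
  simp_rw [e]
  rw [integral_const_mul, h, finrank_euclideanSpace_fin]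
  have e1 : ((π : ℂ) / ((1 / (4 * T) : ℝ) : ℂ)) = ((4 * π * T : ℝ) : ℂ) := by
    push_cast; field_simp
  have e2 : ((n : ℂ) / 2) = (((n : ℝ) / 2 : ℝ) : ℂ) := by push_cast; rfl
  have e3 : (-2 * (π : ℂ) * Complex.I) ^ 2 * (‖ξ‖ : ℂ) ^ 2 / (4 * ((1 / (4 * T) : ℝ) : ℂ))
      = ((-(4 * π ^ 2 * ‖ξ‖ ^ 2 * T) : ℝ) : ℂ) := by
    push_cast
    rw [mul_pow, Complex.I_sq]
    field_simp
    ring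
  rw [e1, e2, e3, ← Complex.ofReal_cpow (by positivity), ← Complex.ofReal_exp,
    ← Complex.ofReal_mul, ← Complex.ofReal_mul, Real.rpow_def_of_pos (by positivity),
    ← Real.exp_add, ← Real.exp_add]
  congr 2
  rw [heatA]; ring

lemma norm_cexp_real_mul_I (x : ℝ) : ‖Complex.exp ((x : ℂ) * Complex.I)‖ = 1 :=
  Complex.norm_exp_ofReal_mul_I x

lemma integral_char_mul_heatD {n : ℕ} (ξ : Rn n) {T₀ : ℝ} (hT₀ : 0 < T₀) :
    ∫ X : Rn n, Complex.exp (((-2 * π * inner ℝ ξ X : ℝ) : ℂ) * Complex.I) *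
      (heatD n (‖X‖ ^ 2) T₀ : ℂ) = ((heatA ξ * Real.exp (-(heatA ξ * T₀)) : ℝ) : ℂ) := by
  set F : ℝ → Rn n → ℂ := fun T X =>
    Complex.exp (((-2 * π * inner ℝ ξ X : ℝ) : ℂ) * Complex.I) *
      ((Real.exp (-T - n / 2 * Real.log (4 * π * T) - ‖X‖ ^ 2 / (4 * T)) : ℝ) : ℂ) with hF
  set F' : ℝ → Rn n → ℂ := fun T X =>
    Complex.exp (((-2 * π * inner ℝ ξ X : ℝ) : ℂ) * Complex.I) *
      ((-heatD n (‖X‖ ^ 2) T : ℝ) : ℂ) with hF'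
  have hFm : ∀ T, Measurable (F T) := fun T => by rw [hF]; fun_prop
  have hF'm : ∀ T, Measurable (F' T) := fun T => by rw [hF']; unfold heatD; fun_prop
  obtain ⟨hg1, -⟩ := integrable_gaussG n (c := 4) (by norm_num) hT₀
  obtain ⟨hg2, -⟩ := integrable_gaussG n (c := 24) (by norm_num) hT₀
  have hs : Set.Ioo (T₀ / 2) (3 / 2 * T₀) ∈ nhds T₀ := Ioo_mem_nhds (by linarith) (by linarith)
  have hder := (hasDerivAt_integral_of_dominated_loc_of_deriv_le (μ := volume) (F := F) (F' := F')
    (bound := fun X => heatC n * (2 / T₀ * (Real.exp (n / 2 * Real.log 2 + 1) *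
      gaussG n 24 (‖X‖ ^ 2) T₀))) hs
    (Filter.Eventually.of_forall fun T => (hFm T).aestronglyMeasurable) ?_
    (hF'm T₀).aestronglyMeasurable ?_ ?_ ?_).2
  · have hev : (fun T => ∫ X, F T X) =ᶠ[nhds T₀] fun T => ((Real.exp (-(heatA ξ * T)) : ℝ) : ℂ) := by
      filter_upwards [lt_mem_nhds hT₀] with T hT using integral_char_mul_heatExp ξ hT
    have h1 := hder.congr_of_eventuallyEq hev.symm
    have h2 : HasDerivAt (fun T : ℝ => ((Real.exp (-(heatA ξ * T)) : ℝ) : ℂ))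
        ((Real.exp (-(heatA ξ * T₀)) * (-(heatA ξ * 1)) : ℝ) : ℂ) T₀ :=
      (((hasDerivAt_id T₀).const_mul (heatA ξ)).neg.exp).ofReal_comp
    have h3 := h1.unique h2
    have e : ∀ X, F' T₀ X = -(Complex.exp (((-2 * π * inner ℝ ξ X : ℝ) : ℂ) * Complex.I) *
      (heatD n (‖X‖ ^ 2) T₀ : ℂ)) := fun X => by simp only [hF']; push_cast; ring
    simp_rw [e, integral_neg] at h3
    rw [neg_eq_iff_eq_neg] at h3
    rw [h3]; push_cast; ring
  · refine (hg1.const_mul (Real.exp (-T₀))).mono' (hFm T₀).aestronglyMeasurable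
      (ae_of_all _ fun X => ?_)
    rw [hF]
    simp only [norm_mul, norm_cexp_real_mul_I, one_mul, Complex.norm_real, Real.norm_eq_abs,
      Real.abs_exp]
    rw [gaussG, ← Real.exp_add]
    exact le_of_eq (by congr 1; ring)
  · refine ae_of_all _ fun X T hT => ?_
    rw [hF']
    simp only [norm_mul, norm_cexp_real_mul_I, one_mul, Complex.norm_real, Real.norm_eq_abs,
      abs_neg]
    have hT0 : 0 < T := by linarith [hT.1]
    refine (abs_heatD_le n (sq_nonneg _) hT0).trans ?_
    have hC := (heatC_pos n).le
    have hG := (gaussG_pos n 8 (‖X‖ ^ 2) T).le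
    have h2 : T⁻¹ ≤ 2 / T₀ := by
      rw [← inv_div]; exact inv_anti₀ (by linarith) hT.1.le
    have h3 : Real.exp (-T / 2) ≤ 1 := by rw [Real.exp_le_one_iff]; linarith
    gcongr
    · exact (mul_le_of_le_one_right (by positivity) h3).trans h2
    · exact gaussG_mono_time n (δ := 0) hT₀ hT.1.le hT.2.le (by simpa using hT₀.le)
        (sq_nonneg _) (by nlinarith [sq_nonneg ‖X‖])
  · exact ((hg2.const_mul _).const_mul _).const_mul _
  · refine ae_of_all _ fun X T hT => ?_
    have hT0 : 0 < T := by linarith [hT.1]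
    have h := (hasDerivAt_heatExp n (hasDerivAt_const T (‖X‖ ^ 2)) (hasDerivAt_id T) hT0)
    refine HasDerivAt.const_mul _ (HasDerivAt.congr_deriv h.ofReal_comp ?_)
    congr 1
    rw [heatD]
    simp only [id]
    ring

lemma FT1_heatK {n : ℕ} {h : ℝ} (hh : 0 < h) (q : Rn1 n) :
    FT1 (heatK n h) q = (heatA q.1 : ℂ) * Complex.exp (-(heatA q.1 * h : ℝ)) /
      (heatA q.1 + 2 * π * q.2 * Complex.I) := by
  have hI : Integrable (fun p => char1 (-p) q * heatK n h p) :=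
    (integrable_heatK n hh).bdd_mul (c := 1) (by
      exact (by fun_prop : Continuous fun p : Rn1 n => char1 (-p) q).aestronglyMeasurable)
      (ae_of_all _ fun p => (norm_char1 _ _).le)
  have hne : (heatA q.1 + 2 * π * q.2 * Complex.I : ℂ) ≠ 0 := fun h0 => by
    have := congrArg Complex.re h0
    simp at this
    linarith [one_le_heatA q.1]
  rw [FT1_eq, Measure.volume_eq_prod]
  rw [Measure.volume_eq_prod] at hI
  rw [integral_prod_symm _ hI]
  have e : ∀ t : ℝ, ∫ X : Rn n, char1 (-(X, t)) q * heatK n h (X, t)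
      = (Set.Ioi (0 : ℝ)).indicator (fun t : ℝ => (heatA q.1 : ℂ) *
        Complex.exp (-(heatA q.1 * h : ℝ)) *
        Complex.exp (-(heatA q.1 + 2 * π * q.2 * Complex.I) * t)) t := fun t => by
    by_cases ht : 0 < t
    · rw [Set.indicator_of_mem (by exact ht)]
      have e1 : ∀ X : Rn n, char1 (-(X, t)) q * heatK n h (X, t) =
          Complex.exp (-(2 * π * q.2 * Complex.I) * t) *
          (Complex.exp (((-2 * π * inner ℝ q.1 X : ℝ) : ℂ) * Complex.I) *
          (heatD n (‖X‖ ^ 2) (t + h) : ℂ)) := fun X => by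
        rw [char1_prod_neg, heatK, if_pos ht]; ring
      simp_rw [e1]
      rw [integral_const_mul, integral_char_mul_heatD _ (by linarith), Complex.ofReal_mul,
        Complex.ofReal_exp, mul_left_comm, ← Complex.exp_add, mul_assoc (heatA q.1 : ℂ),
        ← Complex.exp_add]
      congr 2
      push_cast; ring
    · rw [Set.indicator_of_notMem (by exact ht)]
      simp [heatK, ht]
  simp_rw [e]
  rw [integral_indicator measurableSet_Ioi, integral_const_mul,
    integral_exp_mul_complex_Ioi (by simpa using by linarith [one_le_heatA q.1])]
  simp only [Complex.ofReal_zero, mul_zero, Complex.exp_zero]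
  field_simp

lemma norm_FT1_heatK_le {n : ℕ} {h : ℝ} (hh : 0 < h) (q : Rn1 n) : ‖FT1 (heatK n h) q‖ ≤ 1 := by
  have ha := one_le_heatA q.1
  have hre : heatA q.1 ≤ ‖(heatA q.1 + 2 * π * q.2 * Complex.I : ℂ)‖ := by
    refine le_trans (le_of_eq ?_) (Complex.re_le_norm _)
    simp
  rw [FT1_heatK hh, norm_div, norm_mul, div_le_one (by linarith), Complex.norm_real,
    Real.norm_of_nonneg (by linarith), ← Complex.ofReal_neg, ← Complex.ofReal_exp,
    Complex.norm_real, Real.norm_eq_abs, Real.abs_exp]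
  refine le_trans (mul_le_of_le_one_right (by linarith) ?_) hre
  rw [Real.exp_le_one_iff]
  nlinarith

lemma exists_CZKernel_heatK (n : ℕ) : ∃ A : ℝ≥0, ∀ h > 0, CZKernel A (heatK n h) := by
  obtain ⟨A, hA⟩ := exists_heatK_hormander n
  refine ⟨max 1 A, fun h hh => ⟨measurable_heatK n h, integrable_heatK n hh, fun g hg hgb => ?_,
    fun δ hδ w hw1 hw2 => (hA h hh δ hδ w hw1 hw2).trans (by simp)⟩⟩
  refine (lintegral_conv1_sq_le (B := 1) (measurable_heatK n h) (integrable_heatK n hh)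
    (fun q => ?_) hg hgb).trans ?_
  · rw [← ofReal_norm]
    exact (ENNReal.ofReal_le_ofReal (norm_FT1_heatK_le hh q)).trans (by simp)
  · gcongr
    simp

lemma tendsto_FT1_heatK {n : ℕ} (q : Rn1 n) :
    Filter.Tendsto (fun h => FT1 (heatK n h) q) (nhdsWithin 0 (Set.Ioi 0))
      (nhds (heatA q.1 / (heatA q.1 + 2 * π * q.2 * Complex.I))) := by
  have h1 : Filter.Tendsto (fun h : ℝ => (heatA q.1 : ℂ) * Complex.exp (-(heatA q.1 * h : ℝ)) /
      (heatA q.1 + 2 * π * q.2 * Complex.I)) (nhdsWithin 0 (Set.Ioi 0))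
      (nhds ((heatA q.1 : ℂ) * Complex.exp (-(heatA q.1 * 0 : ℝ)) /
      (heatA q.1 + 2 * π * q.2 * Complex.I))) := by
    refine (Continuous.tendsto ?_ 0).mono_left nhdsWithin_le_nhds
    fun_prop
  simp only [mul_zero, Complex.ofReal_zero, neg_zero, Complex.exp_zero, mul_one] at h1
  refine h1.congr' ?_
  filter_upwards [self_mem_nhdsWithin] with h hh
  rw [FT1_heatK hh]

/-! ### The truncated Hilbert kernel -/

/-- The truncated kernel `(e^{-ε|t|} - e^{-|t|/ε}) / (πt)` of the Hilbert transform. -/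
def hilbK (ε t : ℝ) : ℝ := (Real.exp (-(ε * |t|)) - Real.exp (-(ε⁻¹ * |t|))) / (π * t)

@[fun_prop]
lemma measurable_hilbK (ε : ℝ) : Measurable (hilbK ε) := by unfold hilbK; fun_prop

lemma hilbK_neg (ε t : ℝ) : hilbK ε (-t) = -hilbK ε t := by
  rw [hilbK, hilbK, abs_neg, mul_neg, div_neg]

lemma hasDerivAt_exp_neg_mul (c t : ℝ) :
    HasDerivAt (fun t => Real.exp (-(c * t))) (-c * Real.exp (-(c * t))) t := by
  have h : HasDerivAt (fun t => -(c * t)) (-(c * 1)) t := ((hasDerivAt_id t).const_mul c).neg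
  exact HasDerivAt.congr_deriv h.exp (by ring)

lemma integral_exp_neg_mul_segment {ε t : ℝ} (hε : 0 < ε) (hε1 : ε ≤ 1) (ht : 0 < t) :
    ∫ s in Set.Ioc ε ε⁻¹, Real.exp (-(s * t)) = π * hilbK ε t := by
  have h1 : ε ≤ ε⁻¹ := hε1.trans ((one_le_inv₀ hε).2 hε1)
  rw [← intervalIntegral.integral_of_le h1,
    intervalIntegral.integral_eq_sub_of_hasDerivAt (f := fun s => -(Real.exp (-(s * t)) / t))]
  · rw [hilbK, abs_of_pos ht]; field_simp; ring
  · intro s _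
    have h : HasDerivAt (fun s => -(Real.exp (-(t * s)) / t)) (-(-t * Real.exp (-(t * s)) / t)) s :=
      ((hasDerivAt_exp_neg_mul t s).div_const t).neg
    simp only [mul_comm t] at h
    refine HasDerivAt.congr_deriv h ?_
    field_simp
  · exact Continuous.intervalIntegrable (by fun_prop) _ _

lemma hilbK_nonneg {ε t : ℝ} (hε : 0 < ε) (hε1 : ε ≤ 1) (ht : 0 < t) : 0 ≤ hilbK ε t := by
  have h1 : ε ≤ ε⁻¹ := hε1.trans ((one_le_inv₀ hε).2 hε1)
  rw [hilbK, abs_of_pos ht]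
  refine div_nonneg (sub_nonneg.2 (Real.exp_le_exp.2 ?_)) (by positivity)
  nlinarith

lemma hilbK_le {ε t : ℝ} (hε : 0 < ε) (ht : 0 < t) :
    hilbK ε t ≤ ε⁻¹ * Real.exp (-(ε * t)) := by
  rw [hilbK, abs_of_pos ht, div_le_iff₀ (by positivity)]
  have h2 : Real.exp (-(ε⁻¹ * t)) = Real.exp (-(ε * t)) * Real.exp (-((ε⁻¹ - ε) * t)) := by
    rw [← Real.exp_add]; congr 1; ring
  have h3 := Real.add_one_le_exp (-((ε⁻¹ - ε) * t))
  have hE := Real.exp_pos (-(ε * t))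
  have hπ := Real.pi_gt_three
  have hi : 0 < ε⁻¹ := inv_pos.2 hε
  rw [h2]
  have h4 : 1 - Real.exp (-((ε⁻¹ - ε) * t)) ≤ ε⁻¹ * (π * t) := by
    have : ε⁻¹ * t * 1 ≤ ε⁻¹ * t * π := by gcongr; linarith
    nlinarith [mul_pos hε ht]
  nlinarith

lemma abs_hilbK_le {ε : ℝ} (hε : 0 < ε) (hε1 : ε ≤ 1) (t : ℝ) :
    |hilbK ε t| ≤ ε⁻¹ * Real.exp (-(ε * |t|)) := by
  rcases lt_trichotomy t 0 with ht | rfl | ht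
  · rw [← abs_neg, ← hilbK_neg, abs_of_neg ht, abs_of_nonneg (hilbK_nonneg hε hε1 (by linarith))]
    exact hilbK_le hε (by linarith)
  · simp [hilbK, hε.le]
  · rw [abs_of_pos ht, abs_of_nonneg (hilbK_nonneg hε hε1 ht)]
    exact hilbK_le hε ht

lemma integrable_hilbK {ε : ℝ} (hε : 0 < ε) (hε1 : ε ≤ 1) : Integrable (hilbK ε) := by
  have h2 : Integrable fun t : ℝ => Real.exp (-ε * |t|) := by
    by_contra hcon
    have h3 := integral_comp_abs (f := fun t => Real.exp (-ε * t))
    rw [integral_undef hcon, integral_exp_mul_Ioi (by linarith)] at h3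
    simp [hε.ne'] at h3
  refine (h2.const_mul ε⁻¹).mono' (measurable_hilbK ε).aestronglyMeasurable
    (ae_of_all _ fun t => ?_)
  rw [Real.norm_eq_abs, neg_mul]
  exact abs_hilbK_le hε hε1 t

lemma hasDerivAt_hilbK {ε t : ℝ} (ht : 0 < t) :
    HasDerivAt (hilbK ε) (((1 + ε⁻¹ * t) * Real.exp (-(ε⁻¹ * t)) -
      (1 + ε * t) * Real.exp (-(ε * t))) / (π * t ^ 2)) t := by
  have h1 : HasDerivAt (fun t => (Real.exp (-(ε * t)) - Real.exp (-(ε⁻¹ * t))) / (π * t))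
    _ t := ((hasDerivAt_exp_neg_mul ε t).sub (hasDerivAt_exp_neg_mul ε⁻¹ t)).div
      ((hasDerivAt_id t).const_mul π) (by positivity)
  refine (HasDerivAt.congr_deriv h1 ?_).congr_of_eventuallyEq ?_
  · simp only [Pi.sub_apply]
    generalize ε⁻¹ = η
    field_simp
    ring
  · filter_upwards [lt_mem_nhds ht] with x hx
    rw [hilbK, abs_of_pos hx]

lemma one_add_mul_exp_neg_mem {u : ℝ} (hu : 0 ≤ u) :
    0 ≤ (1 + u) * Real.exp (-u) ∧ (1 + u) * Real.exp (-u) ≤ 1 := by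
  refine ⟨by positivity, ?_⟩
  rw [Real.exp_neg, ← div_eq_mul_inv, div_le_one (Real.exp_pos _), add_comm]
  exact Real.add_one_le_exp u

lemma abs_hilbK_sub_le_of_pos {ε s t d : ℝ} (hε : 0 < ε) (hd : 0 < d) (ht : 2 * d < t)
    (hs : |s| ≤ d) : |hilbK ε (t - s) - hilbK ε t| ≤ 4 * d / t ^ 2 := by
  obtain ⟨hs1, hs2⟩ := abs_le.1 hs
  have hconv : Convex ℝ (Set.Ici (t / 2)) := convex_Ici _
  have key := hconv.norm_image_sub_le_of_norm_hasDerivWithin_le (f := hilbK ε)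
    (C := 4 / t ^ 2) (x := t) (y := t - s)
    (fun x hx => (hasDerivAt_hilbK (by
      have : t / 2 ≤ x := hx
      linarith)).hasDerivWithinAt) (fun x hx => ?_)
      (by rw [Set.mem_Ici]; linarith) (by rw [Set.mem_Ici]; linarith)
  · rw [Real.norm_eq_abs, Real.norm_eq_abs, sub_sub_cancel_left, abs_neg] at key
    refine key.trans ?_
    rw [mul_comm, show 4 * d / t ^ 2 = d * (4 / t ^ 2) by ring]
    gcongr
  · have hx' : t / 2 ≤ x := hx
    have hx0 : 0 < x := by linarith
    obtain ⟨a1, a2⟩ := one_add_mul_exp_neg_mem (u := ε⁻¹ * x) (by positivity)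
    obtain ⟨b1, b2⟩ := one_add_mul_exp_neg_mem (u := ε * x) (by positivity)
    rw [Real.norm_eq_abs, abs_div, abs_of_pos (show 0 < π * x ^ 2 by positivity)]
    have h1 : |(1 + ε⁻¹ * x) * Real.exp (-(ε⁻¹ * x)) - (1 + ε * x) * Real.exp (-(ε * x))| ≤ 1 := by
      rw [abs_le]; constructor <;> linarith
    have ht0 : 0 < t := by linarith
    rw [div_le_div_iff₀ (by positivity) (by positivity)]
    have h3 : t ^ 2 ≤ 4 * (π * x ^ 2) := by
      nlinarith [Real.pi_gt_three, sq_nonneg x]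
    calc _ ≤ 1 * t ^ 2 := by gcongr
      _ ≤ _ := by linarith

lemma abs_hilbK_sub_le {ε s t d : ℝ} (hε : 0 < ε) (hd : 0 < d) (ht : 2 * d < |t|)
    (hs : |s| ≤ d) : |hilbK ε (t - s) - hilbK ε t| ≤ 4 * d / t ^ 2 := by
  rcases le_or_gt 0 t with h | h
  · rw [abs_of_nonneg h] at ht
    exact abs_hilbK_sub_le_of_pos hε hd ht hs
  · rw [abs_of_neg h] at ht
    have := abs_hilbK_sub_le_of_pos (s := -s) hε hd ht (by rwa [abs_neg])
    rw [show -t - -s = -(t - s) by ring, hilbK_neg, hilbK_neg, neg_sq, ← abs_neg] at this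
    convert this using 2
    ring

lemma lintegral_hilb_tail {d : ℝ} (hd : 0 < d) :
    ∫⁻ t in {t : ℝ | 2 * d < |t|}, ENNReal.ofReal (4 * d / t ^ 2) ≤ ENNReal.ofReal 4 := by
  have hd2 : 0 < 2 * d := by linarith
  have e : {t : ℝ | 2 * d < |t|} ⊆ Set.Ioi (2 * d) ∪ Set.Iio (-(2 * d)) := fun t ht => by
    rcases lt_abs.1 (show 2 * d < |t| from ht) with h | h
    · exact Or.inl h
    · exact Or.inr (by rw [Set.mem_Iio]; linarith)
  have hpos : ∫⁻ t in Set.Ioi (2 * d), ENNReal.ofReal (4 * d / t ^ 2) = ENNReal.ofReal 2 := by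
    have hi := (integrableOn_Ioi_rpow_of_lt (by norm_num : (-2 : ℝ) < -1) hd2).const_mul (4 * d)
    have e : ∀ t ∈ Set.Ioi (2 * d), 4 * d / t ^ 2 = 4 * d * t ^ (-2 : ℝ) := fun t ht => by
      rw [Real.rpow_neg (hd2.trans ht).le, div_eq_mul_inv]; norm_cast
    rw [setLIntegral_congr_fun measurableSet_Ioi fun t ht => by rw [e t ht],
      ← ofReal_integral_eq_lintegral_ofReal hi, integral_const_mul,
      integral_Ioi_rpow_of_lt (by norm_num) hd2]
    · congr 1
      norm_num
      rw [Real.rpow_neg_one]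
      field_simp
      norm_num
    · filter_upwards [ae_restrict_mem measurableSet_Ioi] with t ht
      have : 0 < t := hd2.trans ht
      positivity
  have hneg : ∫⁻ t in Set.Iio (-(2 * d)), ENNReal.ofReal (4 * d / t ^ 2) = ENNReal.ofReal 2 := by
    rw [← hpos, ← (Measure.measurePreserving_neg (volume : Measure ℝ)).setLIntegral_comp_preimage_emb
      (Homeomorph.neg ℝ).measurableEmbedding]
    simp
  refine (lintegral_mono_set e).trans ((lintegral_union_le _ _ _).trans ?_)
  rw [hpos, hneg, ← ENNReal.ofReal_add (by norm_num) (by norm_num)]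
  norm_num

/-! ### Calderón–Zygmund estimates for the truncated Hilbert kernel -/

lemma measurePreserving_Rn1_zero :
    MeasurePreserving (fun t : ℝ => ((0, t) : Rn1 0)) volume volume := by
  refine ⟨by fun_prop, ?_⟩
  rw [Measure.volume_eq_prod, volume_euclideanSpace_eq_dirac, Measure.dirac_prod]

lemma measurableEmbedding_Rn1_zero : MeasurableEmbedding (fun t : ℝ => ((0, t) : Rn1 0)) :=
  measurableEmbedding_prodMk_left (0 : Rn 0)

lemma integral_Rn1_zero (g : Rn1 0 → ℂ) : ∫ z, g z = ∫ t : ℝ, g (0, t) :=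
  (measurePreserving_Rn1_zero.integral_comp measurableEmbedding_Rn1_zero g).symm

lemma lintegral_Rn1_zero (g : Rn1 0 → ℝ≥0∞) : ∫⁻ z, g z = ∫⁻ t : ℝ, g (0, t) :=
  (measurePreserving_Rn1_zero.lintegral_comp_emb measurableEmbedding_Rn1_zero g).symm

lemma integrable_Rn1_zero {g : ℝ → ℂ} (hg : Integrable g) :
    Integrable fun z : Rn1 0 => g z.2 :=
  (measurePreserving_Rn1_zero.integrable_comp_emb measurableEmbedding_Rn1_zero).1 hg

/-- The truncated Hilbert kernel as a function on `ℝ^{0+1}`. -/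
def hilbK1 (ε : ℝ) (z : Rn1 0) : ℂ := (hilbK ε z.2 : ℂ)

/-- The Fourier transform of the truncated Hilbert kernel. -/
def hilbM (ε τ : ℝ) : ℂ :=
  -(2 / π * (Real.arctan (ε⁻¹ / (2 * π * τ)) - Real.arctan (ε / (2 * π * τ))) : ℝ) * Complex.I

lemma integral_odd_eq (g : ℝ → ℂ) (hg : Integrable g) :
    ∫ t, g t = ∫ t in Set.Ioi (0 : ℝ), (g t + g (-t)) := by
  have hn : Integrable fun t => g (-t) := hg.comp_neg
  rw [integral_add hg.integrableOn hn.integrableOn, integral_comp_neg_Ioi, neg_zero, add_comm,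
    intervalIntegral.integral_Iic_add_Ioi hg.integrableOn hg.integrableOn]

lemma integral_exp_sub_exp {s : ℝ} (hs : 0 < s) (b : ℝ) :
    ∫ t in Set.Ioi (0 : ℝ), (Complex.exp (-(s + b * Complex.I) * t) -
      Complex.exp (-(s - b * Complex.I) * t)) = -2 * Complex.I * ((b / (b ^ 2 + s ^ 2) : ℝ) : ℂ) := by
  have h1 : (-(s + b * Complex.I)).re < 0 := by simpa using hs
  have h2 : (-(s - b * Complex.I)).re < 0 := by simpa using hs
  rw [integral_sub (integrableOn_exp_mul_complex_Ioi h1 0) (integrableOn_exp_mul_complex_Ioi h2 0),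
    integral_exp_mul_complex_Ioi h1, integral_exp_mul_complex_Ioi h2]
  have n1 : (s + b * Complex.I : ℂ) ≠ 0 := fun h => by
    rw [h] at h1; simp at h1
  have n2 : (s - b * Complex.I : ℂ) ≠ 0 := fun h => by
    rw [h] at h2; simp at h2
  have n3 : (b ^ 2 + s ^ 2 : ℂ) ≠ 0 := by
    have : b ^ 2 + s ^ 2 ≠ 0 := by positivity
    exact_mod_cast this
  have e : (b ^ 2 + s ^ 2 : ℂ) = (s + b * Complex.I) * (s - b * Complex.I) := by
    linear_combination (b : ℂ) ^ 2 * Complex.I_sq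
  simp only [Complex.ofReal_zero, mul_zero, Complex.exp_zero]
  push_cast
  rw [e] at n3 ⊢
  field_simp
  ring

lemma FT1_hilbK1 {ε : ℝ} (hε : 0 < ε) (hε1 : ε ≤ 1) (q : Rn1 0) :
    FT1 (hilbK1 ε) q = hilbM ε q.2 := by
  have h1 : ε ≤ ε⁻¹ := hε1.trans ((one_le_inv₀ hε).2 hε1)
  set b := 2 * π * q.2 with hb
  have hI : Integrable fun t : ℝ => Complex.exp (-(b * t : ℝ) * Complex.I) * (hilbK ε t : ℂ) :=
    (integrable_hilbK hε hε1).ofReal.bdd_mul (c := 1) (by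
      exact (by fun_prop : Continuous fun t : ℝ =>
        Complex.exp (-(b * t : ℝ) * Complex.I)).aestronglyMeasurable)
      (ae_of_all _ fun t => by
        rw [← Complex.ofReal_neg, Complex.norm_exp_ofReal_mul_I])
  have e0 : FT1 (hilbK1 ε) q = ∫ t : ℝ, Complex.exp (-(b * t : ℝ) * Complex.I) * (hilbK ε t : ℂ) := by
    rw [FT1, integral_Rn1_zero]
    refine integral_congr_ae (ae_of_all _ fun t => ?_)
    simp only [hilbK1, Finset.univ_eq_empty, Finset.sum_empty, hb]
    congr 2
    push_cast; ring
  set G : ℝ → ℝ → ℂ := fun t s => Complex.exp (-(s + b * Complex.I) * t) -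
      Complex.exp (-(s - b * Complex.I) * t) with hG
  have e1 : ∀ t ∈ Set.Ioi (0 : ℝ), Complex.exp (-(b * t : ℝ) * Complex.I) * (hilbK ε t : ℂ) +
      Complex.exp (-(b * -t : ℝ) * Complex.I) * (hilbK ε (-t) : ℂ)
      = (π : ℂ)⁻¹ * ∫ s in Set.Ioc ε ε⁻¹, G t s := fun t ht => by
    have e2 : ∀ s : ℝ, G t s = (Complex.exp (-(b * t : ℝ) * Complex.I) -
        Complex.exp (-(b * -t : ℝ) * Complex.I)) * ((Real.exp (-(s * t)) : ℝ) : ℂ) := fun s => by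
      rw [hG, sub_mul, Complex.ofReal_exp, ← Complex.exp_add, ← Complex.exp_add]
      simp only
      congr 2 <;> (push_cast; ring)
    simp_rw [e2]
    rw [integral_const_mul, integral_complex_ofReal, integral_exp_neg_mul_segment hε hε1 ht,
      hilbK_neg]
    have hπ : (π : ℂ) ≠ 0 := by exact_mod_cast Real.pi_ne_zero
    push_cast
    field_simp
    ring
  have hGi : Integrable (Function.uncurry G)
      ((volume.restrict (Set.Ioi (0 : ℝ))).prod (volume.restrict (Set.Ioc ε ε⁻¹))) := by
    have hm : Measurable (Function.uncurry G) := by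
      rw [hG]
      simp only [Function.uncurry_def]
      fun_prop
    have hd : Integrable (fun z : ℝ × ℝ => Real.exp (-ε * z.1) * 2)
        ((volume.restrict (Set.Ioi (0 : ℝ))).prod (volume.restrict (Set.Ioc ε ε⁻¹))) :=
      Integrable.mul_prod (f := fun t => Real.exp (-ε * t)) (g := fun _ => (2 : ℝ))
        (integrableOn_exp_mul_Ioi (by linarith) 0) (integrable_const _)
    refine hd.mono' hm.aestronglyMeasurable ?_
    rw [Measure.prod_restrict]
    filter_upwards [ae_restrict_mem (measurableSet_Ioi.prod measurableSet_Ioc)] with z hz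
    have hz1 : 0 < z.1 := hz.1
    have hz2 : ε < z.2 := hz.2.1
    have hle : Real.exp (-(z.2 * z.1)) ≤ Real.exp (-ε * z.1) := by
      apply Real.exp_le_exp.2; nlinarith
    refine (norm_sub_le _ _).trans ?_
    rw [Complex.norm_exp, Complex.norm_exp]
    have r1 : (-(z.2 + b * Complex.I) * z.1 : ℂ).re = -(z.2 * z.1) := by simp
    have r2 : (-(z.2 - b * Complex.I) * z.1 : ℂ).re = -(z.2 * z.1) := by simp
    rw [r1, r2]
    linarith
  rw [e0, integral_odd_eq _ hI, setIntegral_congr_fun measurableSet_Ioi e1, integral_const_mul,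
    integral_integral_swap hGi, setIntegral_congr_fun measurableSet_Ioc
      fun s hs => integral_exp_sub_exp (hε.trans hs.1) b, integral_const_mul,
    integral_complex_ofReal, ← intervalIntegral.integral_of_le h1, integral_div_sq_add_sq, hilbM, ← hb]
  push_cast
  ring

lemma norm_hilbM_le {ε : ℝ} (hε : 0 < ε) (τ : ℝ) : ‖hilbM ε τ‖ ≤ 1 := by
  have hi : 0 < ε⁻¹ := inv_pos.2 hε
  have key : |Real.arctan (ε⁻¹ / (2 * π * τ)) - Real.arctan (ε / (2 * π * τ))| ≤ π / 2 := by
    set u := ε⁻¹ / (2 * π * τ) with hu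
    set v := ε / (2 * π * τ) with hv
    have hu1 := Real.arctan_lt_pi_div_two u
    have hu2 := Real.neg_pi_div_two_lt_arctan u
    have hv1 := Real.arctan_lt_pi_div_two v
    have hv2 := Real.neg_pi_div_two_lt_arctan v
    rcases le_or_gt 0 τ with h | h
    · have a : 0 ≤ Real.arctan u := Real.arctan_nonneg.2 (by positivity)
      have c : 0 ≤ Real.arctan v := Real.arctan_nonneg.2 (by positivity)
      rw [abs_le]; constructor <;> linarith
    · have hneg : 2 * π * τ ≤ 0 := by nlinarith [Real.pi_pos]
      have a : Real.arctan u ≤ 0 := Real.arctan_le_zero.2 (div_nonpos_of_nonneg_of_nonpos hi.le hneg)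
      have c : Real.arctan v ≤ 0 := Real.arctan_le_zero.2 (div_nonpos_of_nonneg_of_nonpos hε.le hneg)
      rw [abs_le]; constructor <;> linarith
  rw [hilbM, norm_mul, norm_neg, Complex.norm_I, mul_one, Complex.norm_real, Real.norm_eq_abs,
    abs_mul, abs_of_pos (by positivity)]
  calc _ ≤ 2 / π * (π / 2) := by gcongr
    _ = 1 := by field_simp

lemma tendsto_hilbM (τ : ℝ) : Filter.Tendsto (fun ε => hilbM ε τ) (nhdsWithin 0 (Set.Ioi 0))
    (nhds (-(SignType.sign τ : ℝ) * Complex.I)) := by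
  set b := 2 * π * τ with hb
  have hπ := Real.pi_pos
  have h0 : Filter.Tendsto (fun ε : ℝ => Real.arctan (ε / b)) (nhdsWithin 0 (Set.Ioi 0))
      (nhds 0) := by
    have : Continuous fun ε : ℝ => Real.arctan (ε / b) := by fun_prop
    simpa using (this.tendsto 0).mono_left nhdsWithin_le_nhds
  have h1 : Filter.Tendsto (fun ε : ℝ => Real.arctan (ε⁻¹ / b)) (nhdsWithin 0 (Set.Ioi 0))
      (nhds (π / 2 * (SignType.sign τ : ℝ))) := by
    rcases lt_trichotomy τ 0 with h | h | h
    · have hbn : b < 0 := by rw [hb]; nlinarith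
      rw [sign_neg h]
      have := (Real.tendsto_arctan_atBot.mono_right nhdsWithin_le_nhds).comp
        (tendsto_inv_nhdsGT_zero.atTop_mul_const_of_neg (inv_neg''.2 hbn))
      simpa [div_eq_mul_inv, Function.comp_def] using this
    · simp [hb, h]
    · have hbn : 0 < b := by rw [hb]; positivity
      rw [sign_pos h]
      have := (Real.tendsto_arctan_atTop.mono_right nhdsWithin_le_nhds).comp
        (tendsto_inv_nhdsGT_zero.atTop_mul_const (inv_pos.2 hbn))
      simpa [div_eq_mul_inv, Function.comp_def] using this
  have h2 := ((h1.sub h0).const_mul (2 / π)).neg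
  have e : -(2 / π * (π / 2 * (SignType.sign τ : ℝ) - 0)) = -(SignType.sign τ : ℝ) := by
    field_simp; ring
  rw [e] at h2
  have h3 := ((Complex.continuous_ofReal.tendsto _).comp h2).mul_const Complex.I
  simpa [hilbM, hb, Function.comp_def] using h3

lemma exists_CZKernel_hilbK1 : ∃ A : ℝ≥0, ∀ ε > 0, ε ≤ 1 → CZKernel A (hilbK1 ε) := by
  have hm : ∀ ε, Measurable (hilbK1 ε) := fun ε => by unfold hilbK1; fun_prop
  refine ⟨4, fun ε hε hε1 => ⟨hm ε, ?_, fun g hg hgb => ?_, fun δ hδ w hw1 hw2 => ?_⟩⟩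
  · exact integrable_Rn1_zero (integrable_hilbK hε hε1).ofReal
  · refine (lintegral_conv1_sq_le (B := 1) (hm ε)
      (integrable_Rn1_zero (integrable_hilbK hε hε1).ofReal) (fun q => ?_) hg hgb).trans ?_
    · rw [← ofReal_norm, FT1_hilbK1 hε hε1]
      exact (ENNReal.ofReal_le_ofReal (norm_hilbM_le hε _)).trans (by simp)
    · gcongr
      norm_num
  · have hs : {z : Rn1 0 | 2 * δ < ‖z.1‖ ∨ 2 * δ ^ 2 < |z.2|}
        = Prod.snd ⁻¹' {t : ℝ | 2 * δ ^ 2 < |t|} := by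
      ext z
      have : z.1 = 0 := Subsingleton.elim _ _
      simp only [Set.mem_ofPred_eq, this, norm_zero, Set.mem_preimage]
      exact or_iff_right (by linarith)
    have hms : MeasurableSet {t : ℝ | 2 * δ ^ 2 < |t|} :=
      measurableSet_lt measurable_const (by fun_prop)
    rw [hs, ← lintegral_indicator (measurable_snd hms), lintegral_Rn1_zero]
    refine le_trans ?_ ((lintegral_hilb_tail (show 0 < δ ^ 2 by positivity)).trans (by simp))
    rw [← lintegral_indicator hms]
    refine lintegral_mono fun t => ?_
    by_cases ht : 2 * δ ^ 2 < |t|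
    · rw [Set.indicator_of_mem (by exact ht), Set.indicator_of_mem (by exact ht), ← ofReal_norm]
      refine ENNReal.ofReal_le_ofReal ?_
      rw [hilbK1, hilbK1, ← Complex.ofReal_sub, Complex.norm_real, Real.norm_eq_abs]
      exact abs_hilbK_sub_le hε (by positivity) ht hw2
    · rw [Set.indicator_of_notMem (by exact ht)]
      exact zero_le

/-! ### The truncated Hilbert transform in the time variable -/

/-- Truncated Hilbert transform acting in the time variable. -/
def hilbOp {n : ℕ} (ε : ℝ) (f : Rn1 n → ℂ) (z : Rn1 n) : ℂ :=
  ∫ s : ℝ, (hilbK ε s : ℂ) * f (z.1, z.2 - s)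

lemma hilbOp_eq_conv1 {n : ℕ} (ε : ℝ) (f : Rn1 n → ℂ) (X : Rn n) (t : ℝ) :
    hilbOp ε f (X, t) = conv1 (hilbK1 ε) (fun w : Rn1 0 => f (X, w.2)) (0, t) := by
  rw [conv1_eq_integral_sub, integral_Rn1_zero]
  rfl

lemma Nice.continuous_hilbOp {n : ℕ} {ε : ℝ} (hε : 0 < ε) (hε1 : ε ≤ 1) {f : Rn1 n → ℂ}
    (hf : Nice f) : Continuous (hilbOp ε f) := by
  obtain ⟨C, hC⟩ := hf.bdd
  have hK := (integrable_hilbK hε hε1).ofReal (𝕜 := ℂ)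
  refine continuous_of_dominated (bound := fun s => C * ‖(hilbK ε s : ℂ)‖) (fun x => ?_)
      (fun x => ae_of_all _ fun s => ?_) (hK.norm.const_mul C) (ae_of_all _ fun y => ?_)
  · exact hK.aestronglyMeasurable.mul
      (hf.cont.comp (by fun_prop : Continuous fun s : ℝ => (x.1, x.2 - s))).aestronglyMeasurable
  · rw [norm_mul, mul_comm]; gcongr; exact hC _
  · exact continuous_const.mul (hf.cont.comp
      (by fun_prop : Continuous fun x : Rn1 n => (x.1, x.2 - y)))

lemma Nice.ae_nice_slice {n : ℕ} {f : Rn1 n → ℂ} (hf : Nice f) :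
    ∀ᵐ X : Rn n, Nice fun w : Rn1 0 => f (X, w.2) := by
  have := Integrable.prod_right_ae (μ := (volume : Measure (Rn n))) (ν := (volume : Measure ℝ))
    hf.int
  filter_upwards [this] with X hX
  obtain ⟨C, hC⟩ := hf.bdd
  exact ⟨hf.cont.comp (by fun_prop), integrable_Rn1_zero hX, C, fun x => hC _⟩

lemma exists_lintegral_hilbOp_le {p : ℝ} (hp : 1 < p) : ∃ C : ℝ≥0, ∀ (n : ℕ) (ε : ℝ), 0 < ε →
    ε ≤ 1 → ∀ f : Rn1 n → ℂ, Nice f → ∫⁻ z, ‖hilbOp ε f z‖ₑ ^ p ≤ C * ∫⁻ z, ‖f z‖ₑ ^ p := by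
  obtain ⟨A, hA⟩ := exists_CZKernel_hilbK1
  obtain ⟨C, hC⟩ := CZKernel.exists_lintegral_rpow_le 0 A hp
  refine ⟨C, fun n ε hε hε1 f hf => ?_⟩
  have hm1 : Measurable fun z => ‖hilbOp ε f z‖ₑ ^ p :=
    (hf.continuous_hilbOp hε hε1).measurable.enorm.pow_const p
  have hm2 : Measurable fun z => ‖f z‖ₑ ^ p := hf.cont.measurable.enorm.pow_const p
  rw [Measure.volume_eq_prod, lintegral_prod _ hm1.aemeasurable, lintegral_prod _ hm2.aemeasurable,
    ← lintegral_const_mul' _ _ ENNReal.coe_ne_top]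
  refine lintegral_mono_ae ?_
  filter_upwards [hf.ae_nice_slice] with X hX
  have := hC _ (hA ε hε hε1) _ hX
  rw [lintegral_Rn1_zero, lintegral_Rn1_zero] at this
  simpa only [hilbOp_eq_conv1] using this

lemma hilbOp_IFT1 {n : ℕ} {ε : ℝ} (hε : 0 < ε) (hε1 : ε ≤ 1) {ψ : Rn1 n → ℂ}
    (hψ : Integrable ψ) (x : Rn1 n) :
    hilbOp ε (IFT1 ψ) x = IFT1 (fun q => hilbM ε q.2 * ψ q) x := by
  have hK := (integrable_hilbK hε hε1).ofReal (𝕜 := ℂ)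
  have hM : ∀ τ : ℝ, hilbM ε τ = ∫ s : ℝ, char1 (0, -s) ((0, τ) : Rn1 0) * (hilbK ε s : ℂ) := by
    intro τ
    rw [← FT1_hilbK1 hε hε1 ((0, τ) : Rn1 0), FT1_eq, integral_Rn1_zero]
    simp only [Prod.neg_mk, neg_zero]
    rfl
  have hc : ∀ (q : Rn1 n) (s : ℝ), char1 q (x.1, x.2 - s)
      = char1 q x * char1 (0, -s) ((0, q.2) : Rn1 0) := by
    intro q s
    simp only [char1]
    rw [← Complex.exp_add]
    congr 1
    push_cast
    simp
    ring
  rw [IFT1_eq]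
  unfold hilbOp
  simp_rw [IFT1_eq, hM, ← integral_const_mul, ← integral_mul_const, ← integral_const_mul]
  rw [integral_integral_swap]
  · refine integral_congr_ae (ae_of_all _ fun q => integral_congr_ae (ae_of_all _ fun s => ?_))
    change (hilbK ε s : ℂ) * (char1 q (x.1, x.2 - s) * ψ q)
      = char1 q x * (char1 (0, -s) ((0, q.2) : Rn1 0) * (hilbK ε s : ℂ) * ψ q)
    rw [hc]
    ring
  · refine ((hK.mul_prod hψ).bdd_mul (c := 1)
      (f := fun z : ℝ × Rn1 n => char1 z.2 (x.1, x.2 - z.1)) ?_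
      (ae_of_all _ fun q => (norm_char1 _ _).le)).congr (ae_of_all _ fun z => ?_)
    · exact (by fun_prop : Continuous fun z : ℝ × Rn1 n =>
        char1 z.2 (x.1, x.2 - z.1)).aestronglyMeasurable
    · exact mul_left_comm _ _ _

/-! ### The limiting multiplier -/

/-- The multiplier of `(1 + H) ∂ₜ (∂ₜ + 1 - Δ)⁻¹`. -/
def limM {n : ℕ} (q : Rn1 n) : ℂ :=
  (1 - (SignType.sign q.2 : ℝ) * Complex.I) *
    (1 - heatA q.1 / (heatA q.1 + 2 * π * q.2 * Complex.I))

lemma Nice.sub {m : ℕ} {f g : Rn1 m → ℂ} (hf : Nice f) (hg : Nice g) :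
    Nice fun x => f x - g x := by
  obtain ⟨C, hC⟩ := hf.bdd
  obtain ⟨D, hD⟩ := hg.bdd
  exact ⟨hf.cont.sub hg.cont, hf.int.sub hg.int, C + D,
    fun x => (norm_sub_le _ _).trans (add_le_add (hC x) (hD x))⟩

lemma lintegral_add_rpow_le {m : ℕ} {f g : Rn1 m → ℂ} (hg : Continuous g) {p : ℝ}
    (hp : 1 ≤ p) : ∫⁻ x, ‖f x + g x‖ₑ ^ p
      ≤ 2 ^ (p - 1) * ((∫⁻ x, ‖f x‖ₑ ^ p) + ∫⁻ x, ‖g x‖ₑ ^ p) := by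
  rw [← lintegral_add_right _ (hg.measurable.enorm.pow_const p),
    ← lintegral_const_mul' _ _ (by simp)]
  refine lintegral_mono fun x => ?_
  refine le_trans ?_ (ENNReal.rpow_add_le_mul_rpow_add_rpow _ _ hp)
  exact ENNReal.rpow_le_rpow (enorm_add_le _ _) (by linarith)

lemma exists_lintegral_limM_le (n : ℕ) {p : ℝ} (hp : 1 < p) : ∃ C : ℝ≥0,
    ∀ φ : SchwartzMap (Rn1 n) ℂ, ∫⁻ x, ‖MOp limM φ x‖ₑ ^ p ≤ C * ∫⁻ x, ‖φ x‖ₑ ^ p := by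
  obtain ⟨C₁, hC₁⟩ := exists_lintegral_hilbOp_le hp
  obtain ⟨A, hA⟩ := exists_CZKernel_heatK n
  obtain ⟨C₂, hC₂⟩ := CZKernel.exists_lintegral_rpow_le n A hp
  refine ⟨2 ^ (p - 1) * (1 + C₁) * (2 ^ (p - 1) * (1 + C₂)), fun φ => ?_⟩
  obtain ⟨ψ, h1, h2⟩ := exists_schwartz_FT1 φ
  have hψ : Integrable ψ := ψ.integrable
  set e : ℕ → ℝ := fun k => 1 / ((k : ℝ) + 1) with he
  have he0 : ∀ k, 0 < e k := fun k => by positivity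
  have he1 : ∀ k, e k ≤ 1 := fun k => by
    rw [he]; simp only; rw [div_le_one (by positivity)]
    linarith [(Nat.cast_nonneg k : (0 : ℝ) ≤ k)]
  have helim : Filter.Tendsto e Filter.atTop (nhdsWithin 0 (Set.Ioi 0)) :=
    tendsto_nhdsWithin_iff.2 ⟨tendsto_one_div_add_atTop_nhds_zero_nat,
      Filter.Eventually.of_forall he0⟩
  set S : ℕ → Rn1 n → ℂ := fun k x => φ x - conv1 (heatK n (e k)) φ x with hS
  have hKi := fun k => integrable_heatK n (he0 k)
  have hSn : ∀ k, Nice (S k) := fun k => (nice_schwartz φ).sub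
    ((nice_schwartz φ).conv1 (measurable_heatK n _) (hKi k))
  set u : ℕ → Rn1 n → ℂ := fun k q => (1 - FT1 (heatK n (e k)) q) * ψ q with hu
  have hFc : ∀ k, Continuous (FT1 (heatK n (e k))) := fun k => continuous_FT1 (hKi k)
  have hFi : ∀ k, Integrable fun q => FT1 (heatK n (e k)) q * ψ q := fun k =>
    hψ.bdd_mul (c := 1) (hFc k).aestronglyMeasurable
      (ae_of_all _ fun q => norm_FT1_heatK_le (he0 k) q)
  have hui : ∀ k, Integrable (u k) := fun k =>
    (hψ.sub (hFi k)).congr (ae_of_all _ fun q => by simp [hu, sub_mul])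
  have hSu : ∀ k, S k = IFT1 (u k) := by
    intro k
    funext x
    have hφ : (φ : Rn1 n → ℂ) = IFT1 ψ := funext fun x => (h2 x).symm
    rw [hS]
    simp only
    rw [hφ, conv1_IFT1 (hKi k) hψ, IFT1_eq, IFT1_eq, IFT1_eq,
      ← integral_sub (integrable_char1_mul hψ x) (integrable_char1_mul (hFi k) x)]
    refine integral_congr_ae (ae_of_all _ fun q => ?_)
    simp only [hu]
    ring
  set T : ℕ → Rn1 n → ℂ := fun k x => S k x + hilbOp (e k) (S k) x with hT
  have hMm : ∀ k, Measurable fun q : Rn1 n => hilbM (e k) q.2 := fun k => by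
    unfold hilbM; fun_prop
  have hMu : ∀ k, Integrable fun q => hilbM (e k) q.2 * u k q := fun k =>
    (hui k).bdd_mul (c := 1) (hMm k).aestronglyMeasurable
      (ae_of_all _ fun q => norm_hilbM_le (he0 k) _)
  have hTint : ∀ k x, T k x
      = ∫ q, char1 q x * ((1 + hilbM (e k) q.2) * (1 - FT1 (heatK n (e k)) q) * ψ q) := by
    intro k x
    rw [hT]
    simp only
    rw [hSu k, hilbOp_IFT1 (he0 k) (he1 k) (hui k), IFT1_eq, IFT1_eq,
      ← integral_add (integrable_char1_mul (hui k) x) (integrable_char1_mul (hMu k) x)]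
    refine integral_congr_ae (ae_of_all _ fun q => ?_)
    simp only [hu]
    ring
  have hTb : ∀ k, ∫⁻ x, ‖T k x‖ₑ ^ p
      ≤ (2 ^ (p - 1) * (1 + C₁) * (2 ^ (p - 1) * (1 + C₂)) : ℝ≥0) * ∫⁻ x, ‖φ x‖ₑ ^ p := by
    intro k
    have b1 : ∫⁻ x, ‖T k x‖ₑ ^ p ≤ 2 ^ (p - 1) * ((1 + C₁) * ∫⁻ x, ‖S k x‖ₑ ^ p) := by
      refine (lintegral_add_rpow_le ((hSn k).continuous_hilbOp (he0 k) (he1 k)) hp.le).trans ?_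
      rw [add_mul, one_mul]
      gcongr
      exact hC₁ n _ (he0 k) (he1 k) _ (hSn k)
    have b2 : ∫⁻ x, ‖S k x‖ₑ ^ p ≤ 2 ^ (p - 1) * ((1 + C₂) * ∫⁻ x, ‖φ x‖ₑ ^ p) := by
      have hn := (nice_schwartz φ).conv1 (measurable_heatK n (e k)) (hKi k)
      have := lintegral_add_rpow_le (f := φ) hn.cont.neg hp.le
      simp only [Pi.neg_apply, enorm_neg, ← sub_eq_add_neg] at this
      refine this.trans ?_
      rw [add_mul, one_mul]
      gcongr
      exact hC₂ _ (hA _ (he0 k)) _ (nice_schwartz φ)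
    refine (b1.trans (mul_le_mul_right (mul_le_mul_right b2 _) _)).trans (le_of_eq ?_)
    push_cast
    rw [ENNReal.coe_rpow_of_nonneg _ (by linarith)]
    push_cast
    ring
  have hlim : ∀ x, Filter.Tendsto (fun k => T k x) Filter.atTop (nhds (MOp limM φ x)) := by
    intro x
    simp_rw [hTint]
    rw [MOp, IFT1_eq]
    simp_rw [h1]
    refine tendsto_integral_of_dominated_convergence (fun q => 2 * 2 * ‖ψ q‖) (fun k => ?_)
      (hψ.norm.const_mul _) (fun k => ae_of_all _ fun q => ?_) (ae_of_all _ fun q => ?_)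
    · have := hFc k
      exact (by fun_prop : Continuous fun q : Rn1 n => char1 q x).aestronglyMeasurable.mul
        (((aestronglyMeasurable_const.add (hMm k).aestronglyMeasurable).mul
          (aestronglyMeasurable_const.sub this.aestronglyMeasurable)).mul hψ.1)
    · rw [norm_mul, norm_char1, one_mul, norm_mul, norm_mul]
      gcongr
      · refine (norm_add_le _ _).trans ?_
        rw [norm_one]
        linarith [norm_hilbM_le (he0 k) q.2]
      · refine (norm_sub_le _ _).trans ?_
        rw [norm_one]
        linarith [norm_FT1_heatK_le (he0 k) q]
    · have t1 := (tendsto_hilbM q.2).comp helim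
      have t2 := (tendsto_FT1_heatK q).comp helim
      have t3 := (((t1.const_add 1).mul (t2.const_sub 1)).mul_const (ψ q)).const_mul (char1 q x)
      have e1 : (1 + -((SignType.sign q.2 : ℝ) : ℂ) * Complex.I)
          * (1 - heatA q.1 / (heatA q.1 + 2 * π * q.2 * Complex.I)) = limM q := by
        rw [limM]; ring
      rw [← e1]
      exact t3
  calc ∫⁻ x, ‖MOp limM φ x‖ₑ ^ p
      = ∫⁻ x, Filter.liminf (fun k => ‖T k x‖ₑ ^ p) Filter.atTop := by
        refine lintegral_congr fun x => (Filter.Tendsto.liminf_eq ?_).symm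
        exact ((ENNReal.continuous_rpow_const.tendsto _).comp
          ((continuous_enorm.tendsto _).comp (hlim x)))
    _ ≤ Filter.liminf (fun k => ∫⁻ x, ‖T k x‖ₑ ^ p) Filter.atTop :=
        lintegral_liminf_le fun k => by
          exact (((hSn k).cont.add ((hSn k).continuous_hilbOp (he0 k) (he1 k))).measurable.enorm
            ).pow_const p
    _ ≤ _ := by
        refine (Filter.liminf_le_liminf (Filter.Eventually.of_forall hTb)).trans ?_
        simp

/-! ### Scaling in the time variable -/

/-- The dilation `(X, t) ↦ (X, s t)`. -/
def timeScale (n : ℕ) (s : ℝ) (hs : s ≠ 0) : Rn1 n ≃L[ℝ] Rn1 n :=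
  (ContinuousLinearEquiv.refl ℝ (Rn n)).prodCongr
    (ContinuousLinearEquiv.smulLeft (Units.mk0 s hs))

lemma map_timeScale {n : ℕ} {s : ℝ} (hs : 0 < s) :
    (volume : Measure (Rn1 n)).map (timeScale n s hs.ne') = ENNReal.ofReal s⁻¹ • volume := by
  have h := Measure.map_prod_map (volume : Measure (Rn n)) (volume : Measure ℝ)
    measurable_id (measurable_const_mul s)
  rw [Measure.map_id, Real.map_volume_mul_left hs.ne', abs_of_pos (inv_pos.2 hs),
    Measure.prod_smul_right] at h
  exact h.symm

lemma integral_timeScale {n : ℕ} {s : ℝ} (hs : 0 < s) (g : Rn1 n → ℂ) :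
    ∫ z : Rn1 n, g (z.1, s * z.2) = (s : ℂ)⁻¹ * ∫ z, g z := by
  have h := (timeScale n s hs.ne').toHomeomorph.measurableEmbedding.integral_map
    (μ := volume) g
  change ∫ y, g y ∂(Measure.map (timeScale n s hs.ne') volume)
    = ∫ z : Rn1 n, g (z.1, s * z.2) at h
  rw [← h, map_timeScale hs, integral_smul_measure, ENNReal.toReal_ofReal (inv_pos.2 hs).le,
    Complex.real_smul, Complex.ofReal_inv]

lemma lintegral_timeScale {n : ℕ} {s : ℝ} (hs : 0 < s) (g : Rn1 n → ℝ≥0∞) :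
    ∫⁻ z : Rn1 n, g (z.1, s * z.2) = ENNReal.ofReal s⁻¹ * ∫⁻ z, g z := by
  have h := (timeScale n s hs.ne').toHomeomorph.measurableEmbedding.lintegral_map
    (μ := volume) g
  change ∫⁻ y, g y ∂(Measure.map (timeScale n s hs.ne') volume)
    = ∫⁻ z : Rn1 n, g (z.1, s * z.2) at h
  rw [← h, map_timeScale hs, lintegral_smul_measure, smul_eq_mul]

lemma char1_timeScale {n : ℕ} (s : ℝ) (p q : Rn1 n) :
    char1 (p.1, s * p.2) q = char1 p (q.1, s * q.2) := by
  simp only [char1]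
  rw [show s * p.2 * q.2 = p.2 * (s * q.2) by ring]

/-- Dilation of a multiplier in the time variable. -/
lemma MOp_timeScale {n : ℕ} {s : ℝ} (hs : 0 < s) (m f : Rn1 n → ℂ) (x : Rn1 n) :
    MOp (fun q => m (q.1, s⁻¹ * q.2)) f x
      = MOp m (fun z => f (z.1, s⁻¹ * z.2)) (x.1, s * x.2) := by
  have hs' : (s : ℂ) ≠ 0 := by exact_mod_cast hs.ne'
  have hF : ∀ q : Rn1 n, FT1 (fun z => f (z.1, s⁻¹ * z.2)) q = s * FT1 f (q.1, s * q.2) := by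
    intro q
    rw [FT1_eq, FT1_eq]
    have := integral_timeScale (inv_pos.2 hs) fun p : Rn1 n => char1 (-p) (q.1, s * q.2) * f p
    rw [Complex.ofReal_inv, inv_inv] at this
    rw [← this]
    refine integral_congr_ae (ae_of_all _ fun p => ?_)
    simp only
    rw [← char1_timeScale]
    congr 2
    ext1
    · rfl
    · simp [hs.ne']
  rw [MOp, MOp, IFT1_eq, IFT1_eq]
  simp_rw [hF]
  have := integral_timeScale hs fun q : Rn1 n => char1 q x * (m (q.1, s⁻¹ * q.2) * FT1 f q)
  rw [eq_inv_mul_iff_mul_eq₀ hs'] at this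
  rw [← this, ← integral_const_mul]
  refine integral_congr_ae (ae_of_all _ fun q => ?_)
  simp only
  rw [char1_timeScale, inv_mul_cancel_left₀ hs.ne']
  ring

lemma exists_lintegral_limM_timeScale_le (n : ℕ) {p : ℝ} (hp : 1 < p) : ∃ C : ℝ≥0, ∀ s : ℝ,
    0 < s → ∀ φ : SchwartzMap (Rn1 n) ℂ,
    ∫⁻ x, ‖MOp (fun q => limM (q.1, s⁻¹ * q.2)) φ x‖ₑ ^ p ≤ C * ∫⁻ x, ‖φ x‖ₑ ^ p := by
  obtain ⟨C, hC⟩ := exists_lintegral_limM_le n hp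
  refine ⟨C, fun s hs φ => ?_⟩
  set φs := SchwartzMap.compCLMOfContinuousLinearEquiv ℂ
    (timeScale n s⁻¹ (inv_pos.2 hs).ne') φ with hφs
  have hφ : ∀ z : Rn1 n, φs z = φ (z.1, s⁻¹ * z.2) := fun z => rfl
  have h1 := lintegral_timeScale hs fun x => ‖MOp limM φs x‖ₑ ^ p
  have h2 := lintegral_timeScale (inv_pos.2 hs) fun x => ‖φ x‖ₑ ^ p
  rw [inv_inv] at h2
  simp_rw [MOp_timeScale hs]
  change ∫⁻ x : Rn1 n, ‖MOp limM φs (x.1, s * x.2)‖ₑ ^ p ≤ _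
  rw [h1]
  refine (mul_le_mul_right (hC φs) _).trans (le_of_eq ?_)
  simp_rw [hφ]
  rw [h2, mul_left_comm, ← mul_assoc (ENNReal.ofReal s⁻¹), ← ENNReal.ofReal_mul (inv_pos.2 hs).le,
    inv_mul_cancel₀ hs.ne', ENNReal.ofReal_one, one_mul]

/-! ### Averaging over time scales -/

lemma integral_inv_complex_sq_add_sq {b : ℂ} (hb : 0 < b.re)
    (hi : Integrable fun u : ℝ => (b ^ 2 + (u : ℂ) ^ 2)⁻¹) :
    ∫ u : ℝ, (b ^ 2 + (u : ℂ) ^ 2)⁻¹ = π / b := by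
  have hb0 : b ≠ 0 := fun h => by simp [h] at hb
  have hp : ∀ u : ℝ, 0 < (b + u * I).re := fun u => by simpa using hb
  have hm : ∀ u : ℝ, 0 < (b - u * I).re := fun u => by simpa using hb
  have hne : ∀ z : ℂ, 0 < z.re → z ≠ 0 := fun z hz h => by simp [h] at hz
  set F : ℝ → ℂ := fun u => (2 * I * b)⁻¹ * (Complex.log (b + u * I) - Complex.log (b - u * I))
    with hF
  have hder : ∀ u : ℝ, HasDerivAt F (b ^ 2 + (u : ℂ) ^ 2)⁻¹ u := by
    intro u
    have h1 : HasDerivAt (fun u : ℝ => b + (u : ℂ) * I) I u := by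
      simpa using ((hasDerivAt_id u).ofReal_comp.mul_const I).const_add b
    have h2 : HasDerivAt (fun u : ℝ => b - (u : ℂ) * I) (-I) u := by
      simpa using ((hasDerivAt_id u).ofReal_comp.mul_const I).const_sub b
    have h3 := ((h1.clog_real (Or.inl (hp u))).sub (h2.clog_real (Or.inl (hm u)))).const_mul
      (2 * I * b)⁻¹
    refine HasDerivAt.congr_deriv h3 ?_
    have e : b ^ 2 + (u : ℂ) ^ 2 = (b + u * I) * (b - u * I) := by
      ring_nf; rw [I_sq]; ring
    have h2Ib : 2 * I * b ≠ 0 := mul_ne_zero (mul_ne_zero two_ne_zero I_ne_zero) hb0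
    rw [e, sub_eq_add_neg, ← neg_div, neg_neg, div_add_div _ _ (hne _ (hp u)) (hne _ (hm u)),
      show I * (b - u * I) + (b + u * I) * I = 2 * I * b by ring, ← mul_div_assoc,
      inv_mul_cancel₀ h2Ib, one_div]
  have key : Filter.Tendsto (fun u : ℝ => Complex.log (b + u * I) - Complex.log (b - u * I))
      Filter.atTop (nhds (π * I)) := by
    have h0 : Filter.Tendsto (fun u : ℝ => ((u⁻¹ : ℝ) : ℂ) * b) Filter.atTop (nhds 0) := by
      have := ((Complex.continuous_ofReal.tendsto 0).comp tendsto_inv_atTop_zero).mul_const b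
      simpa using this
    have h1 : Filter.Tendsto (fun u : ℝ => Complex.log (((u⁻¹ : ℝ) : ℂ) * b + I)
        - Complex.log (((u⁻¹ : ℝ) : ℂ) * b - I)) Filter.atTop (nhds (π * I)) := by
      have l1 := ((continuousAt_clog (x := I) (by simp [mem_slitPlane_iff])).tendsto).comp
        (by simpa using h0.add_const I : Filter.Tendsto (fun u : ℝ => ((u⁻¹ : ℝ) : ℂ) * b + I)
          Filter.atTop (nhds I))
      have l2 := ((continuousAt_clog (x := -I) (by simp [mem_slitPlane_iff])).tendsto).comp
        (by simpa using h0.sub_const I : Filter.Tendsto (fun u : ℝ => ((u⁻¹ : ℝ) : ℂ) * b - I)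
          Filter.atTop (nhds (-I)))
      have := l1.sub l2
      rw [log_I, log_neg_I] at this
      rw [show (π : ℂ) / 2 * I - -(π / 2) * I = π * I by ring] at this
      exact this
    refine h1.congr' ?_
    filter_upwards [Filter.eventually_gt_atTop 0] with u hu
    have hu' : (u : ℂ) ≠ 0 := by exact_mod_cast hu.ne'
    have e1 : b + u * I = u * (((u⁻¹ : ℝ) : ℂ) * b + I) := by
      push_cast; field_simp
    have e2 : b - u * I = u * (((u⁻¹ : ℝ) : ℂ) * b - I) := by
      push_cast; field_simp
    have n1 : ((u⁻¹ : ℝ) : ℂ) * b + I ≠ 0 := fun h => hne _ (hp u) (by rw [e1, h, mul_zero])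
    have n2 : ((u⁻¹ : ℝ) : ℂ) * b - I ≠ 0 := fun h => hne _ (hm u) (by rw [e2, h, mul_zero])
    rw [e1, e2, log_ofReal_mul hu n1, log_ofReal_mul hu n2]
    ring
  have htop : Filter.Tendsto F Filter.atTop (nhds ((2 * I * b)⁻¹ * (π * I))) :=
    key.const_mul _
  have hbot : Filter.Tendsto F Filter.atBot (nhds ((2 * I * b)⁻¹ * -(π * I))) := by
    have := (key.neg.const_mul (2 * I * b)⁻¹).comp Filter.tendsto_neg_atBot_atTop
    refine this.congr fun u => ?_
    simp only [Function.comp, hF]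
    push_cast
    ring_nf
  rw [integral_of_hasDerivAt_of_tendsto hder hi hbot htop]
  have := I_ne_zero
  field_simp
  ring

/-- The time scales used in the averaging. -/
def avgScale (u : ℝ) : ℝ := 2 * π / (1 + u ^ 2)

lemma avgScale_pos (u : ℝ) : 0 < avgScale u := by
  unfold avgScale
  have := Real.pi_pos
  positivity

lemma measurable_avgScale : Measurable avgScale := by
  unfold avgScale
  fun_prop

/-- The Cauchy distribution. -/
def cauchyProb : Measure ℝ := ProbabilityTheory.cauchyMeasure 0 1

instance : IsProbabilityMeasure cauchyProb := by
  unfold cauchyProb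
  infer_instance

lemma integral_cauchyProb (g : ℝ → ℂ) :
    ∫ u, g u ∂cauchyProb = ∫ u : ℝ, ((π⁻¹ * (1 + u ^ 2)⁻¹ : ℝ) : ℂ) * g u := by
  have hπ := Real.pi_pos
  rw [cauchyProb, ProbabilityTheory.cauchyMeasure_of_scale_ne_zero _ one_ne_zero,
    integral_withDensity_eq_integral_toReal_smul (ProbabilityTheory.measurable_cauchyPDF 0 1)
      (ae_of_all _ fun _ => by exact ENNReal.ofReal_lt_top)]
  refine integral_congr_ae (ae_of_all _ fun u => ?_)
  simp only [ProbabilityTheory.cauchyPDF, ProbabilityTheory.cauchyPDFReal_def]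
  rw [ENNReal.toReal_ofReal (by positivity), Complex.real_smul]
  congr 2
  simp [add_comm]

/-- The symbol is an average of dilates of `limM`. -/
lemma integral_limM_cauchyProb {n : ℕ} (q : Rn1 n) :
    ((|q.2| ^ ((1 : ℝ) / 2) : ℝ) : ℂ) *
      (1 + 4 * (π : ℂ) ^ 2 * (‖q.1‖ : ℂ) ^ 2 + Complex.I * (q.2 : ℂ)) ^ (-(1 : ℂ) / 2)
      = (√2 / 2 : ℝ) * ∫ u, limM (q.1, (avgScale u)⁻¹ * q.2) ∂cauchyProb := by
  have hπ := Real.pi_pos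
  obtain ⟨ξ, τ⟩ := q
  simp only
  rcases eq_or_ne τ 0 with rfl | hτ
  · have : limM (ξ, (0 : ℝ)) = 0 := by
      have h : (heatA ξ : ℂ) ≠ 0 := by
        exact_mod_cast (zero_lt_one.trans_le (one_le_heatA ξ)).ne'
      simp [limM, h]
    simp [this]
  set a := heatA ξ with ha
  have ha1 : 1 ≤ a := one_le_heatA ξ
  set z : ℂ := a + I * τ with hz
  have hz' : 1 + 4 * (π : ℂ) ^ 2 * (‖ξ‖ : ℂ) ^ 2 + Complex.I * (τ : ℂ) = z := by
    rw [hz, ha, heatA]; push_cast; ring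
  set r : ℂ := z ^ (2⁻¹ : ℂ) with hr
  have hr2 : r ^ 2 = z := by
    exact_mod_cast Complex.cpow_nat_inv_pow z (n := 2) two_ne_zero
  have hre : 0 < r.re := by
    rw [hr, cpow_inv_two_re]
    refine Real.sqrt_pos.2 ?_
    have h1 : z.re = a := by simp [hz]
    have := norm_nonneg z
    rw [h1]; linarith
  have hr0 : r ≠ 0 := fun h => by simp [h] at hre
  have him : 2 * (r.re * r.im) = τ := by
    have := congrArg Complex.im hr2
    simp [hz, sq] at this
    linarith
  set σ : ℝ := (SignType.sign τ : ℝ) with hσ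
  have hσ2 : σ ^ 2 = 1 := by
    rcases hτ.lt_or_gt with h | h
    · simp [hσ, sign_neg h]
    · simp [hσ, sign_pos h]
  have hστ : σ * τ = |τ| := by
    rcases hτ.lt_or_gt with h | h
    · simp [hσ, sign_neg h, abs_of_neg h]
    · simp [hσ, sign_pos h, abs_of_pos h]
  have hσp : 0 ≤ r.im * σ := by
    have h2 : 0 ≤ (2 * r.re) * (r.im * σ) := by
      have : (2 * r.re) * (r.im * σ) = σ * τ := by rw [← him]; ring
      rw [this, hστ]; exact abs_nonneg _
    exact nonneg_of_mul_nonneg_right h2 (by positivity)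
  set h : ℝ := √|τ| with hh
  have hh0 : 0 < h := Real.sqrt_pos.2 (abs_pos.2 hτ)
  have hh2 : h ^ 2 = |τ| := Real.sq_sqrt (abs_nonneg _)
  set c : ℝ := √2 / 2 with hc
  have hc2 : c ^ 2 = 1 / 2 := by rw [hc, div_pow, Real.sq_sqrt (by norm_num)]; norm_num
  have hc0 : 0 < c := by positivity
  set b : ℂ := ((c / h : ℝ) : ℂ) * (r * (1 - σ * I)) with hb
  have hbre : 0 < b.re := by
    rw [hb, Complex.re_ofReal_mul]
    refine mul_pos (by positivity) ?_
    simp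
    nlinarith
  have hhC : (h : ℂ) ≠ 0 := by exact_mod_cast hh0.ne'
  have hcC : (c : ℂ) ≠ 0 := by exact_mod_cast hc0.ne'
  have hτC : (τ : ℂ) ≠ 0 := by exact_mod_cast hτ
  have hσC : (σ : ℂ) ^ 2 = 1 := by exact_mod_cast hσ2
  have h1σ : (1 - σ * I : ℂ) ≠ 0 := fun h => by
    have := congrArg Complex.re h
    simp at this
  have hb2 : b ^ 2 = 1 - a / τ * I := by
    have e1 : b ^ 2 = (c : ℂ) ^ 2 / (h : ℂ) ^ 2 * (z * (1 - 2 * σ * I - (σ : ℂ) ^ 2)) := by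
      rw [hb, ← hr2]; push_cast
      ring_nf; rw [I_sq]; ring
    have e2 : (h : ℂ) ^ 2 = σ * τ := by
      have : h ^ 2 = σ * τ := by rw [hh2, hστ]
      exact_mod_cast this
    have e3 : (c : ℂ) ^ 2 = 1 / 2 := by
      rw [← Complex.ofReal_pow, hc2]; norm_num
    have hσ0 : (σ : ℂ) ≠ 0 := fun h => by simp [h] at hσC
    rw [e1, e2, e3, hσC, hz]
    field_simp
    ring_nf
    rw [I_sq]
    ring
  have h_int : Integrable fun u : ℝ => (b ^ 2 + (u : ℂ) ^ 2)⁻¹ := by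
    refine integrable_inv_one_add_sq.mono' (by fun_prop) (ae_of_all _ fun u => ?_)
    rw [norm_inv]
    refine inv_anti₀ (by positivity) (le_trans (le_of_eq ?_) (Complex.re_le_norm _))
    rw [hb2]
    simp [← Complex.ofReal_pow, ← Complex.ofReal_div]
  rw [hz', integral_cauchyProb]
  have hI : ∀ u : ℝ, ((π⁻¹ * (1 + u ^ 2)⁻¹ : ℝ) : ℂ) * limM (ξ, (avgScale u)⁻¹ * τ)
      = (1 - σ * I) * (π : ℂ)⁻¹ * (b ^ 2 + (u : ℂ) ^ 2)⁻¹ := by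
    intro u
    have hu : (1 + (u : ℂ) ^ 2) ≠ 0 := by
      have : (1 + u ^ 2 : ℝ) ≠ 0 := by positivity
      exact_mod_cast this
    have hπC : (π : ℂ) ≠ 0 := by exact_mod_cast hπ.ne'
    have hs : SignType.sign ((avgScale u)⁻¹ * τ) = SignType.sign τ := by
      rw [sign_mul, sign_pos (inv_pos.2 (avgScale_pos u)), one_mul]
    have e1 : 2 * (π : ℂ) * (((avgScale u)⁻¹ * τ : ℝ) : ℂ) = (1 + (u : ℂ) ^ 2) * τ := by
      rw [avgScale]; push_cast; field_simp
    have hD : (a : ℂ) + (1 + (u : ℂ) ^ 2) * τ * I ≠ 0 := fun h => by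
      have := congrArg Complex.re h
      simp [← Complex.ofReal_pow] at this
      linarith
    have hE : b ^ 2 + (u : ℂ) ^ 2 ≠ 0 := fun h => by
      have := congrArg Complex.re h
      rw [hb2] at this
      simp [← Complex.ofReal_pow, ← Complex.ofReal_div] at this
      nlinarith [sq_nonneg u]
    rw [limM]
    simp only
    rw [hs, e1, ← hσ, ← ha]
    have e2 : (1 + (u : ℂ) ^ 2)⁻¹ * (1 - a / (a + (1 + (u : ℂ) ^ 2) * τ * I))
        = (b ^ 2 + (u : ℂ) ^ 2)⁻¹ := by
      rw [hb2] at hE ⊢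
      have : (τ : ℂ) * I * (1 - a / τ * I + (u : ℂ) ^ 2) = a + (1 + (u : ℂ) ^ 2) * τ * I := by
        field_simp; ring_nf; rw [I_sq]; ring
      rw [one_sub_div hD, add_sub_cancel_left, ← this]
      have := I_ne_zero
      generalize 1 - (a : ℂ) / τ * I + (u : ℂ) ^ 2 = X at hE ⊢
      field_simp
    rw [← e2]
    push_cast
    ring
  simp_rw [hI]
  rw [integral_const_mul, integral_inv_complex_sq_add_sq hbre h_int, ← Real.sqrt_eq_rpow, ← hh,
    neg_div, Complex.cpow_neg, one_div, ← hr, hb]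
  have hπC : (π : ℂ) ≠ 0 := by exact_mod_cast hπ.ne'
  push_cast
  field_simp

lemma measurable_limM {n : ℕ} : Measurable (limM (n := n)) := by
  have h : Measurable fun q : Rn1 n => (SignType.sign q.2 : ℝ) := by
    have : (fun x : ℝ => (SignType.sign x : ℝ))
        = fun x => if 0 < x then 1 else if x < 0 then -1 else 0 := by
      funext x
      rw [sign_apply]
      split_ifs <;> simp
    have hm : Measurable fun x : ℝ => (SignType.sign x : ℝ) := by
      rw [this]
      exact Measurable.ite (measurableSet_Ioi (a := (0 : ℝ))) measurable_const
        (Measurable.ite (measurableSet_Iio (a := (0 : ℝ))) measurable_const measurable_const)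
    exact hm.comp measurable_snd
  unfold limM heatA
  fun_prop

lemma measurable_limM_avgScale {α : Type*} [MeasurableSpace α] {n : ℕ} {f : α → Rn1 n}
    {u : α → ℝ} (hf : Measurable f) (hu : Measurable u) :
    Measurable fun a => limM ((f a).1, (avgScale (u a))⁻¹ * (f a).2) :=
  measurable_limM.comp (hf.fst.prodMk ((measurable_avgScale.comp hu).inv.mul hf.snd))

lemma norm_limM_le {n : ℕ} (q : Rn1 n) : ‖limM q‖ ≤ 2 * 2 := by
  have ha := one_le_heatA q.1
  rw [limM, norm_mul]
  gcongr
  · refine (norm_sub_le _ _).trans ?_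
    rw [norm_one, norm_mul, Complex.norm_I, mul_one, Complex.norm_real, Real.norm_eq_abs]
    have : |((SignType.sign q.2 : ℤ) : ℝ)| ≤ 1 := by
      rcases lt_trichotomy q.2 0 with h | h | h <;> simp [h]
    simp only [SignType.intCast_cast] at this
    linarith
  · refine (norm_sub_le _ _).trans ?_
    rw [norm_one, norm_div]
    have h1 : ‖(heatA q.1 : ℂ)‖ ≤ ‖heatA q.1 + 2 * π * q.2 * Complex.I‖ := by
      refine le_trans (le_of_eq ?_) (Complex.re_le_norm _)
      rw [Complex.norm_real, Real.norm_of_nonneg (by linarith)]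
      simp
    linarith [div_le_one_of_le₀ h1 (norm_nonneg _)]

lemma enorm_integral_rpow_le {g : ℝ → ℂ} (hg : AEStronglyMeasurable g cauchyProb) {p : ℝ}
    (hp : 1 ≤ p) : ‖∫ u, g u ∂cauchyProb‖ₑ ^ p ≤ ∫⁻ u, ‖g u‖ₑ ^ p ∂cauchyProb := by
  have hp0 : 0 < p := by linarith
  have h := eLpNorm_le_eLpNorm_of_exponent_le (p := 1) (q := ENNReal.ofReal p)
    (ENNReal.one_le_ofReal.2 hp) hg
  rw [eLpNorm_one_eq_lintegral_enorm, eLpNorm_eq_lintegral_rpow_enorm_toReal (by simpa using hp0)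
    ENNReal.ofReal_ne_top, ENNReal.toReal_ofReal hp0.le] at h
  calc ‖∫ u, g u ∂cauchyProb‖ₑ ^ p
      ≤ ((∫⁻ u, ‖g u‖ₑ ^ p ∂cauchyProb) ^ (1 / p)) ^ p := by
        gcongr
        exact (enorm_integral_le_lintegral_enorm _).trans h
    _ = ∫⁻ u, ‖g u‖ₑ ^ p ∂cauchyProb := by
        rw [← ENNReal.rpow_mul, one_div_mul_cancel hp0.ne', ENNReal.rpow_one]

lemma exists_lintegral_MOp_le (n : ℕ) {p : ℝ} (hp : 1 < p) : ∃ C : ℝ≥0,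
    ∀ φ : SchwartzMap (Rn1 n) ℂ, ∫⁻ x, ‖MOp (fun q => ((|q.2| ^ ((1 : ℝ) / 2) : ℝ) : ℂ) *
      (1 + 4 * (π : ℂ) ^ 2 * (‖q.1‖ : ℂ) ^ 2 + Complex.I * (q.2 : ℂ)) ^ (-(1 : ℂ) / 2)) φ x‖ₑ ^ p
      ≤ C * ∫⁻ x, ‖φ x‖ₑ ^ p := by
  obtain ⟨C, hC⟩ := exists_lintegral_limM_timeScale_le n hp
  refine ⟨C, fun φ => ?_⟩
  obtain ⟨ψ, h1, -⟩ := exists_schwartz_FT1 φ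
  have hψ : Integrable ψ := ψ.integrable
  set G : ℝ → Rn1 n → ℂ := fun u => MOp (fun q => limM (q.1, (avgScale u)⁻¹ * q.2)) φ with hG
  have hGe : ∀ u x, G u x = ∫ q, char1 q x * (limM (q.1, (avgScale u)⁻¹ * q.2) * ψ q) := by
    intro u x
    simp only [hG, MOp, h1, IFT1_eq]
  have hGm : StronglyMeasurable fun z : Rn1 n × ℝ => G z.2 z.1 := by
    simp_rw [hGe]
    refine StronglyMeasurable.integral_prod_right (f := fun (z : Rn1 n × ℝ) (q : Rn1 n) =>
      char1 q z.1 * (limM (q.1, (avgScale z.2)⁻¹ * q.2) * ψ q)) (Measurable.stronglyMeasurable ?_)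
    have m1 : Measurable fun w : (Rn1 n × ℝ) × Rn1 n => char1 w.2 w.1.1 :=
      (by fun_prop : Continuous fun w : (Rn1 n × ℝ) × Rn1 n => char1 w.2 w.1.1).measurable
    have m2 : Measurable fun w : (Rn1 n × ℝ) × Rn1 n =>
        limM (w.2.1, (avgScale w.1.2)⁻¹ * w.2.2) :=
      measurable_limM_avgScale measurable_snd measurable_fst.snd
    exact m1.mul (m2.mul (ψ.continuous.measurable.comp measurable_snd))
  have hrep : ∀ x, MOp (fun q => ((|q.2| ^ ((1 : ℝ) / 2) : ℝ) : ℂ) *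
      (1 + 4 * (π : ℂ) ^ 2 * (‖q.1‖ : ℂ) ^ 2 + Complex.I * (q.2 : ℂ)) ^ (-(1 : ℂ) / 2)) φ x
      = (√2 / 2 : ℝ) * ∫ u, G u x ∂cauchyProb := by
    intro x
    rw [MOp, IFT1_eq]
    simp_rw [integral_limM_cauchyProb, h1, hGe]
    rw [integral_integral_swap, ← integral_const_mul]
    · refine integral_congr_ae (ae_of_all _ fun q => ?_)
      simp only
      rw [integral_const_mul, integral_mul_const]
      ring
    · have hb : Integrable (fun z : ℝ × Rn1 n => (1 : ℂ) * ψ z.2) (cauchyProb.prod volume) :=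
        (integrable_const _).mul_prod hψ
      refine (hb.bdd_mul (c := 2 * 2)
        (f := fun z : ℝ × Rn1 n => char1 z.2 x * limM (z.2.1, (avgScale z.1)⁻¹ * z.2.2)) ?_
        (ae_of_all _ fun z => ?_)).congr (ae_of_all _ fun z => ?_)
      · exact ((by fun_prop : Continuous fun z : ℝ × Rn1 n => char1 z.2 x).measurable.mul
          (measurable_limM_avgScale measurable_snd measurable_fst)).aestronglyMeasurable
      · rw [norm_mul, norm_char1, one_mul]
        exact norm_limM_le _
      · simp only [Function.uncurry]
        ring
  have hc : ‖((√2 / 2 : ℝ) : ℂ)‖ₑ ≤ 1 := by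
    rw [← ofReal_norm, Complex.norm_real, Real.norm_of_nonneg (by positivity),
      ENNReal.ofReal_le_one, div_le_one two_pos, Real.sqrt_le_left two_pos.le]
    norm_num
  have hp0 : 0 ≤ p := by linarith
  calc _ ≤ ∫⁻ x, ∫⁻ u, ‖G u x‖ₑ ^ p ∂cauchyProb := by
        refine lintegral_mono fun x => ?_
        rw [hrep, enorm_mul]
        refine le_trans (ENNReal.rpow_le_rpow (mul_le_of_le_one_left zero_le hc) hp0) ?_
        exact enorm_integral_rpow_le
          (hGm.comp_measurable measurable_prodMk_left).aestronglyMeasurable hp.le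
    _ = ∫⁻ u, (∫⁻ x, ‖G u x‖ₑ ^ p) ∂cauchyProb :=
        lintegral_lintegral_swap (hGm.measurable.enorm.pow_const p).aemeasurable
    _ ≤ ∫⁻ _, (C * ∫⁻ x, ‖φ x‖ₑ ^ p) ∂cauchyProb :=
        lintegral_mono fun u => hC _ (avgScale_pos u) φ
    _ = C * ∫⁻ x, ‖φ x‖ₑ ^ p := by simp

lemma pNorm_eq {n : ℕ} {p : ℝ} (hp : 0 < p) (f : Rn1 n → ℂ) :
    pNorm p f = (∫⁻ x, ‖f x‖ₑ ^ p) ^ (1 / p) := by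
  rw [pNorm, eLpNorm_eq_lintegral_rpow_enorm_toReal (by simpa using hp) ENNReal.ofReal_ne_top,
    ENNReal.toReal_ofReal hp.le]

/-- The symbol `μ_2(ξ,τ) = |τ|^{1/2} (1 + 4π²|ξ|² + iτ)^{−1/2}` is an
`Lᵖ(ℝ^{n+1})`-multiplier, `1 < p < ∞`. -/
theorem stmt3 (n : ℕ) (hn : 1 ≤ n) (p : ℝ) (hp : 1 < p) :
    ∃ M : ℝ, 0 < M ∧
      ∀ f : SchwartzMap (Rn1 n) ℂ,
        pNorm p (MOp (fun q => ((|q.2| ^ ((1 : ℝ) / 2) : ℝ) : ℂ) *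
            (1 + 4 * (π : ℂ) ^ 2 * (‖q.1‖ : ℂ) ^ 2 + Complex.I * (q.2 : ℂ)) ^ (-(1 : ℂ) / 2)) ⇑f)
          ≤ ENNReal.ofReal M * pNorm p ⇑f := by
  have hp0 : 0 < p := by linarith
  obtain ⟨C, hC⟩ := exists_lintegral_MOp_le n hp
  refine ⟨((C : ℝ) + 1) ^ (1 / p), by positivity, fun f => ?_⟩
  rw [pNorm_eq hp0, pNorm_eq hp0, ← ENNReal.ofReal_rpow_of_pos (by positivity),
    ← ENNReal.mul_rpow_of_nonneg _ _ (by positivity)]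
  refine ENNReal.rpow_le_rpow ((hC f).trans ?_) (by positivity)
  gcongr
  rw [← ENNReal.ofReal_coe_nnreal]
  exact ENNReal.ofReal_le_ofReal (by linarith)
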